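/- arXiv:1811.09223 — 2 statements merged into one kernel-verified Lean document; each statement's English description precedes it below -/
import Mathlib

section
/- There is an absolute constant K ≥ 1 such that for every 0 < ε ≤ 1/2 there exist a map Φ: H → ℓ² and a constant c > 0 with c·d(p,p')^{1−ε} ≤ ‖Φ(p) − Φ(p')‖_{ℓ²} ≤ c·K·ε^{−1/2}·d(p,p')^{1−ε} for all p, p' ∈ H; that is, (H, d^{1−ε}) embeds into the Hilbert space ℓ² with distortion O(ε^{−1/2}). -/
open scoped ENNReal NNReal RealInnerProductSpace BigOperators

noncomputable section

/-- The Heisenberg group `H`, identified as a set with `ℝ³`. -/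
abbrev H : Type := ℝ × ℝ × ℝ

namespace Heisenberg

/-- The group law `[a,b,c]·[x,y,z] = [x+a, y+b, z+c+a·y]`. -/
def mul (p q : H) : H := (q.1 + p.1, q.2.1 + p.2.1, q.2.2 + p.2.2 + p.1 * q.2.1)

/-- The group inverse `[x,y,z]⁻¹ = [−x,−y,−z+xy]`. -/
def inv (p : H) : H := (-p.1, -p.2.1, -p.2.2 + p.1 * p.2.1)

/-- Membership in the integer lattice `Γ`. -/
def inGamma (p : H) : Prop :=
  (∃ a : ℤ, p.1 = (a : ℝ)) ∧ (∃ b : ℤ, p.2.1 = (b : ℝ)) ∧ (∃ c : ℤ, p.2.2 = (c : ℝ))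

/-- Flow along the vector field `X`: `exp(tX)[x,y,z] = [x+t, y, z+t·y]`. -/
def flowX (t : ℝ) (p : H) : H := (p.1 + t, p.2.1, p.2.2 + t * p.2.1)

/-- Flow along the vector field `Y`: `exp(tY)[x,y,z] = [x, y+t, z]`. -/
def flowY (t : ℝ) (p : H) : H := (p.1, p.2.1 + t, p.2.2)

def flow : Bool → ℝ → H → H
  | true => flowX
  | false => flowY

/-- `applyFlows [(W₁,t₁),…,(W_k,t_k)] p = exp(t₁W₁)⋯exp(t_kW_k) p`. -/
def applyFlows : List (Bool × ℝ) → H → H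
  | [], p => p
  | wt :: l, p => flow wt.1 wt.2 (applyFlows l p)

/-- The Carnot–Carathéodory metric on `H`. -/
def ccDist (p p' : H) : ℝ :=
  sInf { s | ∃ l : List (Bool × ℝ), applyFlows l p = p' ∧ s = (l.map fun wt => |wt.2|).sum }

/-- The parabolic dilation `δ_λ[x,y,z] = [λx, λy, λ²z]`. -/
def dilate (lam : ℝ) (p : H) : H := (lam * p.1, lam * p.2.1, lam ^ 2 * p.2.2)

variable {E : Type*} [NormedAddCommGroup E] [NormedSpace ℝ E]

/-- The right-invariant vector field `X = ∂/∂x + y ∂/∂z` acting on functions. -/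
def XD (φ : H → E) : H → E := fun p => fderiv ℝ φ p (1, 0, p.2.1)

/-- The right-invariant vector field `Y = ∂/∂y` acting on functions. -/
def YD (φ : H → E) : H → E := fun p => fderiv ℝ φ p (0, 1, 0)

/-- The vector field `Z = ∂/∂z` acting on functions. -/
def ZD (φ : H → E) : H → E := fun p => fderiv ℝ φ p (0, 0, 1)

def WD : Bool → (H → E) → H → E
  | true => XD
  | false => YD

/-- `X`, `Y`, `Z` indexed by `Fin 3`. -/
def WD3 : Fin 3 → (H → E) → H → E := ![XD, YD, ZD]

/-- The pointwise (Euclidean) norm `|∇^j φ(p)|` of the `j`-th iterated horizontal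
gradient `∇^jφ`, computed via the words of length `j` in `X, Y`. -/
def gradNorm (j : ℕ) (φ : H → E) (p : H) : ℝ :=
  Real.sqrt (∑ w : Fin j → Bool, ‖(List.ofFn w).foldr WD φ p‖ ^ 2)

/-- `‖∇^m φ‖_{C^k_R}`, valued in `ℝ≥0∞`. -/
def CkRS (m k : ℕ) (R : ℝ) (φ : H → E) : ℝ≥0∞ :=
  ∑ j ∈ Finset.range (k + 1),
    ENNReal.ofReal (R ^ j) * ⨆ p : H, ENNReal.ofReal (gradNorm (m + j) φ p)

/-- The homogeneous Hölder seminorm `‖∇^m φ‖_{Ċ^{0,α}}`, valued in `ℝ≥0∞`. -/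
def gradHolderS (m : ℕ) (α : ℝ) (φ : H → E) : ℝ≥0∞ :=
  ⨆ (p : H) (q : H) (_ : p ≠ q),
    ENNReal.ofReal (Real.sqrt (∑ w : Fin m → Bool,
        ‖(List.ofFn w).foldr WD φ p - (List.ofFn w).foldr WD φ q‖ ^ 2)) /
      ENNReal.ofReal (ccDist p q ^ α)

/-- `‖∇^m φ‖_{C^{k,α}_R}`, valued in `ℝ≥0∞`. -/
def CkAS (m k : ℕ) (α R : ℝ) (φ : H → E) : ℝ≥0∞ :=
  CkRS m k R φ + ENNReal.ofReal (R ^ ((k : ℝ) + α)) * gradHolderS (m + k) α φ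

/-- `‖φ‖_{C^k_R}`. -/
abbrev CkR (k : ℕ) (R : ℝ) (φ : H → E) : ℝ≥0∞ := CkRS 0 k R φ

/-- `‖φ‖_{C^{k,α}_R}`. -/
abbrev CkA (k : ℕ) (α R : ℝ) (φ : H → E) : ℝ≥0∞ := CkAS 0 k α R φ

/-- A dyadic number is one of the form `2^m`, `m ∈ ℤ`. -/
def IsDyadic (A : ℝ) : Prop := ∃ m : ℤ, A = 2 ^ m

/-- The norm `|v₁ ∧ ⋯ ∧ v_k|` of a wedge product of vectors of `ℝ^D`, via the
Cauchy–Binet (Gram determinant) formula. -/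
def wedgeNorm {D k : ℕ} (v : Fin k → EuclideanSpace ℝ (Fin D)) : ℝ :=
  Real.sqrt (Matrix.det (Matrix.of fun i j => ⟪v i, v j⟫))

end Heisenberg

open Heisenberg

namespace Heisenberg

lemma applyFlows_append (l l' : List (Bool × ℝ)) (p : H) :
    applyFlows (l ++ l') p = applyFlows l (applyFlows l' p) := by
  induction l with
  | nil => rfl
  | cons wt l ih => simp [applyFlows, ih]

lemma flow_neg_flow (w : Bool) (t : ℝ) (p : H) : flow w (-t) (flow w t p) = p := by
  cases w <;> simp [flow, flowX, flowY]

/-- The length of the path described by a list of flows. -/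
def pathLength (l : List (Bool × ℝ)) : ℝ := (l.map fun wt => |wt.2|).sum

lemma pathLength_nonneg (l : List (Bool × ℝ)) : 0 ≤ pathLength l := by
  refine List.sum_nonneg ?_
  simp only [List.mem_map]
  rintro _ ⟨wt, -, rfl⟩
  exact abs_nonneg _

lemma exists_reverse_path (l : List (Bool × ℝ)) (p : H) :
    ∃ l', applyFlows l' (applyFlows l p) = p ∧ pathLength l' = pathLength l := by
  induction l with
  | nil => exact ⟨[], rfl, rfl⟩
  | cons wt l ih =>
    obtain ⟨l', h, h'⟩ := ih
    refine ⟨l' ++ [(wt.1, -wt.2)], ?_, ?_⟩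
    · simp [applyFlows_append, applyFlows, flow_neg_flow, h]
    · simp only [pathLength, List.map_append, List.sum_append, List.map_cons, List.sum_cons,
        List.map_nil, List.sum_nil, abs_neg, add_zero] at h' ⊢
      rw [h', add_comm]

lemma ccDist_le_pathLength (l : List (Bool × ℝ)) (p : H) :
    ccDist p (applyFlows l p) ≤ pathLength l := by
  refine csInf_le ⟨0, ?_⟩ ⟨l, rfl, rfl⟩
  rintro _ ⟨l, -, rfl⟩
  exact pathLength_nonneg l

/-- An explicit path between two points, made of a commutator square and two segments. -/
lemma exists_path (p q : H) :
    ∃ l, applyFlows l p = q ∧ pathLength l = |q.1 - p.1| + |q.2.1 - p.2.1| +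
      4 * √|q.2.2 - p.2.2 - (q.1 - p.1) * p.2.1| := by
  obtain ⟨x, y, z⟩ := p
  obtain ⟨x', y', z'⟩ := q
  set c := z' - z - (x' - x) * y with hc
  obtain ⟨t, ht, htc⟩ : ∃ t : ℝ, |t| = √|c| ∧ t * √|c| = c := by
    have hs : √|c| * √|c| = |c| := Real.mul_self_sqrt (abs_nonneg c)
    rcases le_total 0 c with h | h
    · exact ⟨√|c|, abs_of_nonneg (Real.sqrt_nonneg _), by rw [hs, abs_of_nonneg h]⟩
    · exact ⟨-√|c|, by rw [abs_neg, abs_of_nonneg (Real.sqrt_nonneg _)],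
        by rw [neg_mul, hs, abs_of_nonpos h, neg_neg]⟩
  refine ⟨[(false, y' - y), (true, x' - x), (true, -t), (false, -√|c|), (true, t),
    (false, √|c|)], ?_, ?_⟩
  · simp only [applyFlows, flow, flowX, flowY, Prod.mk.injEq]
    exact ⟨by ring, by ring, by linear_combination htc + hc⟩
  · simp only [pathLength, List.map_cons, List.sum_cons, List.map_nil, List.sum_nil, abs_neg, ht,
      abs_of_nonneg (Real.sqrt_nonneg |c|)]
    ring

lemma ccDist_le (p q : H) :
    ccDist p q ≤ |q.1 - p.1| + |q.2.1 - p.2.1| +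
      4 * √|q.2.2 - p.2.2 - (q.1 - p.1) * p.2.1| := by
  obtain ⟨l, rfl, h⟩ := exists_path p q
  exact (ccDist_le_pathLength l p).trans h.le

lemma exists_path_lt {p q : H} {r : ℝ} (h : ccDist p q < r) :
    ∃ l, applyFlows l p = q ∧ pathLength l < r := by
  obtain ⟨l, hl, -⟩ := exists_path p q
  unfold ccDist at h
  obtain ⟨_, ⟨l, hl, rfl⟩, hr⟩ := exists_lt_of_csInf_lt (by exact ⟨_, l, hl, rfl⟩) h
  exact ⟨l, hl, hr⟩

lemma ccDist_nonneg (p q : H) : 0 ≤ ccDist p q := by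
  refine Real.sInf_nonneg ?_
  rintro _ ⟨l, -, rfl⟩
  exact pathLength_nonneg l

lemma ccDist_comm (p q : H) : ccDist p q = ccDist q p := by
  suffices h : ∀ p q : H, ccDist p q ≤ ccDist q p from le_antisymm (h p q) (h q p)
  intro p q
  refine le_of_forall_gt fun r hr => ?_
  obtain ⟨l, rfl, hl⟩ := exists_path_lt hr
  obtain ⟨l', h, h'⟩ := exists_reverse_path l q
  have := ccDist_le_pathLength l' (applyFlows l q)
  rw [h] at this
  linarith

lemma ccDist_triangle (p q r : H) : ccDist p r ≤ ccDist p q + ccDist q r := by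
  refine le_of_forall_pos_le_add fun δ hδ => ?_
  obtain ⟨l, rfl, hl⟩ := exists_path_lt (lt_add_of_pos_right (ccDist p q) (half_pos hδ))
  obtain ⟨l', rfl, hl'⟩ := exists_path_lt
    (lt_add_of_pos_right (ccDist (applyFlows l p) r) (half_pos hδ))
  have h := ccDist_le_pathLength (l' ++ l) p
  rw [applyFlows_append, pathLength, List.map_append, List.sum_append] at h
  simp only [pathLength] at hl hl'
  linarith

lemma abs_sub_ccDist_le (p q r : H) : |ccDist p r - ccDist q r| ≤ ccDist p q := by
  rw [abs_sub_le_iff]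
  constructor
  · linarith [ccDist_triangle p q r]
  · linarith [ccDist_triangle q p r, ccDist_comm p q]

lemma path_displacement (l : List (Bool × ℝ)) (p : H) :
    |(applyFlows l p).1 - p.1| ≤ pathLength l ∧
    |(applyFlows l p).2.1 - p.2.1| ≤ pathLength l ∧
    |(applyFlows l p).2.2 - p.2.2 - ((applyFlows l p).1 - p.1) * p.2.1| ≤ pathLength l ^ 2 := by
  induction l with
  | nil => simp [applyFlows, pathLength]
  | cons wt l ih =>
    obtain ⟨w, t⟩ := wt
    obtain ⟨h₁, h₂, h₃⟩ := ih
    have hL := pathLength_nonneg l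
    have ht := abs_nonneg t
    have hcons : pathLength ((w, t) :: l) = |t| + pathLength l := by simp [pathLength]
    rw [hcons]
    set q := applyFlows l p with hq
    have happ : applyFlows ((w, t) :: l) p = flow w t q := rfl
    rw [happ]
    cases w
    · simp only [flow, flowY]
      refine ⟨by linarith, ?_, h₃.trans (by gcongr; linarith)⟩
      calc |q.2.1 + t - p.2.1| = |t + (q.2.1 - p.2.1)| := by ring_nf
        _ ≤ _ := (abs_add_le _ _).trans (by linarith)
    · simp only [flow, flowX]
      refine ⟨?_, by linarith, ?_⟩
      · calc |q.1 + t - p.1| = |t + (q.1 - p.1)| := by ring_nf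
          _ ≤ _ := (abs_add_le _ _).trans (by linarith)
      · calc |q.2.2 + t * q.2.1 - p.2.2 - (q.1 + t - p.1) * p.2.1|
            = |(q.2.2 - p.2.2 - (q.1 - p.1) * p.2.1) + t * (q.2.1 - p.2.1)| := by ring_nf
          _ ≤ |q.2.2 - p.2.2 - (q.1 - p.1) * p.2.1| + |t| * |q.2.1 - p.2.1| := by
            rw [← abs_mul]; exact abs_add_le _ _
          _ ≤ pathLength l ^ 2 + |t| * pathLength l := by gcongr
          _ ≤ _ := by nlinarith [mul_nonneg ht hL]

lemma displacement_of_ccDist_lt {p q : H} {r : ℝ} (h : ccDist p q < r) :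
    |q.1 - p.1| ≤ r ∧ |q.2.1 - p.2.1| ≤ r ∧
    |q.2.2 - p.2.2 - (q.1 - p.1) * p.2.1| ≤ r ^ 2 := by
  obtain ⟨l, rfl, hl⟩ := exists_path_lt h
  obtain ⟨h₁, h₂, h₃⟩ := path_displacement l p
  have := pathLength_nonneg l
  exact ⟨h₁.trans hl.le, h₂.trans hl.le, h₃.trans (by gcongr)⟩

lemma eq_of_ccDist_eq_zero {p q : H} (h : ccDist p q = 0) : p = q := by
  have key : ∀ r : ℝ, 0 < r → |q.1 - p.1| ≤ r ∧ |q.2.1 - p.2.1| ≤ r ∧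
      |q.2.2 - p.2.2 - (q.1 - p.1) * p.2.1| ≤ r ^ 2 :=
    fun r hr => displacement_of_ccDist_lt (h.trans_lt hr)
  have h₁ : q.1 - p.1 = 0 :=
    abs_nonpos_iff.1 (le_of_forall_gt_imp_ge_of_dense fun r hr => (key r hr).1)
  have h₂ : q.2.1 - p.2.1 = 0 :=
    abs_nonpos_iff.1 (le_of_forall_gt_imp_ge_of_dense fun r hr => (key r hr).2.1)
  have h₃ : q.2.2 - p.2.2 - (q.1 - p.1) * p.2.1 = 0 := by
    refine abs_nonpos_iff.1 (le_of_forall_gt_imp_ge_of_dense fun r hr => ?_)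
    simpa [Real.sq_sqrt hr.le] using (key (√r) (Real.sqrt_pos.2 hr)).2.2
  rw [h₁, zero_mul, sub_zero] at h₃
  ext <;> linarith

/-- The points of the integer lattice, dilated by `s`. -/
def latticePoint (s : ℝ) (g : ℤ × ℤ × ℤ) : H := (s * g.1, s * g.2.1, s ^ 2 * g.2.2)

lemma exists_latticePoint_near {s : ℝ} (hs : 0 < s) (p : H) :
    ∃ g, ccDist p (latticePoint s g) ≤ 6 * s := by
  obtain ⟨x, y, z⟩ := p
  have key : ∀ {r : ℝ} (_ : 0 < r) (v : ℝ), |v - r * ⌊v / r⌋| ≤ r := by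
    intro r hr v
    have h₁ := Int.floor_le (v / r)
    have h₂ := (Int.lt_floor_add_one (v / r)).le
    rw [le_div_iff₀ hr] at h₁
    rw [div_le_iff₀ hr] at h₂
    rw [abs_le]
    constructor <;> linarith
  set i := ⌊x / s⌋
  set j := ⌊y / s⌋
  set w := z - (x - s * i) * (s * j)
  refine ⟨(i, j, ⌊w / s ^ 2⌋), ?_⟩
  rw [ccDist_comm]
  refine (ccDist_le _ _).trans ?_
  simp only [latticePoint]
  have h₁ := key hs x
  have h₂ := key hs y
  have h₃ := key (pow_pos hs 2) w
  have h₄ : z - s ^ 2 * ⌊w / s ^ 2⌋ - (x - s * i) * (s * j) = w - s ^ 2 * ⌊w / s ^ 2⌋ := by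
    simp only [w]; ring
  rw [h₄]
  have h₅ : √|w - s ^ 2 * ⌊w / s ^ 2⌋| ≤ s := by
    rw [Real.sqrt_le_left hs.le]; exact h₃
  linarith

lemma tsum_int_abs_sub_le (w : ℝ) (R : ℕ) :
    ∑' k : ℤ, (if |(k : ℝ) - w| ≤ R then (1 : ℝ≥0∞) else 0) ≤ 2 * R + 2 := by
  rw [tsum_eq_sum (s := Finset.Icc (⌊w⌋ - R) (⌊w⌋ + R + 1))]
  · refine (Finset.sum_le_card_nsmul _ _ 1 fun k _ => by split_ifs <;> simp).trans ?_
    rw [Int.card_Icc, nsmul_one]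
    have : (⌊w⌋ + R + 1 + 1 - (⌊w⌋ - R)).toNat = 2 * R + 2 := by omega
    rw [this]
    push_cast
    exact le_rfl
  · intro k hk
    refine if_neg fun h => hk ?_
    rw [abs_le] at h
    have h₁ := Int.floor_le w
    have h₂ := Int.lt_floor_add_one w
    rw [Finset.mem_Icc]
    constructor
    · have : ((⌊w⌋ - R : ℤ) : ℝ) ≤ k := by push_cast; linarith
      exact_mod_cast this
    · have : (k : ℝ) ≤ ((⌊w⌋ + R + 1 : ℤ) : ℝ) := by push_cast; linarith
      exact_mod_cast this

lemma tsum_latticePoint_near_le {s : ℝ} (hs : 0 < s) (p : H) :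
    ∑' g, (if ccDist p (latticePoint s g) < 12 * s then (1 : ℝ≥0∞) else 0) ≤ 196040 := by
  obtain ⟨x, y, z⟩ := p
  let w : ℤ → ℝ := fun i => (z + (s * i - x) * y) / s ^ 2
  have key : ∀ {r : ℝ} (_ : 0 < r) (k : ℤ) (v R : ℝ), |r * k - v| ≤ R * r → |k - v / r| ≤ R := by
    intro r hr k v R h
    have : r * k - v = (k - v / r) * r := by field_simp
    rw [this, abs_mul, abs_of_pos hr] at h
    exact le_of_mul_le_mul_right h hr
  calc ∑' g, (if ccDist (x, y, z) (latticePoint s g) < 12 * s then (1 : ℝ≥0∞) else 0)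
      ≤ ∑' g : ℤ × ℤ × ℤ, (if |(g.1 : ℝ) - x / s| ≤ (12 : ℕ) then (1 : ℝ≥0∞) else 0) *
          ((if |(g.2.1 : ℝ) - y / s| ≤ (12 : ℕ) then (1 : ℝ≥0∞) else 0) *
            (if |(g.2.2 : ℝ) - w g.1| ≤ (144 : ℕ) then (1 : ℝ≥0∞) else 0)) := by
        refine ENNReal.tsum_le_tsum fun g => ?_
        by_cases h : ccDist (x, y, z) (latticePoint s g) < 12 * s
        · obtain ⟨h₁, h₂, h₃⟩ := displacement_of_ccDist_lt h
          simp only [latticePoint] at h₁ h₂ h₃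
          have h₃' : |s ^ 2 * g.2.2 - (z + (s * g.1 - x) * y)| ≤ 144 * s ^ 2 := by
            convert h₃ using 2 <;> ring
          have e₁ := key hs _ _ _ h₁
          have e₂ := key hs _ _ _ h₂
          have e₃ := key (pow_pos hs 2) _ _ _ h₃'
          simp [h, e₁, e₂, e₃, w]
        · simp [h]
    _ = ∑' i : ℤ, (if |(i : ℝ) - x / s| ≤ (12 : ℕ) then (1 : ℝ≥0∞) else 0) *
          ∑' j : ℤ, (if |(j : ℝ) - y / s| ≤ (12 : ℕ) then (1 : ℝ≥0∞) else 0) *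
            ∑' k : ℤ, (if |(k : ℝ) - w i| ≤ (144 : ℕ) then (1 : ℝ≥0∞) else 0) := by
        rw [ENNReal.tsum_prod']
        refine tsum_congr fun i => ?_
        rw [ENNReal.tsum_prod', ← ENNReal.tsum_mul_left]
        refine tsum_congr fun j => ?_
        rw [← ENNReal.tsum_mul_left, ← ENNReal.tsum_mul_left]
    _ ≤ ∑' i : ℤ, (if |(i : ℝ) - x / s| ≤ (12 : ℕ) then (1 : ℝ≥0∞) else 0) *
          ∑' j : ℤ, (if |(j : ℝ) - y / s| ≤ (12 : ℕ) then (1 : ℝ≥0∞) else 0) *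
            (2 * (144 : ℕ) + 2) := by
        gcongr
        exact tsum_int_abs_sub_le _ _
    _ ≤ (2 * (12 : ℕ) + 2) * ((2 * (12 : ℕ) + 2) * (2 * (144 : ℕ) + 2)) := by
        simp only [ENNReal.tsum_mul_right]
        gcongr <;> exact tsum_int_abs_sub_le _ _
    _ = 196040 := by norm_num

/-- The coordinates of the embedding: weighted tent functions centred at the points of the
lattice dilated by `2 ^ n`. -/
def tent (ε : ℝ) (i : ℤ × ℤ × ℤ × ℤ) (p : H) : ℝ :=
  (2 : ℝ) ^ (-(ε * i.1)) *
    max 0 (12 * (2 : ℝ) ^ (i.1 : ℝ) - ccDist p (latticePoint ((2 : ℝ) ^ (i.1 : ℝ)) i.2))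

lemma sq_max_sub_max_le {d R a b : ℝ} (hR : 0 ≤ R) (ha : 0 ≤ a) (hb : 0 ≤ b)
    (h : |a - b| ≤ d) :
    ENNReal.ofReal ((max 0 (R - a) - max 0 (R - b)) ^ 2) ≤
      ENNReal.ofReal (min d R ^ 2) *
        ((if a < R then 1 else 0) + (if b < R then 1 else 0)) := by
  by_cases hab : a < R ∨ b < R
  · have h₁ : |max 0 (R - a) - max 0 (R - b)| ≤ min d R := by
      refine le_min ?_ ?_
      · refine (abs_max_sub_max_le_max _ _ _ _).trans ?_
        simp only [sub_self, abs_zero, sub_sub_sub_cancel_left]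
        rw [abs_sub_comm]
        exact max_le ((abs_nonneg _).trans h) h
      · rw [abs_le]
        have := le_max_left 0 (R - a)
        have := le_max_left 0 (R - b)
        have : max 0 (R - a) ≤ R := max_le hR (by linarith)
        have : max 0 (R - b) ≤ R := max_le hR (by linarith)
        constructor <;> linarith
    calc _ ≤ ENNReal.ofReal (min d R ^ 2) := by
          rw [← sq_abs]
          gcongr
      _ ≤ _ := by
          refine le_mul_of_one_le_right' ?_
          rcases hab with h | h <;> simp [h]
  · push Not at hab
    rw [max_eq_left (by linarith), max_eq_left (by linarith)]
    simp

lemma tsum_tent_scale_le (ε : ℝ) (n : ℤ) (p q : H) :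
    ∑' g, ENNReal.ofReal ((tent ε (n, g) p - tent ε (n, g) q) ^ 2) ≤
      ENNReal.ofReal (((2 : ℝ) ^ (-(ε * n)) * min (ccDist p q) (12 * (2 : ℝ) ^ (n : ℝ))) ^ 2) *
        392080 := by
  have hs : (0 : ℝ) < (2 : ℝ) ^ (n : ℝ) := by positivity
  set s := (2 : ℝ) ^ (n : ℝ) with hsdef
  set W := (2 : ℝ) ^ (-(ε * n)) with hW
  calc ∑' g, ENNReal.ofReal ((tent ε (n, g) p - tent ε (n, g) q) ^ 2)
      ≤ ∑' g, ENNReal.ofReal ((W * min (ccDist p q) (12 * s)) ^ 2) *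
          ((if ccDist p (latticePoint s g) < 12 * s then 1 else 0) +
            (if ccDist q (latticePoint s g) < 12 * s then 1 else 0)) := by
        refine ENNReal.tsum_le_tsum fun g => ?_
        simp only [tent, ← hsdef, ← hW]
        rw [← mul_sub, mul_pow, mul_pow, ENNReal.ofReal_mul (sq_nonneg W),
          ENNReal.ofReal_mul (sq_nonneg W), mul_assoc]
        gcongr
        exact sq_max_sub_max_le (by positivity) (ccDist_nonneg _ _) (ccDist_nonneg _ _)
          (abs_sub_ccDist_le _ _ _)
    _ ≤ _ := by
        rw [ENNReal.tsum_mul_left, ENNReal.tsum_add]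
        gcongr
        calc _ ≤ (196040 : ℝ≥0∞) + 196040 :=
              add_le_add (tsum_latticePoint_near_le hs p) (tsum_latticePoint_near_le hs q)
          _ = 392080 := by norm_num

lemma exists_two_rpow_le {d : ℝ} (hd : 0 < d) :
    ∃ m : ℤ, (2 : ℝ) ^ (m : ℝ) ≤ d ∧ d < 2 * (2 : ℝ) ^ (m : ℝ) := by
  obtain ⟨m, h₁, h₂⟩ := exists_mem_Ico_zpow hd (one_lt_two : (1 : ℝ) < 2)
  refine ⟨m, by simpa using h₁, ?_⟩
  rw [Real.rpow_intCast]
  rwa [zpow_add₀ two_ne_zero, zpow_one, mul_comm] at h₂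

lemma tsum_ofReal_geometric_le {C r B : ℝ} (hC : 0 ≤ C) (hr : 0 ≤ r) (hr1 : r < 1)
    (hB : C ≤ B * (1 - r)) : ∑' k : ℕ, ENNReal.ofReal (C * r ^ k) ≤ ENNReal.ofReal B := by
  rw [← ENNReal.ofReal_tsum_of_nonneg (fun k => by positivity)
    ((summable_geometric_of_lt_one hr hr1).mul_left C), tsum_mul_left,
    tsum_geometric_of_lt_one hr hr1]
  refine ENNReal.ofReal_le_ofReal ?_
  rw [← div_eq_mul_inv, div_le_iff₀ (by linarith)]
  exact hB

lemma tsum_scales_le {ε d : ℝ} (hε : 0 < ε) (hε' : ε ≤ 1 / 2) (hd : 0 < d) :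
    ∑' n : ℤ, ENNReal.ofReal (((2 : ℝ) ^ (-(ε * n)) * min d (12 * (2 : ℝ) ^ (n : ℝ))) ^ 2) ≤
      ENNReal.ofReal (76 / ε * (d ^ (1 - ε)) ^ 2) := by
  obtain ⟨m, hm, hm'⟩ := exists_two_rpow_le hd
  set D := d ^ (1 - ε) with hD
  have hDpos : 0 < D := Real.rpow_pos_of_pos hd _
  rw [← (Equiv.addLeft m).tsum_eq, tsum_of_nat_of_neg_add_one ENNReal.summable ENNReal.summable]
  set r := (2 : ℝ) ^ (-(2 * ε)) with hr
  have hrpos : 0 < r := by positivity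
  have hr1 : r * (1 + ε) ≤ 1 := by
    have h₁ : 1 + ε ≤ (2 : ℝ) ^ (2 * ε) := by
      rw [Real.rpow_def_of_pos two_pos]
      have h := Real.add_one_le_exp (Real.log 2 * (2 * ε))
      nlinarith [Real.log_two_gt_d9]
    calc r * (1 + ε) ≤ r * (2 : ℝ) ^ (2 * ε) := by gcongr
      _ = 1 := by rw [hr, ← Real.rpow_add two_pos]; simp
  have h_large : ∑' k : ℕ, ENNReal.ofReal (((2 : ℝ) ^ (-(ε * ((Equiv.addLeft m) k : ℤ))) *
      min d (12 * (2 : ℝ) ^ (((Equiv.addLeft m) k : ℤ) : ℝ))) ^ 2) ≤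
      ENNReal.ofReal (4 / ε * D ^ 2) := by
    refine le_trans (ENNReal.tsum_le_tsum fun k => ENNReal.ofReal_le_ofReal ?_)
      (tsum_ofReal_geometric_le (C := 2 * D ^ 2) (r := r) (by positivity) hrpos.le
        (by nlinarith) ?_)
    · have h₁ : (2 : ℝ) ^ (-(ε * m)) * d ≤ 2 ^ ε * D := by
        have : d ^ ε ≤ 2 ^ ε * (2 : ℝ) ^ (ε * m) := by
          calc d ^ ε ≤ (2 * (2 : ℝ) ^ (m : ℝ)) ^ ε := by gcongr
            _ = _ := by
              rw [Real.mul_rpow (by positivity) (by positivity), ← Real.rpow_mul (by positivity),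
                mul_comm (m : ℝ)]
        calc (2 : ℝ) ^ (-(ε * m)) * d = (2 : ℝ) ^ (-(ε * m)) * d ^ ε * D := by
              rw [hD, mul_assoc, ← Real.rpow_add hd]; simp
          _ ≤ (2 : ℝ) ^ (-(ε * m)) * (2 ^ ε * (2 : ℝ) ^ (ε * m)) * D := by gcongr
          _ = 2 ^ ε * D * ((2 : ℝ) ^ (-(ε * m)) * (2 : ℝ) ^ (ε * m)) := by ring
          _ = _ := by rw [← Real.rpow_add two_pos]; simp
      have h₂ : ((2 : ℝ) ^ ε) ^ 2 ≤ 2 := by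
        rw [← Real.rpow_mul_natCast two_pos.le]
        calc (2 : ℝ) ^ (ε * (2 : ℕ)) ≤ 2 ^ (1 : ℝ) :=
              Real.rpow_le_rpow_of_exponent_le one_le_two (by push_cast; linarith)
          _ = 2 := Real.rpow_one 2
      have h₃ : ((2 : ℝ) ^ (-(ε * k))) ^ 2 = r ^ k := by
        rw [hr, ← Real.rpow_mul_natCast two_pos.le, ← Real.rpow_mul_natCast two_pos.le]
        congr 1
        push_cast
        ring
      calc _ ≤ ((2 : ℝ) ^ (-(ε * ((Equiv.addLeft m) k : ℤ))) * d) ^ 2 := by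
            gcongr
            exact min_le_left _ _
        _ = ((2 : ℝ) ^ (-(ε * k)) * ((2 : ℝ) ^ (-(ε * m)) * d)) ^ 2 := by
            rw [← mul_assoc, ← Real.rpow_add two_pos, Equiv.coe_addLeft]
            push_cast
            ring_nf
        _ ≤ ((2 : ℝ) ^ (-(ε * k)) * (2 ^ ε * D)) ^ 2 := by gcongr
        _ = r ^ k * (((2 : ℝ) ^ ε) ^ 2 * D ^ 2) := by rw [mul_pow, h₃, mul_pow]
        _ ≤ r ^ k * (2 * D ^ 2) := by gcongr
        _ = _ := by ring
    · have : 1 ≤ 2 / ε * (1 - r) := by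
        rw [div_mul_eq_mul_div, le_div_iff₀ hε]
        nlinarith
      calc 2 * D ^ 2 = 2 * D ^ 2 * 1 := by ring
        _ ≤ 2 * D ^ 2 * (2 / ε * (1 - r)) := by gcongr
        _ = _ := by ring
  have h_small : ∑' k : ℕ, ENNReal.ofReal
      (((2 : ℝ) ^ (-(ε * ((Equiv.addLeft m) (-((k : ℤ) + 1)) : ℤ))) *
      min d (12 * (2 : ℝ) ^ (((Equiv.addLeft m) (-((k : ℤ) + 1)) : ℤ) : ℝ))) ^ 2) ≤
      ENNReal.ofReal (72 / ε * D ^ 2) := by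
    refine le_trans (ENNReal.tsum_le_tsum fun k => ENNReal.ofReal_le_ofReal ?_)
      (tsum_ofReal_geometric_le (C := 72 * D ^ 2) (r := 1 / 2) (by positivity) (by norm_num)
        (by norm_num) ?_)
    · have h₁ : (2 : ℝ) ^ ((1 - ε) * m) ≤ D := by
        rw [mul_comm, Real.rpow_mul two_pos.le]
        exact Real.rpow_le_rpow (by positivity) hm (by linarith)
      have h₂ : ((2 : ℝ) ^ (-((1 - ε) * (k + 1)))) ^ 2 ≤ (1 / 2) ^ (k + 1) := by
        rw [one_div, inv_pow, ← Real.rpow_natCast 2 (k + 1), ← Real.rpow_neg two_pos.le,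
          ← Real.rpow_mul_natCast two_pos.le]
        refine Real.rpow_le_rpow_of_exponent_le one_le_two ?_
        push_cast
        have : (0 : ℝ) ≤ k := k.cast_nonneg
        nlinarith
      calc _ ≤ ((2 : ℝ) ^ (-(ε * ((Equiv.addLeft m) (-((k : ℤ) + 1)) : ℤ))) *
              (12 * (2 : ℝ) ^ (((Equiv.addLeft m) (-((k : ℤ) + 1)) : ℤ) : ℝ))) ^ 2 := by
            gcongr
            exact min_le_right _ _
        _ = (12 * ((2 : ℝ) ^ (-((1 - ε) * (k + 1))) * (2 : ℝ) ^ ((1 - ε) * m))) ^ 2 := by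
            rw [mul_left_comm, ← Real.rpow_add two_pos, ← Real.rpow_add two_pos,
              Equiv.coe_addLeft]
            push_cast
            ring_nf
        _ ≤ (12 * ((2 : ℝ) ^ (-((1 - ε) * (k + 1))) * D)) ^ 2 := by gcongr
        _ = 144 * (((2 : ℝ) ^ (-((1 - ε) * (k + 1)))) ^ 2 * D ^ 2) := by ring
        _ ≤ 144 * ((1 / 2) ^ (k + 1) * D ^ 2) := by gcongr
        _ = _ := by ring
    · have : 2 ≤ 1 / ε := by rw [le_div_iff₀ hε]; linarith
      calc 72 * D ^ 2 = 36 * D ^ 2 * 2 := by ring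
        _ ≤ 36 * D ^ 2 * (1 / ε) := by gcongr
        _ = _ := by ring
  calc _ ≤ ENNReal.ofReal (4 / ε * D ^ 2) + ENNReal.ofReal (72 / ε * D ^ 2) :=
        add_le_add h_large h_small
    _ = _ := by
        rw [← ENNReal.ofReal_add (by positivity) (by positivity)]
        congr 1
        ring

lemma tsum_tent_le {ε : ℝ} (hε : 0 < ε) (hε' : ε ≤ 1 / 2) (p q : H) :
    ∑' i, ENNReal.ofReal ((tent ε i p - tent ε i q) ^ 2) ≤
      ENNReal.ofReal ((5460 * ε ^ (-(1 / 2 : ℝ)) * ccDist p q ^ (1 - ε)) ^ 2) := by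
  rcases (ccDist_nonneg p q).eq_or_lt with h | hd
  · rw [eq_of_ccDist_eq_zero h.symm]
    simp
  have hsq : (ε ^ (-(1 / 2 : ℝ))) ^ 2 = 1 / ε := by
    rw [← Real.rpow_mul_natCast hε.le, show -(1 / 2 : ℝ) * (2 : ℕ) = -1 by norm_num,
      Real.rpow_neg_one, one_div]
  calc ∑' i, ENNReal.ofReal ((tent ε i p - tent ε i q) ^ 2)
      = ∑' n, ∑' g, ENNReal.ofReal ((tent ε (n, g) p - tent ε (n, g) q) ^ 2) :=
        ENNReal.tsum_prod'
    _ ≤ _ := ENNReal.tsum_le_tsum fun n => tsum_tent_scale_le ε n p q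
    _ ≤ ENNReal.ofReal (76 / ε * (ccDist p q ^ (1 - ε)) ^ 2) * 392080 := by
        rw [ENNReal.tsum_mul_right]
        gcongr
        exact tsum_scales_le hε hε' hd
    _ = ENNReal.ofReal (76 / ε * (ccDist p q ^ (1 - ε)) ^ 2 * 392080) := by
        rw [ENNReal.ofReal_mul (q := 392080) (by positivity), ENNReal.ofReal_ofNat]
    _ ≤ _ := by
        refine ENNReal.ofReal_le_ofReal ?_
        rw [mul_pow, mul_pow, hsq]
        have : 0 ≤ 1 / ε * (ccDist p q ^ (1 - ε)) ^ 2 := by positivity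
        calc _ = 29798080 * (1 / ε * (ccDist p q ^ (1 - ε)) ^ 2) := by ring
          _ ≤ 29811600 * (1 / ε * (ccDist p q ^ (1 - ε)) ^ 2) := by gcongr; norm_num
          _ = _ := by ring

lemma sum_tent_le {ε : ℝ} (hε : 0 < ε) (hε' : ε ≤ 1 / 2) (p q : H)
    (e : ℕ ≃ ℤ × ℤ × ℤ × ℤ) (t : Finset ℕ) :
    ∑ k ∈ t, ‖tent ε (e k) p - tent ε (e k) q‖ ^ (2 : ℝ≥0∞).toReal ≤
      (5460 * ε ^ (-(1 / 2 : ℝ)) * ccDist p q ^ (1 - ε)) ^ (2 : ℝ≥0∞).toReal := by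
  simp only [ENNReal.toReal_ofNat, Real.rpow_ofNat, Real.norm_eq_abs, sq_abs]
  rw [← ENNReal.ofReal_le_ofReal_iff (sq_nonneg _),
    ENNReal.ofReal_sum_of_nonneg fun _ _ => sq_nonneg _]
  refine (ENNReal.sum_le_tsum t).trans ?_
  rw [e.tsum_eq fun i => ENNReal.ofReal ((tent ε i p - tent ε i q) ^ 2)]
  exact tsum_tent_le hε hε' p q

lemma exists_tent_sub_ge {ε : ℝ} (hε : 0 ≤ ε) (hε' : ε ≤ 1) {p q : H} (hd : 0 < ccDist p q) :
    ∃ i, 3 / 32 * ccDist p q ^ (1 - ε) ≤ ‖tent ε i p - tent ε i q‖ := by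
  obtain ⟨n, hn, hn'⟩ := exists_two_rpow_le (div_pos hd (by norm_num : (0 : ℝ) < 32))
  have hs : (0 : ℝ) < (2 : ℝ) ^ (n : ℝ) := by positivity
  obtain ⟨g, hg⟩ := exists_latticePoint_near hs p
  refine ⟨(n, g), ?_⟩
  have hW : (2 : ℝ) ^ (-(ε * n)) * (2 : ℝ) ^ (n : ℝ) = ((2 : ℝ) ^ (n : ℝ)) ^ (1 - ε) := by
    rw [← Real.rpow_add two_pos, ← Real.rpow_mul two_pos.le]
    ring_nf
  simp only [tent]
  set s := (2 : ℝ) ^ (n : ℝ)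
  have hq : 12 * s - ccDist q (latticePoint s g) ≤ 0 := by
    have := ccDist_triangle p (latticePoint s g) q
    rw [ccDist_comm (latticePoint s g) q] at this
    linarith
  rw [max_eq_left hq, mul_zero, sub_zero]
  refine le_trans ?_ (le_abs_self _)
  calc 3 / 32 * ccDist p q ^ (1 - ε) ≤ 3 / 32 * (64 * s) ^ (1 - ε) := by
        have : ccDist p q ≤ 64 * s := by linarith
        gcongr
    _ ≤ 3 / 32 * (64 * s ^ (1 - ε)) := by
        rw [Real.mul_rpow (by norm_num) hs.le]
        gcongr
        exact Real.rpow_le_self_of_one_le (by norm_num) (by linarith)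
    _ = (2 : ℝ) ^ (-(ε * n)) * (6 * s) := by rw [← hW]; ring
    _ ≤ _ := by
        gcongr
        exact le_max_of_le_right (by linarith)

end Heisenberg

/-- **The Assouad embedding of the snowflaked Heisenberg group into Hilbert space with
optimal distortion** `O(ε^{-1/2})`. -/
theorem statement17 :
    ∃ K : ℝ, 1 ≤ K ∧
      ∀ ε : ℝ, 0 < ε → ε ≤ 1 / 2 →
        ∃ (Φ : H → lp (fun _ : ℕ => ℝ) 2) (c : ℝ), 0 < c ∧
          ∀ p p' : H,
            c * ccDist p p' ^ (1 - ε) ≤ ‖Φ p - Φ p'‖ ∧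
            ‖Φ p - Φ p'‖ ≤ c * K * ε ^ (-(1 / 2 : ℝ)) * ccDist p p' ^ (1 - ε) := by
  refine ⟨58240, by norm_num, fun ε hε hε' => ?_⟩
  obtain ⟨e⟩ : Nonempty (ℕ ≃ ℤ × ℤ × ℤ × ℤ) := ⟨(Denumerable.eqv _).symm⟩
  let Φ : H → lp (fun _ : ℕ => ℝ) 2 := fun p =>
    ⟨fun k => tent ε (e k) p - tent ε (e k) 0, memℓp_gen' (sum_tent_le hε hε' p 0 e)⟩
  have hΦ : ∀ p q k, (Φ p - Φ q) k = tent ε (e k) p - tent ε (e k) q := by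
    intro p q k
    exact sub_sub_sub_cancel_right _ _ _
  refine ⟨Φ, 3 / 32, by norm_num, fun p q => ⟨?_, ?_⟩⟩
  · rcases (ccDist_nonneg p q).eq_or_lt with h | hd
    · rw [← h, Real.zero_rpow (by linarith), mul_zero]
      exact norm_nonneg _
    · obtain ⟨i, hi⟩ := exists_tent_sub_ge hε.le (by linarith) hd
      refine hi.trans ?_
      have := lp.norm_apply_le_norm two_ne_zero (Φ p - Φ q) (e.symm i)
      rwa [hΦ, e.apply_symm_apply] at this
  · have hd := ccDist_nonneg p q
    have hK : (3 / 32 : ℝ) * 58240 = 5460 := by norm_num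
    rw [hK]
    refine lp.norm_le_of_forall_sum_le (by norm_num) (by positivity) fun t => ?_
    simp only [hΦ]
    exact sum_tent_le hε hε' p q e t
end
end

section
/- There exist a natural number D and a constant C ≥ 1 such that for every 0 < ε ≤ 1/2 there is a map Φ: H → ℝ^D satisfying C^{−1}·F_ε(p·q^{−1}) ≤ |Φ(p) − Φ(q)| ≤ C·F_ε(p·q^{−1}) for all p, q ∈ H, where F_ε: H → ℝ is defined by F_ε([x,y,z]) = ε^{−1/2}|x|^{1−ε} + ε^{−1/2}|y|^{1−ε} + |z|^{(1−ε)/2}. (Note that d(p,q)^{1−ε} ≲ F_ε(p·q^{−1}) ≲ ε^{−1/2}·d(p,q)^{1−ε} for all p, q ∈ H, so this refines the optimal-distortion Assouad embedding.) -/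
open scoped ENNReal NNReal RealInnerProductSpace BigOperators

noncomputable section

open Heisenberg

/-- The function `F_ε([x,y,z]) = ε^{-1/2}|x|^{1-ε} + ε^{-1/2}|y|^{1-ε} + |z|^{(1-ε)/2}`. -/
noncomputable def Feps (ε : ℝ) (p : H) : ℝ :=
  ε ^ (-(1 / 2 : ℝ)) * |p.1| ^ (1 - ε) + ε ^ (-(1 / 2 : ℝ)) * |p.2.1| ^ (1 - ε) +
    |p.2.2| ^ ((1 - ε) / 2)

namespace Heisenberg

open scoped ContDiff

section Calculus

variable {E F G : Type*} [NormedAddCommGroup E] [NormedSpace ℝ E]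
  [NormedAddCommGroup F] [NormedSpace ℝ F] [NormedAddCommGroup G] [NormedSpace ℝ G]

/-- The right-invariant frame `X, Y, Z`, as tangent vectors at `p`. -/
def frame (W : Fin 3) (p : H) : H := ![(1, 0, p.2.1), (0, 1, 0), (0, 0, 1)] W

lemma WD3_apply (W : Fin 3) (f : H → E) (p : H) : WD3 W f p = fderiv ℝ f p (frame W p) := by
  fin_cases W <;> rfl

/-- The flow along `Z`. -/
def flowZ (t : ℝ) (p : H) : H := (p.1, p.2.1, p.2.2 + t)

/-- The flows of `X, Y, Z`. -/
def flow3 : Fin 3 → ℝ → H → H := ![flowX, flowY, flowZ]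

/-- The homogeneous degrees of `X, Y, Z`. -/
def wt : Fin 3 → ℕ := ![1, 1, 2]

lemma contDiff_frame (W : Fin 3) : ContDiff ℝ ∞ (frame W) := by
  fin_cases W
  · exact contDiff_const.prodMk (contDiff_const.prodMk (contDiff_fst.comp contDiff_snd))
  · exact contDiff_const
  · exact contDiff_const

lemma contDiff_WD3 {f : H → E} (hf : ContDiff ℝ ∞ f) (W : Fin 3) : ContDiff ℝ ∞ (WD3 W f) := by
  have : WD3 W f = fun p => fderiv ℝ f p (frame W p) := funext fun p => WD3_apply W f p
  rw [this]
  exact (hf.fderiv_right (m := ∞) (by simp)).clm_apply (contDiff_frame W)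

lemma differentiableAt_of_contDiff {f : H → E} (hf : ContDiff ℝ ∞ f) (p : H) :
    DifferentiableAt ℝ f p := (hf.differentiable (by simp)).differentiableAt

lemma WD3_congr {f g : H → E} {p : H} (h : f =ᶠ[nhds p] g) (W : Fin 3) :
    WD3 W f =ᶠ[nhds p] WD3 W g := by
  filter_upwards [h.eventuallyEq_nhds] with q hq
  rw [WD3_apply, WD3_apply, hq.fderiv_eq]

lemma WD3_add {f g : H → E} (hf : ContDiff ℝ ∞ f) (hg : ContDiff ℝ ∞ g) (W : Fin 3) :
    WD3 W (fun p => f p + g p) = fun p => WD3 W f p + WD3 W g p := by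
  funext p
  simp only [WD3_apply]
  rw [fderiv_fun_add (differentiableAt_of_contDiff hf p) (differentiableAt_of_contDiff hg p)]
  rfl

lemma WD3_sub {f g : H → E} (hf : ContDiff ℝ ∞ f) (hg : ContDiff ℝ ∞ g) (W : Fin 3) :
    WD3 W (fun p => f p - g p) = fun p => WD3 W f p - WD3 W g p := by
  funext p
  simp only [WD3_apply]
  rw [fderiv_fun_sub (differentiableAt_of_contDiff hf p) (differentiableAt_of_contDiff hg p)]
  rfl

lemma WD3_const_smul {f : H → E} (hf : ContDiff ℝ ∞ f) (c : ℝ) (W : Fin 3) :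
    WD3 W (fun p => c • f p) = fun p => c • WD3 W f p := by
  funext p
  simp only [WD3_apply]
  rw [fderiv_fun_const_smul (differentiableAt_of_contDiff hf p)]
  rfl

lemma WD3_add_const (f : H → E) (c : E) (W : Fin 3) :
    WD3 W (fun p => f p + c) = WD3 W f := by
  funext p
  simp only [WD3_apply, fderiv_add_const]

lemma WD3_bilin (b : E →L[ℝ] F →L[ℝ] G) {f : H → E} {g : H → F}
    (hf : ContDiff ℝ ∞ f) (hg : ContDiff ℝ ∞ g) (W : Fin 3) :
    WD3 W (fun p => b (f p) (g p)) = fun p => b (WD3 W f p) (g p) + b (f p) (WD3 W g p) := by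
  funext p
  simp only [WD3_apply]
  rw [b.fderiv_of_bilinear (differentiableAt_of_contDiff hf p) (differentiableAt_of_contDiff hg p)]
  simp [add_comm]

lemma contDiff_bilin (b : E →L[ℝ] F →L[ℝ] G) {f : H → E} {g : H → F}
    (hf : ContDiff ℝ ∞ f) (hg : ContDiff ℝ ∞ g) : ContDiff ℝ ∞ (fun p => b (f p) (g p)) :=
  (b.contDiff.comp hf).clm_apply hg

/-- The derivative of `flow3 W t`. -/
def flow3Deriv (W : Fin 3) (t : ℝ) : H →L[ℝ] H :=
  ContinuousLinearMap.id ℝ H + ![(t : ℝ), 0, 0] W •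
    ((ContinuousLinearMap.inr ℝ ℝ (ℝ × ℝ)).comp ((ContinuousLinearMap.inr ℝ ℝ ℝ).comp
      ((ContinuousLinearMap.fst ℝ ℝ ℝ).comp (ContinuousLinearMap.snd ℝ ℝ (ℝ × ℝ)))))

lemma flow3_eq (W : Fin 3) (t : ℝ) (p : H) :
    flow3 W t p = flow3Deriv W t p + ![(t, 0, 0), (0, t, 0), (0, 0, t)] W := by
  fin_cases W <;> simp [flow3, flow3Deriv, flowX, flowY, flowZ, Prod.ext_iff]

lemma hasFDerivAt_flow3 (W : Fin 3) (t : ℝ) (p : H) :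
    HasFDerivAt (flow3 W t) (flow3Deriv W t) p := by
  have : flow3 W t = fun p => flow3Deriv W t p + ![(t, 0, 0), (0, t, 0), (0, 0, t)] W :=
    funext (flow3_eq W t)
  rw [this]
  exact (flow3Deriv W t).hasFDerivAt.add_const _

lemma contDiff_flow3 (W : Fin 3) (t : ℝ) : ContDiff ℝ ∞ (flow3 W t) := by
  have : flow3 W t = fun p => flow3Deriv W t p + ![(t, 0, 0), (0, t, 0), (0, 0, t)] W :=
    funext (flow3_eq W t)
  rw [this]
  exact (flow3Deriv W t).contDiff.add contDiff_const

/-- The structure constant: pulling back `V` by the unit time flow of `W` adds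
`comm V W • Z`. -/
def comm (V W : Fin 3) : ℝ := ![![0, -1, 0], ![1, 0, 0], ![0, 0, 0]] V W

lemma abs_comm_le (V W : Fin 3) : |comm V W| ≤ 1 := by
  fin_cases V <;> fin_cases W <;> simp [comm]

lemma flow3Deriv_frame (V W : Fin 3) (p : H) :
    flow3Deriv W 1 (frame V p) = frame V (flow3 W 1 p) + comm V W • frame 2 (flow3 W 1 p) := by
  fin_cases V <;> fin_cases W <;>
    simp [flow3, flow3Deriv, flowX, flowY, flowZ, frame, comm]

lemma WD3_comp_flow3 {f : H → E} (hf : ContDiff ℝ ∞ f) (V W : Fin 3) :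
    WD3 V (fun p => f (flow3 W 1 p)) =
      fun p => WD3 V f (flow3 W 1 p) + comm V W • WD3 2 f (flow3 W 1 p) := by
  funext p
  simp only [WD3_apply]
  have := ((differentiableAt_of_contDiff hf (flow3 W 1 p)).hasFDerivAt.comp p
    (hasFDerivAt_flow3 W 1 p)).fderiv
  rw [show (fun p => f (flow3 W 1 p)) = f ∘ flow3 W 1 from rfl, this,
    ContinuousLinearMap.comp_apply, flow3Deriv_frame, map_add, map_smul]

lemma hasDerivAt_flow3 (W : Fin 3) (t : ℝ) (p : H) :
    HasDerivAt (fun s => flow3 W s p) (frame W (flow3 W t p)) t := by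
  fin_cases W
  · exact ((hasDerivAt_id t).const_add p.1).prodMk ((hasDerivAt_const t p.2.1).prodMk
      (by simpa [flow3, flowX] using ((hasDerivAt_id t).mul_const p.2.1).const_add p.2.2))
  · exact (hasDerivAt_const t p.1).prodMk (((hasDerivAt_id t).const_add p.2.1).prodMk
      (hasDerivAt_const t p.2.2))
  · exact (hasDerivAt_const t p.1).prodMk ((hasDerivAt_const t p.2.1).prodMk
      ((hasDerivAt_id t).const_add p.2.2))

lemma flow3_zero (W : Fin 3) (p : H) : flow3 W 0 p = p := by
  fin_cases W <;> simp [flow3, flowX, flowY, flowZ]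

lemma hasDerivAt_comp_flow3 {f : H → E} (hf : ContDiff ℝ ∞ f) (W : Fin 3) (t : ℝ) (p : H) :
    HasDerivAt (fun s => f (flow3 W s p)) (WD3 W f (flow3 W t p)) t := by
  rw [WD3_apply]
  exact (differentiableAt_of_contDiff hf _).hasFDerivAt.comp_hasDerivAt t (hasDerivAt_flow3 W t p)

lemma norm_flow3_sub_le {f : H → E} (hf : ContDiff ℝ ∞ f) (W : Fin 3) {C : ℝ}
    (hC : ∀ p, ‖WD3 W f p‖ ≤ C) (t : ℝ) (p : H) : ‖f (flow3 W t p) - f p‖ ≤ C * |t| := by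
  have := Convex.norm_image_sub_le_of_norm_hasDerivWithin_le (s := Set.univ) (x := 0) (y := t)
    (f := fun s => f (flow3 W s p)) (fun s _ => (hasDerivAt_comp_flow3 hf W s p).hasDerivWithinAt)
    (fun s _ => hC _) convex_univ trivial trivial
  simpa [flow3_zero] using this

lemma norm_flow3_sub_sub_le {f : H → E} (hf : ContDiff ℝ ∞ f) (W : Fin 3) {C : ℝ}
    (hC : ∀ p, ‖WD3 W (WD3 W f) p‖ ≤ C) (p : H) :
    ‖f (flow3 W 1 p) - f p - WD3 W f p‖ ≤ C := by
  have hC0 : 0 ≤ C := (norm_nonneg _).trans (hC p)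
  have h : ∀ s ∈ Set.Icc (0 : ℝ) 1, HasDerivWithinAt (fun s => f (flow3 W s p) - s • WD3 W f p)
      (WD3 W f (flow3 W s p) - WD3 W f p) (Set.Icc 0 1) s := fun s _ => by
    have := (hasDerivAt_comp_flow3 hf W s p).fun_sub ((hasDerivAt_id s).smul_const (WD3 W f p))
    simpa using this.hasDerivWithinAt
  have := norm_image_sub_le_of_norm_deriv_le_segment_01' h (C := C) (fun s hs => by
    refine (norm_flow3_sub_le (contDiff_WD3 hf W) W hC s p).trans ?_
    rw [abs_of_nonneg hs.1]
    nlinarith [hs.2])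
  simpa [flow3_zero, sub_right_comm] using this

/-- The derivative of the dilation. -/
def dilateCLM (l : ℝ) : H →L[ℝ] H :=
  (l • ContinuousLinearMap.id ℝ ℝ).prodMap
    ((l • ContinuousLinearMap.id ℝ ℝ).prodMap (l ^ 2 • ContinuousLinearMap.id ℝ ℝ))

lemma dilateCLM_apply (l : ℝ) (p : H) : dilateCLM l p = dilate l p := rfl

lemma contDiff_dilate (l : ℝ) : ContDiff ℝ ∞ (dilate l) := by
  have : dilate l = dilateCLM l := funext fun p => (dilateCLM_apply l p).symm
  rw [this]
  exact (dilateCLM l).contDiff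

lemma dilateCLM_frame (l : ℝ) (W : Fin 3) (p : H) :
    dilateCLM l (frame W p) = l ^ wt W • frame W (dilate l p) := by
  fin_cases W <;> simp [dilateCLM_apply, dilate, frame, wt, Prod.ext_iff] ; ring

lemma WD3_comp_dilate {f : H → E} (hf : ContDiff ℝ ∞ f) (l : ℝ) (W : Fin 3) :
    WD3 W (fun p => f (dilate l p)) = fun p => l ^ wt W • WD3 W f (dilate l p) := by
  funext p
  have hd : HasFDerivAt (dilate l) (dilateCLM l) p := by
    have : dilate l = dilateCLM l := funext fun p => (dilateCLM_apply l p).symm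
    rw [this]
    exact (dilateCLM l).hasFDerivAt
  simp only [WD3_apply]
  have := ((differentiableAt_of_contDiff hf (dilate l p)).hasFDerivAt.comp p hd).fderiv
  rw [show (fun p => f (dilate l p)) = f ∘ dilate l from rfl, this,
    ContinuousLinearMap.comp_apply, dilateCLM_frame, map_smul]

end Calculus

section Bounds

variable {E F G : Type*} [NormedAddCommGroup E] [NormedSpace ℝ E]
  [NormedAddCommGroup F] [NormedSpace ℝ F] [NormedAddCommGroup G] [NormedSpace ℝ G]

/-- `f` is smooth and its derivatives of order `0, 1, 2` along `X, Y, Z` are bounded. -/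
structure C2Bound (f : H → E) (m₀ m₁ m₂ : ℝ) : Prop where
  smooth : ContDiff ℝ ∞ f
  bound₀ : ∀ p, ‖f p‖ ≤ m₀
  bound₁ : ∀ W p, ‖WD3 W f p‖ ≤ m₁
  bound₂ : ∀ U W p, ‖WD3 U (WD3 W f) p‖ ≤ m₂

lemma C2Bound.mono {f : H → E} {m₀ m₁ m₂ n₀ n₁ n₂ : ℝ} (hf : C2Bound f m₀ m₁ m₂)
    (h₀ : m₀ ≤ n₀) (h₁ : m₁ ≤ n₁) (h₂ : m₂ ≤ n₂) : C2Bound f n₀ n₁ n₂ :=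
  ⟨hf.smooth, fun p => (hf.bound₀ p).trans h₀, fun W p => (hf.bound₁ W p).trans h₁,
    fun U W p => (hf.bound₂ U W p).trans h₂⟩

lemma C2Bound.const_smul {f : H → E} {m₀ m₁ m₂ : ℝ} (hf : C2Bound f m₀ m₁ m₂) {c : ℝ}
    (hc : 0 ≤ c) : C2Bound (fun p => c • f p) (c * m₀) (c * m₁) (c * m₂) := by
  refine ⟨contDiff_const.smul hf.smooth, fun p => ?_, fun W p => ?_, fun U W p => ?_⟩
  · rw [norm_smul, Real.norm_of_nonneg hc]
    exact mul_le_mul_of_nonneg_left (hf.bound₀ p) hc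
  · rw [WD3_const_smul hf.smooth, norm_smul, Real.norm_of_nonneg hc]
    exact mul_le_mul_of_nonneg_left (hf.bound₁ W p) hc
  · rw [WD3_const_smul hf.smooth, WD3_const_smul (contDiff_WD3 hf.smooth W), norm_smul,
      Real.norm_of_nonneg hc]
    exact mul_le_mul_of_nonneg_left (hf.bound₂ U W p) hc

lemma C2Bound.bilin {f : H → E} {g : H → F} {m₀ m₁ m₂ n₀ n₁ n₂ k : ℝ}
    (hf : C2Bound f m₀ m₁ m₂) (hg : C2Bound g n₀ n₁ n₂) (b : E →L[ℝ] F →L[ℝ] G) (hk : 0 ≤ k)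
    (hb : ∀ u v, ‖b u v‖ ≤ k * ‖u‖ * ‖v‖) :
    C2Bound (fun p => b (f p) (g p)) (k * (m₀ * n₀)) (k * (m₁ * n₀ + m₀ * n₁))
      (k * (m₂ * n₀ + 2 * (m₁ * n₁) + m₀ * n₂)) := by
  have hm₀ := (norm_nonneg _).trans (hf.bound₀ 0)
  have hm₁ := (norm_nonneg _).trans (hf.bound₁ 0 0)
  have hm₂ := (norm_nonneg _).trans (hf.bound₂ 0 0 0)
  have key : ∀ u v m n, ‖u‖ ≤ m → ‖v‖ ≤ n → ‖b u v‖ ≤ k * (m * n) := fun u v m n hu hv => by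
    refine (hb u v).trans ?_
    rw [mul_assoc]
    have := norm_nonneg u
    gcongr
    linarith
  refine ⟨contDiff_bilin b hf.smooth hg.smooth, fun p => key _ _ _ _ (hf.bound₀ p) (hg.bound₀ p),
    fun W p => ?_, fun U W p => ?_⟩
  · rw [WD3_bilin b hf.smooth hg.smooth]
    refine (norm_add_le _ _).trans ?_
    have h1 := key _ _ _ _ (hf.bound₁ W p) (hg.bound₀ p)
    have h2 := key _ _ _ _ (hf.bound₀ p) (hg.bound₁ W p)
    linarith
  · rw [WD3_bilin b hf.smooth hg.smooth]
    have sf := contDiff_WD3 hf.smooth W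
    have sg := contDiff_WD3 hg.smooth W
    rw [WD3_add (contDiff_bilin b sf hg.smooth) (contDiff_bilin b hf.smooth sg),
      WD3_bilin b sf hg.smooth, WD3_bilin b hf.smooth sg]
    refine (norm_add_le _ _).trans ((add_le_add (norm_add_le _ _) (norm_add_le _ _)).trans ?_)
    have h1 := key _ _ _ _ (hf.bound₂ U W p) (hg.bound₀ p)
    have h2 := key _ _ _ _ (hf.bound₁ W p) (hg.bound₁ U p)
    have h3 := key _ _ _ _ (hf.bound₁ U p) (hg.bound₁ W p)
    have h4 := key _ _ _ _ (hf.bound₀ p) (hg.bound₂ U W p)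
    linarith

end Bounds

section Cross

open Matrix

lemma abs_dotProduct_le (u v : Fin 3 → ℝ) : |u ⬝ᵥ v| ≤ 3 * ‖u‖ * ‖v‖ := by
  have hu := fun i => norm_le_pi_norm u i
  have hv := fun i => norm_le_pi_norm v i
  simp only [Real.norm_eq_abs] at hu hv
  have h : ∀ i, |u i * v i| ≤ ‖u‖ * ‖v‖ := fun i => by
    rw [abs_mul]
    exact mul_le_mul (hu i) (hv i) (abs_nonneg _) (norm_nonneg _)
  rw [dotProduct, Fin.sum_univ_three]
  refine (abs_add_three _ _ _).trans ?_
  linarith [h 0, h 1, h 2]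

lemma sq_norm_le_dotProduct_self (u : Fin 3 → ℝ) : ‖u‖ ^ 2 ≤ u ⬝ᵥ u := by
  have h0 : 0 ≤ u ⬝ᵥ u := by
    rw [dotProduct, Fin.sum_univ_three]
    exact add_nonneg (add_nonneg (mul_self_nonneg _) (mul_self_nonneg _)) (mul_self_nonneg _)
  refine Real.le_sqrt (norm_nonneg _) h0 |>.mp ?_
  refine (pi_norm_le_iff_of_nonneg (Real.sqrt_nonneg _)).mpr fun i => ?_
  refine Real.le_sqrt (norm_nonneg _) h0 |>.mpr ?_
  rw [Real.norm_eq_abs, sq_abs, dotProduct, Fin.sum_univ_three]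
  fin_cases i <;> simp only [Fin.zero_eta, Fin.mk_one, Fin.reduceFinMk] <;>
    nlinarith [sq_nonneg (u 0), sq_nonneg (u 1), sq_nonneg (u 2)]

lemma norm_cross_le (u v : Fin 3 → ℝ) : ‖crossProduct u v‖ ≤ 2 * ‖u‖ * ‖v‖ := by
  have hu := fun i => norm_le_pi_norm u i
  have hv := fun i => norm_le_pi_norm v i
  have h : ∀ i j, ‖u i * v j‖ ≤ ‖u‖ * ‖v‖ := fun i j => by
    rw [norm_mul]
    exact mul_le_mul (hu i) (hv j) (norm_nonneg _) (norm_nonneg _)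
  refine (pi_norm_le_iff_of_nonneg (by positivity)).mpr fun i => ?_
  rw [cross_apply]
  fin_cases i
  · exact (norm_sub_le _ _).trans (by linarith [h 1 2, h 2 1])
  · exact (norm_sub_le _ _).trans (by linarith [h 2 0, h 0 2])
  · exact (norm_sub_le _ _).trans (by linarith [h 0 1, h 1 0])

/-- The cross product on `ℝ³` as a continuous bilinear map. -/
def crossCLM : (Fin 3 → ℝ) →L[ℝ] (Fin 3 → ℝ) →L[ℝ] (Fin 3 → ℝ) :=
  LinearMap.mkContinuous₂ crossProduct 2 norm_cross_le

lemma crossCLM_apply (u v : Fin 3 → ℝ) : crossCLM u v = crossProduct u v := rfl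

end Cross

section Step

open Matrix

/-- The renormalised state of the iteration: second order bounds `B`, and the vectors
`X G + L e₀`, `Y G + L e₁` are almost orthogonal of length `L`, up to `η`. -/
structure State (B L η : ℝ) (G : H → Fin 3 → ℝ) : Prop where
  smooth : ContDiff ℝ ∞ G
  boundZ : ∀ p, ‖WD3 2 G p‖ ≤ B
  bound₂ : ∀ U W p, ‖WD3 U (WD3 W G) p‖ ≤ B
  gram : ∀ V W p, V ≠ 2 → W ≠ 2 →
    |(WD3 V G p + L • Pi.single V 1) ⬝ᵥ (WD3 W G p + L • Pi.single W 1)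
      - if V = W then L ^ 2 else 0| ≤ η

/-- The difference quotient of `G` along `W`, shifted by the reference vector. -/
def diffQuot (L : ℝ) (G : H → Fin 3 → ℝ) (W : Fin 3) (p : H) : Fin 3 → ℝ :=
  G (flow3 W 1 p) - G p + L • Pi.single W 1

/-- The normal direction to the two horizontal difference quotients. -/
def normal (L : ℝ) (G : H → Fin 3 → ℝ) (p : H) : Fin 3 → ℝ :=
  (L ^ 2)⁻¹ • crossCLM (diffQuot L G 0 p) (diffQuot L G 1 p)

variable {B L η : ℝ} {G : H → Fin 3 → ℝ}

lemma State.norm_grad_le (hG : State B L η G) (hL : 0 < L) (hη : η ≤ L ^ 2 / 4) {W : Fin 3}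
    (hW : W ≠ 2) (p : H) : ‖WD3 W G p + L • Pi.single W 1‖ ≤ 6 / 5 * L := by
  have h1 := sq_norm_le_dotProduct_self (WD3 W G p + L • Pi.single W 1)
  have h2 := (abs_le.mp (hG.gram W W p hW hW)).2
  simp only [if_true] at h2
  refine abs_le_of_sq_le_sq' (by nlinarith) (by positivity) |>.2

lemma State.norm_diffQuot_sub_le (hG : State B L η G) (W : Fin 3) (p : H) :
    ‖diffQuot L G W p - (WD3 W G p + L • Pi.single W 1)‖ ≤ B := by
  have := norm_flow3_sub_sub_le hG.smooth W (hG.bound₂ W W) p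
  rw [diffQuot, add_sub_add_right_eq_sub]
  exact this

lemma State.WD3_diffQuot (hG : State B L η G) (V W : Fin 3) :
    WD3 V (diffQuot L G W) = fun p =>
      (WD3 V G (flow3 W 1 p) - WD3 V G p) + comm V W • WD3 2 G (flow3 W 1 p) := by
  have hs := hG.smooth
  have hc : ContDiff ℝ ∞ (fun p => G (flow3 W 1 p)) := hs.comp (contDiff_flow3 W 1)
  unfold diffQuot
  rw [WD3_add_const, WD3_sub hc hs, WD3_comp_flow3 hs]
  funext p
  exact add_sub_right_comm _ _ _

lemma norm_comm_smul_le {v : Fin 3 → ℝ} {C : ℝ} (h : ‖v‖ ≤ C) (V W : Fin 3) :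
    ‖comm V W • v‖ ≤ C := by
  rw [norm_smul, Real.norm_eq_abs]
  have := mul_le_mul (abs_comm_le V W) h (norm_nonneg _) zero_le_one
  linarith

lemma State.c2Bound_diffQuot (hG : State B L η G) (hL : 0 < L) (hBL : 100 * B ≤ L)
    (hη : η ≤ L ^ 2 / 4) {W : Fin 3} (hW : W ≠ 2) :
    C2Bound (diffQuot L G W) (2 * L) (2 * B) (5 * B) := by
  have hs := hG.smooth
  have hfl : ∀ {f : H → Fin 3 → ℝ}, ContDiff ℝ ∞ f → ContDiff ℝ ∞ (fun p => f (flow3 W 1 p)) :=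
    fun hf => hf.comp (contDiff_flow3 W 1)
  have hB : 0 ≤ B := (norm_nonneg _).trans (hG.boundZ 0)
  refine ⟨((hfl hs).sub hs).add contDiff_const, fun p => ?_, fun V p => ?_, fun U V p => ?_⟩
  · have h1 := hG.norm_diffQuot_sub_le W p
    have h2 := hG.norm_grad_le hL hη hW p
    have h3 := norm_le_norm_sub_add (diffQuot L G W p) (WD3 W G p + L • Pi.single W 1)
    linarith
  · rw [hG.WD3_diffQuot]
    have h1 := norm_flow3_sub_le (contDiff_WD3 hs V) W (hG.bound₂ W V) 1 p
    have h2 := norm_comm_smul_le (hG.boundZ (flow3 W 1 p)) V W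
    refine (norm_add_le _ _).trans ?_
    rw [abs_one] at h1
    linarith
  · have sV := contDiff_WD3 hs V
    have s2 := contDiff_WD3 hs 2
    have d1 : ContDiff ℝ ∞ fun p => WD3 V G (flow3 W 1 p) - WD3 V G p := (hfl sV).sub sV
    have d2 : ContDiff ℝ ∞ fun p => comm V W • WD3 2 G (flow3 W 1 p) :=
      (contDiff_const (c := comm V W)).smul (hfl s2)
    rw [hG.WD3_diffQuot, WD3_add d1 d2,
      WD3_sub (hfl sV) sV, WD3_const_smul (hfl s2), WD3_comp_flow3 sV, WD3_comp_flow3 s2]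
    have b1 := hG.bound₂ U V (flow3 W 1 p)
    have b2 := norm_comm_smul_le (hG.bound₂ 2 V (flow3 W 1 p)) U W
    have b3 := hG.bound₂ U V p
    have b4 := norm_comm_smul_le (hG.bound₂ U 2 (flow3 W 1 p)) V W
    have b5 := norm_comm_smul_le (norm_comm_smul_le (hG.bound₂ 2 2 (flow3 W 1 p)) U W) V W
    beta_reduce
    rw [smul_add]
    have t1 := norm_add_le (WD3 U (WD3 V G) (flow3 W 1 p)
        + comm U W • WD3 2 (WD3 V G) (flow3 W 1 p) - WD3 U (WD3 V G) p)
      (comm V W • WD3 U (WD3 2 G) (flow3 W 1 p)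
        + comm V W • comm U W • WD3 2 (WD3 2 G) (flow3 W 1 p))
    have t2 := norm_sub_le (WD3 U (WD3 V G) (flow3 W 1 p)
        + comm U W • WD3 2 (WD3 V G) (flow3 W 1 p)) (WD3 U (WD3 V G) p)
    have t3 := norm_add_le (WD3 U (WD3 V G) (flow3 W 1 p))
      (comm U W • WD3 2 (WD3 V G) (flow3 W 1 p))
    have t4 := norm_add_le (comm V W • WD3 U (WD3 2 G) (flow3 W 1 p))
        (comm V W • comm U W • WD3 2 (WD3 2 G) (flow3 W 1 p))
    linarith

lemma State.c2Bound_normal (hG : State B L η G) (hB1 : 1 ≤ B) (hBL : 100 * B ≤ L)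
    (hη : η ≤ L ^ 2 / 4) : C2Bound (normal L G) 8 (16 * B / L) 1 := by
  have hL : 0 < L := by linarith
  have h := ((hG.c2Bound_diffQuot hL hBL hη (W := 0) (by decide)).bilin
    (hG.c2Bound_diffQuot hL hBL hη (W := 1) (by decide)) crossCLM zero_le_two
    norm_cross_le).const_smul (c := (L ^ 2)⁻¹) (by positivity)
  refine h.mono ?_ ?_ ?_
  · apply le_of_eq; field_simp; norm_num
  · apply le_of_eq; field_simp; norm_num
  · rw [inv_mul_le_iff₀ (by positivity)]
    nlinarith

lemma abs_dotProduct_sub_le {a b α β : Fin 3 → ℝ} (hL : 0 < L) (hB : 0 ≤ B)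
    (hBL : 100 * B ≤ L) (ea : ‖a - α‖ ≤ B) (eb : ‖b - β‖ ≤ B) (nα : ‖α‖ ≤ 6 / 5 * L)
    (nβ : ‖β‖ ≤ 6 / 5 * L) : |a ⬝ᵥ b - α ⬝ᵥ β| ≤ 1 / 10 * L ^ 2 := by
  have dot : ∀ {u v : Fin 3 → ℝ} {m n : ℝ}, ‖u‖ ≤ m → ‖v‖ ≤ n → |u ⬝ᵥ v| ≤ 3 * (m * n) :=
    fun {u v m n} hu hv => (abs_dotProduct_le u v).trans (by
      rw [mul_assoc]
      have := norm_nonneg u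
      gcongr
      linarith)
  have expand : a ⬝ᵥ b - α ⬝ᵥ β = α ⬝ᵥ (b - β) + (a - α) ⬝ᵥ β + (a - α) ⬝ᵥ (b - β) := by
    simp only [sub_dotProduct, dotProduct_sub]; ring
  have h1 := dot nα eb
  have h2 := dot ea nβ
  have h3 := dot ea eb
  have k1 : 6 / 5 * L * B ≤ 6 / 500 * L ^ 2 := by nlinarith
  have k3 : B * B ≤ L ^ 2 / 10000 := by nlinarith
  rw [expand]
  refine (abs_add_three _ _ _).trans ?_
  linarith [sq_nonneg L]

lemma State.norm_normal_ge (hG : State B L η G) (hB1 : 1 ≤ B) (hBL : 100 * B ≤ L)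
    (hη : η ≤ L ^ 2 / 4) (p : H) : 1 / 4 ≤ ‖normal L G p‖ := by
  have hL : 0 < L := by linarith
  have key : ∀ V W : Fin 3, V ≠ 2 → W ≠ 2 → |diffQuot L G V p ⬝ᵥ diffQuot L G W p
      - if V = W then L ^ 2 else 0| ≤ 7 / 20 * L ^ 2 := fun V W hV hW => by
    have h1 := abs_dotProduct_sub_le hL (by linarith) hBL (hG.norm_diffQuot_sub_le V p)
      (hG.norm_diffQuot_sub_le W p) (hG.norm_grad_le hL hη hV p) (hG.norm_grad_le hL hη hW p)
    refine (abs_sub_le _ _ _).trans ((add_le_add h1 (hG.gram V W p hV hW)).trans ?_)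
    linarith
  have naa := key 0 0 (by decide) (by decide)
  have nbb := key 1 1 (by decide) (by decide)
  have nab := key 0 1 (by decide) (by decide)
  rw [if_pos rfl, abs_le] at naa nbb
  rw [if_neg (by decide), sub_zero] at nab
  have hN : normal L G p ⬝ᵥ normal L G p = ((L ^ 2)⁻¹) ^ 2 *
      ((diffQuot L G 0 p ⬝ᵥ diffQuot L G 0 p) * (diffQuot L G 1 p ⬝ᵥ diffQuot L G 1 p)
        - (diffQuot L G 0 p ⬝ᵥ diffQuot L G 1 p) ^ 2) := by
    rw [normal, crossCLM_apply, dotProduct_smul, smul_dotProduct, cross_dot_cross,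
      dotProduct_comm (diffQuot L G 1 p) (diffQuot L G 0 p)]
    simp only [smul_eq_mul]
    ring
  have hlow : 1 / 5 ≤ normal L G p ⬝ᵥ normal L G p := by
    rw [hN]
    generalize diffQuot L G 0 p ⬝ᵥ diffQuot L G 0 p = aa at *
    generalize diffQuot L G 1 p ⬝ᵥ diffQuot L G 1 p = bb at *
    generalize diffQuot L G 0 p ⬝ᵥ diffQuot L G 1 p = ab at *
    have hsq : ab ^ 2 ≤ (7 / 20 * L ^ 2) ^ 2 := by
      rw [← sq_abs]
      exact pow_le_pow_left₀ (abs_nonneg _) nab 2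
    have hprod : (13 / 20 * L ^ 2) * (13 / 20 * L ^ 2) ≤ aa * bb :=
      mul_le_mul (by linarith) (by linarith) (by positivity) (by nlinarith)
    rw [inv_pow, ← div_eq_inv_mul, le_div_iff₀ (by positivity)]
    nlinarith [sq_nonneg (L ^ 2)]
  by_contra! hlt
  have := abs_dotProduct_le (normal L G p) (normal L G p)
  have h0 := norm_nonneg (normal L G p)
  nlinarith [le_abs_self (normal L G p ⬝ᵥ normal L G p)]

variable {h : H → ℝ} {c : ℝ}

lemma State.c2Bound_smul_normal (hG : State B L η G) (hB1 : 1 ≤ B) (hBL : 100 * B ≤ L)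
    (hη : η ≤ L ^ 2 / 4) (hh : C2Bound h c c c) :
    C2Bound (fun p => h p • normal L G p) (8 * c) (9 * c) (11 * c) := by
  have hL : 0 < L := by linarith
  have hc := (norm_nonneg _).trans (hh.bound₀ 0)
  have hN := (hG.c2Bound_normal hB1 hBL hη).mono le_rfl (n₁ := 1)
    (by rw [div_le_one hL]; linarith) le_rfl
  have := hh.bilin hN (ContinuousLinearMap.lsmul ℝ ℝ) (k := 1) zero_le_one
    (fun u v => by simp [norm_smul])
  exact this.mono (by linarith) (by linarith) (by linarith)

lemma State.abs_dot_increment_le (hG : State B L η G) (hB1 : 1 ≤ B) (hBL : 100 * B ≤ L)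
    (hη : η ≤ L ^ 2 / 4) (hh : C2Bound h c c c) {V : Fin 3} (hV : V ≠ 2) (W : Fin 3) (p : H) :
    |(WD3 V G p + L • Pi.single V 1) ⬝ᵥ WD3 W (fun p => h p • normal L G p) p|
      ≤ 120 * B * c := by
  have hL : 0 < L := by linarith
  have hN := hG.c2Bound_normal hB1 hBL hη
  set α := WD3 V G p + L • Pi.single V 1 with hα
  have nα : ‖α‖ ≤ 6 / 5 * L := hG.norm_grad_le hL hη hV p
  have ea : ‖diffQuot L G V p - α‖ ≤ B := hG.norm_diffQuot_sub_le V p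
  have hperp : diffQuot L G V p ⬝ᵥ normal L G p = 0 := by
    rw [normal, crossCLM_apply, dotProduct_smul]
    have : V = 0 ∨ V = 1 := by
      revert hV; fin_cases V <;> simp
    rcases this with rfl | rfl
    · rw [dot_self_cross, smul_zero]
    · rw [dot_cross_self, smul_zero]
  have h1 : |α ⬝ᵥ normal L G p| ≤ 24 * B := by
    have : α ⬝ᵥ normal L G p = -((diffQuot L G V p - α) ⬝ᵥ normal L G p) := by
      rw [sub_dotProduct, hperp]; ring
    rw [this, abs_neg]
    refine (abs_dotProduct_le _ _).trans ?_
    have := mul_le_mul ea (hN.bound₀ p) (norm_nonneg _) (by linarith)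
    linarith
  have h2 : |α ⬝ᵥ WD3 W (normal L G) p| ≤ 96 * B := by
    refine (abs_dotProduct_le _ _).trans ?_
    have := mul_le_mul nα (hN.bound₁ W p) (norm_nonneg _) (by linarith)
    have e : 6 / 5 * L * (16 * B / L) = 96 / 5 * B := by field_simp; norm_num
    linarith
  have hd := congrFun (WD3_bilin (ContinuousLinearMap.lsmul ℝ ℝ) hh.smooth hN.smooth W) p
  simp only [ContinuousLinearMap.lsmul_apply] at hd
  rw [hd, dotProduct_add, dotProduct_smul, dotProduct_smul, smul_eq_mul, smul_eq_mul]
  refine (abs_add_le _ _).trans ?_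
  rw [abs_mul, abs_mul]
  have h3 := mul_le_mul (hh.bound₁ W p) h1 (abs_nonneg _) ((norm_nonneg _).trans (hh.bound₁ W p))
  have h4 := mul_le_mul (hh.bound₀ p) h2 (abs_nonneg _) ((norm_nonneg _).trans (hh.bound₀ p))
  simp only [Real.norm_eq_abs] at h3 h4
  linarith

end Step

section Iteration

open Matrix

/-- Renormalisation by the factor `A`. -/
def rescale (A : ℝ) (G : H → Fin 3 → ℝ) (p : H) : Fin 3 → ℝ := A • G (dilate A⁻¹ p)

variable {A B L η c : ℝ} {G : H → Fin 3 → ℝ} {h : H → ℝ}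

lemma contDiff_comp_dilate {f : H → Fin 3 → ℝ} (hf : ContDiff ℝ ∞ f) (l : ℝ) :
    ContDiff ℝ ∞ fun p => f (dilate l p) := hf.comp (contDiff_dilate l)

lemma WD3_rescale (hG : ContDiff ℝ ∞ G) (A : ℝ) (W : Fin 3) :
    WD3 W (rescale A G) = fun p => A • A⁻¹ ^ wt W • WD3 W G (dilate A⁻¹ p) := by
  unfold rescale
  rw [WD3_const_smul (contDiff_comp_dilate hG _), WD3_comp_dilate hG]

lemma mul_inv_pow_wt_le (hA : 1 ≤ A) (W : Fin 3) : A * A⁻¹ ^ wt W ≤ 1 := by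
  have h0 : 0 < A := by linarith
  have h1 : A⁻¹ ≤ 1 := inv_le_one_of_one_le₀ hA
  have : A⁻¹ ^ wt W ≤ A⁻¹ ^ 1 := by
    apply pow_le_pow_of_le_one (by positivity) h1
    fin_cases W <;> simp [wt]
  calc A * A⁻¹ ^ wt W ≤ A * A⁻¹ ^ 1 := by gcongr
    _ = 1 := by field_simp

lemma inv_pow_wt_le (hA : 1 ≤ A) (W : Fin 3) : A⁻¹ ^ wt W ≤ A⁻¹ := by
  have h0 : 0 < A := by linarith
  calc A⁻¹ ^ wt W = A⁻¹ * (A * A⁻¹ ^ wt W) := by rw [inv_mul_cancel_left₀ h0.ne']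
    _ ≤ A⁻¹ * 1 := by gcongr; exact mul_inv_pow_wt_le hA W
    _ = A⁻¹ := mul_one _

lemma State.rescale (hG : State B L η G) (hA : 1 ≤ A) : State (B / A) L η (rescale A G) := by
  have h0 : 0 < A := by linarith
  have hs := hG.smooth
  have hB : 0 ≤ B := (norm_nonneg _).trans (hG.boundZ 0)
  refine ⟨(contDiff_const (c := A)).smul (contDiff_comp_dilate hs A⁻¹), fun p => ?_,
    fun U W p => ?_,
    fun V W p hV hW => ?_⟩
  · rw [WD3_rescale hs, norm_smul, norm_smul, Real.norm_of_nonneg h0.le,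
      Real.norm_of_nonneg (by positivity)]
    have := hG.boundZ (dilate A⁻¹ p)
    calc A * (A⁻¹ ^ wt 2 * ‖WD3 2 G (dilate A⁻¹ p)‖) ≤ A * (A⁻¹ ^ wt 2 * B) := by gcongr
      _ = B / A := by simp [wt]; field_simp
  · have s1 : ContDiff ℝ ∞ fun p => A⁻¹ ^ wt W • WD3 W G (dilate A⁻¹ p) :=
      (contDiff_const (c := A⁻¹ ^ wt W)).smul (contDiff_comp_dilate (contDiff_WD3 hs W) A⁻¹)
    rw [WD3_rescale hs, WD3_const_smul s1,
      WD3_const_smul (contDiff_comp_dilate (contDiff_WD3 hs W) _),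
      WD3_comp_dilate (contDiff_WD3 hs W)]
    beta_reduce
    rw [norm_smul, norm_smul, norm_smul, Real.norm_of_nonneg h0.le,
      Real.norm_of_nonneg (by positivity), Real.norm_of_nonneg (by positivity)]
    have h1 := hG.bound₂ U W (dilate A⁻¹ p)
    have h2 := mul_inv_pow_wt_le hA W
    have h3 := inv_pow_wt_le hA U
    calc A * (A⁻¹ ^ wt W * (A⁻¹ ^ wt U * ‖WD3 U (WD3 W G) (dilate A⁻¹ p)‖))
        = (A * A⁻¹ ^ wt W) * (A⁻¹ ^ wt U * ‖WD3 U (WD3 W G) (dilate A⁻¹ p)‖) := by ring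
      _ ≤ 1 * (A⁻¹ * B) := by gcongr
      _ = B / A := by rw [one_mul, inv_mul_eq_div]
  · have hw : ∀ W : Fin 3, W ≠ 2 → WD3 W (Heisenberg.rescale A G) p = WD3 W G (dilate A⁻¹ p) :=
      fun W hW => by
        have : wt W = 1 := by revert hW; fin_cases W <;> simp [wt]
        rw [WD3_rescale hs, this]
        beta_reduce
        rw [pow_one, smul_smul, mul_inv_cancel₀ h0.ne', one_smul]
    rw [hw V hV, hw W hW]
    exact hG.gram V W _ hV hW

lemma State.mono {B' η' : ℝ} (hG : State B L η G) (hB : B ≤ B') (hη : η ≤ η') :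
    State B' L η' G :=
  ⟨hG.smooth, fun p => (hG.boundZ p).trans hB, fun U W p => (hG.bound₂ U W p).trans hB,
    fun V W p hV hW => (hG.gram V W p hV hW).trans hη⟩

lemma State.add_normal (hG : State (11 * c) L η G) (hc : 1 ≤ c) (hL : 2200 * c ≤ L)
    (hη : η ≤ L ^ 2 / 4) (hh : C2Bound h c c c) :
    State (22 * c) L (η + 5600 * c ^ 2) (fun p => G p + h p • normal L G p) := by
  have hG' := hG.mono (B' := 22 * c) (by linarith) le_rfl
  have hφ := hG'.c2Bound_smul_normal (by linarith) (by linarith) hη hh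
  refine ⟨hG.smooth.add hφ.smooth, fun p => ?_, fun U W p => ?_, fun V W p hV hW => ?_⟩
  · rw [WD3_add hG.smooth hφ.smooth]
    have h1 := hG.boundZ p
    have h2 := hφ.bound₁ 2 p
    exact (norm_add_le _ _).trans (by linarith)
  · rw [WD3_add hG.smooth hφ.smooth,
      WD3_add (contDiff_WD3 hG.smooth W) (contDiff_WD3 hφ.smooth W)]
    have h1 := hG.bound₂ U W p
    have h2 := hφ.bound₂ U W p
    exact (norm_add_le _ _).trans (by linarith)
  · rw [WD3_add hG.smooth hφ.smooth, WD3_add hG.smooth hφ.smooth]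
    have h1 := hG.gram V W p hV hW
    have h2 := hG'.abs_dot_increment_le (by linarith) (by linarith) hη hh hV W p
    have h3 := hG'.abs_dot_increment_le (by linarith) (by linarith) hη hh hW V p
    have h4 := abs_dotProduct_le (WD3 V (fun p => h p • normal L G p) p)
      (WD3 W (fun p => h p • normal L G p) p)
    have h5 := hφ.bound₁ V p
    have h6 := hφ.bound₁ W p
    have h7 : 3 * ‖WD3 V (fun p => h p • normal L G p) p‖ *
        ‖WD3 W (fun p => h p • normal L G p) p‖ ≤ 3 * (9 * c) * (9 * c) := by gcongr
    have e : ∀ α β u v : Fin 3 → ℝ, ∀ d : ℝ, ∀ a b : Fin 3 → ℝ,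
        (α + u + a) ⬝ᵥ (β + v + b) - d = ((α + a) ⬝ᵥ (β + b) - d) + (α + a) ⬝ᵥ v
          + (β + b) ⬝ᵥ u + u ⬝ᵥ v := fun α β u v d a b => by
      rw [dotProduct_comm (β + b) u]
      simp only [add_dotProduct, dotProduct_add]
      ring
    rw [e]
    refine (abs_add_le _ _).trans ?_
    refine (add_le_add_left (abs_add_three _ _ _) _).trans ?_
    nlinarith

/-- The renormalised iteration. -/
def iter (A L : ℝ) (h : H → ℝ) : ℕ → H → Fin 3 → ℝ
  | 0 => fun _ => 0
  | n + 1 => fun p => rescale A (iter A L h n) p + h p • normal L (rescale A (iter A L h n)) p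

lemma state_zero (hc : 0 ≤ B) : State B L 0 (fun _ => (0 : Fin 3 → ℝ)) := by
  have e : ∀ W : Fin 3, WD3 W (fun _ : H => (0 : Fin 3 → ℝ)) = fun _ => 0 := fun W => by
    funext p; rw [WD3_apply]; simp
  refine ⟨contDiff_const, fun p => ?_, fun U W p => ?_, fun V W p _ _ => ?_⟩
  · rw [e]; simpa using hc
  · rw [e, e]; simpa using hc
  · rw [e, e]
    by_cases hVW : V = W
    · subst hVW; simp [sq]
    · simp [hVW]

lemma state_iter (hc : 1 ≤ c) (hh : C2Bound h c c c) (hA : 2 ≤ A) (hL : 2200 * c ≤ L) {N : ℕ}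
    (hN : 5600 * c ^ 2 * N ≤ L ^ 2 / 4) {n : ℕ} (hn : n ≤ N) :
    State (22 * c) L (5600 * c ^ 2 * n) (iter A L h n) := by
  induction n with
  | zero => simpa [iter] using state_zero (B := 22 * c) (L := L) (by linarith)
  | succ n ih =>
    have h1 := ih (by omega)
    have h2 := (h1.rescale (A := A) (by linarith)).mono (B' := 11 * c)
      (by rw [div_le_iff₀ (by linarith)]; nlinarith) le_rfl
    have h3 : (n : ℝ) ≤ N := by exact_mod_cast (by omega : n ≤ N)
    have h4 := h2.add_normal hc hL (by nlinarith [sq_nonneg c]) hh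
    refine h4.mono le_rfl ?_
    push_cast
    linarith

lemma norm_increment_le (hc : 1 ≤ c) (hh : C2Bound h c c c) (hA : 2 ≤ A) (hL : 2200 * c ≤ L)
    {N : ℕ} (hN : 5600 * c ^ 2 * N ≤ L ^ 2 / 4) {n : ℕ} (hn : n < N) :
    State (22 * c / A) L (5600 * c ^ 2 * n) (rescale A (iter A L h n)) ∧
      State (22 * c) L (5600 * c ^ 2 * n) (rescale A (iter A L h n)) ∧
      5600 * c ^ 2 * n ≤ L ^ 2 / 4 := by
  have h1 := (state_iter hc hh hA hL hN hn.le).rescale (A := A) (by linarith)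
  have h3 : (n : ℝ) ≤ N := by exact_mod_cast hn.le
  exact ⟨h1, h1.mono (div_le_self (by linarith) (by linarith)) le_rfl,
    by nlinarith [sq_nonneg c]⟩

lemma dilate_dilate (a b : ℝ) (p : H) : dilate a (dilate b p) = dilate (a * b) p := by
  simp only [dilate, Prod.ext_iff]
  refine ⟨?_, ?_, ?_⟩ <;> ring

lemma dilate_one (p : H) : dilate 1 p = p := by simp [dilate]

lemma norm_iter_add_sub_le (hc : 1 ≤ c) (hh : C2Bound h c c c) (hA : 2 ≤ A)
    (hL : 2200 * c ≤ L) {N : ℕ} (hN : 5600 * c ^ 2 * N ≤ L ^ 2 / 4) (n k : ℕ) (hn : n + k ≤ N)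
    (p : H) : ‖iter A L h (n + k) p - A ^ k • iter A L h n (dilate (A ^ k)⁻¹ p)‖
      ≤ 16 * c * (A ^ k - 1) / A := by
  have h0 : 0 < A := by linarith
  induction k generalizing p with
  | zero => simp [dilate_one]
  | succ k ih =>
    obtain ⟨-, h2, h3⟩ := norm_increment_le hc hh hA hL hN (n := n + k) (by omega)
    have hφ := (h2.c2Bound_smul_normal (by linarith) (by linarith) h3 hh).bound₀ p
    have e : iter A L h (n + (k + 1)) p - A ^ (k + 1) • iter A L h n (dilate (A ^ (k + 1))⁻¹ p)
        = A • (iter A L h (n + k) (dilate A⁻¹ p)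
            - A ^ k • iter A L h n (dilate (A ^ k)⁻¹ (dilate A⁻¹ p)))
          + h p • normal L (rescale A (iter A L h (n + k))) p := by
      rw [dilate_dilate, ← mul_inv, ← pow_succ, smul_sub, smul_smul, ← pow_succ', ← add_assoc n k 1]
      simp only [iter, rescale]
      abel
    rw [e]
    refine (norm_add_le _ _).trans ?_
    rw [norm_smul, Real.norm_of_nonneg h0.le]
    refine (add_le_add (mul_le_mul_of_nonneg_left (ih (by omega) _) h0.le) hφ).trans ?_
    rw [le_div_iff₀ h0]
    have : A * (16 * c * (A ^ k - 1) / A) = 16 * c * (A ^ k - 1) := by field_simp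
    rw [this, pow_succ]
    nlinarith

end Iteration

section Profile

open Matrix

/-- The unrenormalised outcome of `N` steps of the iteration. -/
def profile (A L : ℝ) (h : H → ℝ) (N : ℕ) (p : H) : Fin 3 → ℝ :=
  (A ^ N)⁻¹ • iter A L h N (dilate (A ^ N) p)

variable {A L c : ℝ} {h : H → ℝ} {N : ℕ}

lemma flowZ_dilate (l t : ℝ) (p : H) : dilate l (flowZ t p) = flowZ (l ^ 2 * t) (dilate l p) := by
  simp only [dilate, flowZ, mul_add]

lemma norm_profile_sub_le (hc : 1 ≤ c) (hh : C2Bound h c c c) (hA : 2 ≤ A)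
    (hL : 2200 * c ≤ L) (hN : 5600 * c ^ 2 * N ≤ L ^ 2 / 4) {n : ℕ} (hn : n ≤ N) (p : H) :
    ‖profile A L h N p - (A ^ n)⁻¹ • iter A L h n (dilate (A ^ n) p)‖
      ≤ (A ^ n)⁻¹ * (16 * c / A) := by
  have h0 : 0 < A := by linarith
  obtain ⟨k, rfl⟩ := Nat.exists_eq_add_of_le hn
  have h1 := norm_iter_add_sub_le hc hh hA hL hN n k le_rfl (dilate (A ^ (n + k)) p)
  have e : profile A L h (n + k) p - (A ^ n)⁻¹ • iter A L h n (dilate (A ^ n) p)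
      = (A ^ (n + k))⁻¹ • (iter A L h (n + k) (dilate (A ^ (n + k)) p)
        - A ^ k • iter A L h n (dilate (A ^ k)⁻¹ (dilate (A ^ (n + k)) p))) := by
    have e1 : (A ^ k)⁻¹ * A ^ (n + k) = A ^ n := by rw [pow_add]; field_simp
    have e2 : (A ^ (n + k))⁻¹ * A ^ k = (A ^ n)⁻¹ := by rw [pow_add]; field_simp
    rw [dilate_dilate, e1, smul_sub, smul_smul, e2, profile]
  rw [e, norm_smul, Real.norm_of_nonneg (by positivity)]
  refine (mul_le_mul_of_nonneg_left h1 (by positivity)).trans ?_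
  have e3 : (A ^ n)⁻¹ * (16 * c / A) = (A ^ (n + k))⁻¹ * (16 * c * A ^ k / A) := by
    rw [pow_add]; field_simp
  rw [e3]
  gcongr
  linarith

lemma norm_profile_le (hc : 1 ≤ c) (hh : C2Bound h c c c) (hA : 2 ≤ A)
    (hL : 2200 * c ≤ L) (hN : 5600 * c ^ 2 * N ≤ L ^ 2 / 4) (p : H) :
    ‖profile A L h N p‖ ≤ 16 * c / A := by
  have := norm_profile_sub_le hc hh hA hL hN (Nat.zero_le N) p
  simpa [iter] using this

lemma norm_profile_flow_sub_le (hc : 1 ≤ c) (hh : C2Bound h c c c) (hA : 2 ≤ A)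
    (hL : 2200 * c ≤ L) (hN : 5600 * c ^ 2 * N ≤ L ^ 2 / 4) {W : Fin 3} (hW : W ≠ 2) (t : ℝ)
    (p : H) : ‖profile A L h N (flow3 W t p) - profile A L h N p‖ ≤ 3 * L * |t| := by
  have h0 : 0 < A := by linarith
  have hS := state_iter hc hh hA hL hN le_rfl
  have hgrad : ∀ p, ‖WD3 W (iter A L h N) p‖ ≤ 3 * L := fun p => by
    have h1 := hS.norm_grad_le (by linarith) hN hW p
    have h2 : ‖L • (Pi.single W 1 : Fin 3 → ℝ)‖ ≤ L := by
      rw [norm_smul, Real.norm_of_nonneg (by linarith), Pi.norm_single]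
      simp
    have h3 := norm_sub_le (WD3 W (iter A L h N) p + L • Pi.single W 1) (L • Pi.single W 1)
    rw [add_sub_cancel_right] at h3
    linarith
  have e : dilate (A ^ N) (flow3 W t p) = flow3 W (A ^ N * t) (dilate (A ^ N) p) := by
    revert hW
    fin_cases W <;> simp [flow3, dilate, flowX, flowY, Prod.ext_iff] <;> (ring_nf; try trivial)
  have h1 := norm_flow3_sub_le hS.smooth W hgrad (A ^ N * t) (dilate (A ^ N) p)
  rw [profile, profile, ← smul_sub, norm_smul, Real.norm_of_nonneg (by positivity), e]
  refine (mul_le_mul_of_nonneg_left h1 (by positivity)).trans (le_of_eq ?_)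
  rw [abs_mul, abs_of_nonneg (by positivity : 0 ≤ A ^ N)]
  field_simp

lemma norm_iter_flowZ_sub_le (hc : 1 ≤ c) (hh : C2Bound h c c c) (hA : 2 ≤ A)
    (hL : 2200 * c ≤ L) (hN : 5600 * c ^ 2 * N ≤ L ^ 2 / 4) {n : ℕ} (hn : n ≤ N) (t : ℝ)
    (p : H) : ‖(A ^ n)⁻¹ • iter A L h n (dilate (A ^ n) (flowZ t p))
      - (A ^ n)⁻¹ • iter A L h n (dilate (A ^ n) p)‖ ≤ 22 * c * A ^ n * |t| := by
  have h0 : 0 < A := by linarith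
  have hS := state_iter hc hh hA hL hN hn
  have h1 := norm_flow3_sub_le hS.smooth 2 hS.boundZ ((A ^ n) ^ 2 * t) (dilate (A ^ n) p)
  rw [← smul_sub, norm_smul, Real.norm_of_nonneg (by positivity), flowZ_dilate]
  refine (mul_le_mul_of_nonneg_left h1 (by positivity)).trans (le_of_eq ?_)
  rw [abs_mul, abs_of_nonneg (by positivity : 0 ≤ (A ^ n) ^ 2)]
  field_simp

lemma norm_profile_flowZ_sub_le (hc : 1 ≤ c) (hh : C2Bound h c c c) (hA : 2 ≤ A)
    (hL : 2200 * c ≤ L) (hN : 5600 * c ^ 2 * N ≤ L ^ 2 / 4) (t : ℝ) (p : H) :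
    ‖profile A L h N (flowZ t p) - profile A L h N p‖ ≤ 22 * c * A ^ N * |t| :=
  norm_iter_flowZ_sub_le hc hh hA hL hN le_rfl t p

lemma norm_profile_flowZ_sub_le_sqrt (hc : 1 ≤ c) (hh : C2Bound h c c c) (hA : 2 ≤ A)
    (hL : 2200 * c ≤ L) (hN : 5600 * c ^ 2 * N ≤ L ^ 2 / 4) (t : ℝ) (p : H) :
    ‖profile A L h N (flowZ t p) - profile A L h N p‖ ≤ 54 * c * A * √|t| := by
  have h0 : 0 < A := by linarith
  have hs := Real.sqrt_nonneg |t|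
  have hst : √|t| * √|t| = |t| := Real.mul_self_sqrt (abs_nonneg t)
  have hcA : 32 * c / A ≤ 32 * c * A := by
    rw [div_le_iff₀ h0]
    have : 1 ≤ A * A := by nlinarith
    nlinarith
  rcases le_or_gt 1 (√|t|) with h1 | h1
  · have a1 := norm_profile_le hc hh hA hL hN p
    have a2 := norm_profile_le hc hh hA hL hN (flowZ t p)
    refine (norm_sub_le _ _).trans ?_
    have : 16 * c / A + 16 * c / A = 32 * c / A := by ring
    have h2 : 54 * c * A * 1 ≤ 54 * c * A * √|t| := by gcongr
    nlinarith
  by_cases h2 : √|t| * A ^ N ≤ A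
  · refine (norm_profile_flowZ_sub_le hc hh hA hL hN t p).trans ?_
    calc 22 * c * A ^ N * |t| = 22 * c * √|t| * (√|t| * A ^ N) := by
          linear_combination (-22 * c * A ^ N) * hst
      _ ≤ 22 * c * √|t| * A := by gcongr
      _ ≤ 54 * c * A * √|t| := by nlinarith [mul_nonneg (mul_nonneg (by linarith : 0 ≤ c) h0.le) hs]
  obtain ⟨n, hn1, hn2⟩ : ∃ n ≤ N, 1 ≤ √|t| * A ^ n ∧ √|t| * A ^ n ≤ A := by
    have hex : ∃ n, 1 ≤ √|t| * A ^ n := ⟨N, by linarith⟩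
    classical
    refine ⟨Nat.find hex, Nat.find_min' hex (by linarith), Nat.find_spec hex, ?_⟩
    have hne : Nat.find hex ≠ 0 := fun h => by
      have := Nat.find_spec hex
      rw [h, pow_zero, mul_one] at this
      linarith
    obtain ⟨m, hm⟩ := Nat.exists_eq_succ_of_ne_zero hne
    have := Nat.find_min hex (m := m) (by omega)
    rw [hm, Nat.succ_eq_add_one, pow_succ, ← mul_assoc]
    nlinarith
  have a1 := norm_profile_sub_le hc hh hA hL hN hn1 p
  have a2 := norm_profile_sub_le hc hh hA hL hN hn1 (flowZ t p)
  have a3 := norm_iter_flowZ_sub_le hc hh hA hL hN hn1 t p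
  have hsplit : ∀ a b a' b' : Fin 3 → ℝ, ‖a - b‖ ≤ ‖a - a'‖ + ‖a' - b'‖ + ‖b - b'‖ :=
    fun a b a' b' => by
      have : a - b = (a - a') + (a' - b') - (b - b') := by abel
      rw [this]
      exact (norm_sub_le _ _).trans (by gcongr; exact norm_add_le _ _)
  refine (hsplit _ _ _ _).trans ((add_le_add (add_le_add a2 a3) a1).trans ?_)
  have k1 : (A ^ n)⁻¹ ≤ √|t| := by
    rw [← one_div, div_le_iff₀ (by positivity)]; exact hn2.1
  have k2 : (A ^ n)⁻¹ * (16 * c / A) ≤ √|t| * (16 * c * A) := by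
    have : 16 * c / A ≤ 16 * c * A := by linarith [hcA, (by ring : 32 * c / A = 2 * (16 * c / A))]
    gcongr
  have k3 : 22 * c * A ^ n * |t| ≤ 22 * c * A * √|t| := by
    calc 22 * c * A ^ n * |t| = 22 * c * √|t| * (√|t| * A ^ n) := by
          linear_combination (-22 * c * A ^ n) * hst
      _ ≤ 22 * c * √|t| * A := by gcongr; exact hn2.2
      _ = _ := by ring
  linarith

lemma le_norm_profile_flowZ_sub (hc : 1 ≤ c) (hh : C2Bound h c c c) (hA : 8800 * c ≤ A)
    (hL : 140800 * c ^ 2 ≤ L) (hN : 5600 * c ^ 2 * N ≤ L ^ 2 / 4) {n : ℕ} (hn1 : 1 ≤ n)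
    (hn : n ≤ N) {t : ℝ} (ht : (A ^ n) ^ 2 * |t| ≤ 4) (p : H)
    (hsep : 2 / 5 ≤ |h (dilate (A ^ n) (flowZ t p)) - h (dilate (A ^ n) p)|) :
    1 / 20 * (A ^ n)⁻¹ ≤ ‖profile A L h N (flowZ t p) - profile A L h N p‖ := by
  have h0 : 0 < A := by linarith
  have hA2 : 2 ≤ A := by linarith
  have hL2 : 2200 * c ≤ L := by nlinarith
  have a1 := norm_profile_sub_le hc hh hA2 hL2 hN hn p
  have a2 := norm_profile_sub_le hc hh hA2 hL2 hN hn (flowZ t p)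
  have hsplit : ∀ a b a' b' : Fin 3 → ℝ, ‖a' - b'‖ ≤ ‖a - b‖ + ‖a - a'‖ + ‖b - b'‖ :=
    fun a b a' b' => by
      have : a' - b' = (a - b) - (a - a') + (b - b') := by abel
      rw [this]
      exact (norm_add_le _ _).trans (by gcongr; exact norm_sub_le _ _)
  have a3 := hsplit (profile A L h N (flowZ t p)) (profile A L h N p)
    ((A ^ n)⁻¹ • iter A L h n (dilate (A ^ n) (flowZ t p)))
    ((A ^ n)⁻¹ • iter A L h n (dilate (A ^ n) p))
  have a4 : (A ^ n)⁻¹ * (7 / 100) ≤ ‖(A ^ n)⁻¹ • iter A L h n (dilate (A ^ n) (flowZ t p))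
      - (A ^ n)⁻¹ • iter A L h n (dilate (A ^ n) p)‖ := by
    rw [← smul_sub, norm_smul, Real.norm_of_nonneg (by positivity)]
    gcongr
    obtain ⟨m, rfl⟩ : ∃ m, n = m + 1 := ⟨n - 1, by omega⟩
    obtain ⟨s1, s2, s3⟩ := norm_increment_le hc hh hA2 hL2 hN (n := m) (by omega)
    have hn2 := s2.c2Bound_normal (by linarith) (by linarith) s3
    rw [flowZ_dilate] at hsep ⊢
    obtain ⟨q, hq⟩ : ∃ q, q = dilate (A ^ (m + 1)) p := ⟨_, rfl⟩
    obtain ⟨s, hs⟩ : ∃ s, s = (A ^ (m + 1)) ^ 2 * t := ⟨_, rfl⟩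
    have hs4 : |s| ≤ 4 := by
      rw [hs, abs_mul, abs_of_nonneg (by positivity)]; exact ht
    rw [← hq, ← hs] at hsep ⊢
    simp only [iter]
    obtain ⟨G, hG⟩ : ∃ G, G = rescale A (iter A L h m) := ⟨_, rfl⟩
    rw [← hG] at s1 s2 hn2 ⊢
    have b1 : ‖G (flowZ s q) - G q‖ ≤ 1 / 100 := by
      refine (norm_flow3_sub_le s1.smooth 2 s1.boundZ s q).trans ?_
      calc 22 * c / A * |s| ≤ 22 * c / A * 4 := by gcongr
        _ ≤ 1 / 100 := by
          rw [div_mul_eq_mul_div, div_le_iff₀ h0]; linarith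
    have b2 : ‖normal L G (flowZ s q) - normal L G q‖ ≤ 1 / (100 * c) := by
      refine (norm_flow3_sub_le hn2.smooth 2 (hn2.bound₁ 2) s q).trans ?_
      have hLp : 0 < L := by nlinarith
      calc 16 * (22 * c) / L * |s| ≤ 16 * (22 * c) / L * 4 := by gcongr
        _ ≤ 1 / (100 * c) := by
          rw [div_mul_eq_mul_div, div_le_div_iff₀ hLp (by linarith)]; nlinarith
    have b3 := s2.norm_normal_ge (by linarith) (by linarith) s3 (flowZ s q)
    have b4 := hh.bound₀ q
    have e : G (flowZ s q) + h (flowZ s q) • normal L G (flowZ s q) - (G q + h q • normal L G q)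
        = (h (flowZ s q) - h q) • normal L G (flowZ s q)
          + h q • (normal L G (flowZ s q) - normal L G q) + (G (flowZ s q) - G q) := by
      rw [sub_smul, smul_sub]; abel
    rw [e]
    have c1 := norm_sub_le_norm_add ((h (flowZ s q) - h q) • normal L G (flowZ s q)
      + h q • (normal L G (flowZ s q) - normal L G q)) (G (flowZ s q) - G q)
    have c2 := norm_sub_le_norm_add ((h (flowZ s q) - h q) • normal L G (flowZ s q))
      (h q • (normal L G (flowZ s q) - normal L G q))
    have c3 : 2 / 5 * (1 / 4) ≤ ‖(h (flowZ s q) - h q) • normal L G (flowZ s q)‖ := by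
      rw [norm_smul, Real.norm_eq_abs]; gcongr
    have c4 : ‖h q • (normal L G (flowZ s q) - normal L G q)‖ ≤ 1 / 100 := by
      rw [norm_smul]
      calc ‖h q‖ * _ ≤ c * (1 / (100 * c)) := by gcongr
        _ = 1 / 100 := by field_simp
    linarith
  have k : (A ^ n)⁻¹ * (16 * c / A) ≤ (A ^ n)⁻¹ * (1 / 200) := by
    refine mul_le_mul_of_nonneg_left ?_ (by positivity)
    rw [div_le_div_iff₀ h0 (by norm_num)]; linarith
  have : 0 < (A ^ n)⁻¹ := by positivity
  linarith

end Profile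

section Oscillation

/-- An oscillation in `z`, localised by `g` around the plane `y = k`. -/
def wave (g : ℝ → ℝ) (k s : ℝ) (p : H) : ℝ := g (p.2.1 - k) * Real.cos (p.2.2 - k * p.1 + s)

/-- The effect of `X, Y, Z` on the amplitude of a `wave`. -/
def amplitude (W : Fin 3) (g : ℝ → ℝ) : ℝ → ℝ := ![fun u => u * g u, deriv g, g] W

/-- The effect of `X, Y, Z` on the phase of a `wave`. -/
def phase (W : Fin 3) : ℝ := ![Real.pi / 2, 0, Real.pi / 2] W

lemma contDiff_amplitude {g : ℝ → ℝ} (hg : ContDiff ℝ ∞ g) (W : Fin 3) :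
    ContDiff ℝ ∞ (amplitude W g) := by
  fin_cases W
  · exact contDiff_id.mul hg
  · exact (contDiff_infty_iff_deriv.mp hg).2
  · exact hg

lemma hasCompactSupport_amplitude {g : ℝ → ℝ} (hg : HasCompactSupport g) (W : Fin 3) :
    HasCompactSupport (amplitude W g) := by
  fin_cases W
  · exact hg.mul_left
  · exact hg.deriv
  · exact hg

lemma contDiff_wave {g : ℝ → ℝ} (hg : ContDiff ℝ ∞ g) (k s : ℝ) : ContDiff ℝ ∞ (wave g k s) := by
  have h2 : ContDiff ℝ ∞ fun p : H => p.2.1 := contDiff_fst.comp contDiff_snd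
  have h3 : ContDiff ℝ ∞ fun p : H => p.2.2 := contDiff_snd.comp contDiff_snd
  exact (hg.comp (h2.sub contDiff_const)).mul
    (Real.contDiff_cos.comp ((h3.sub (contDiff_const.mul contDiff_fst)).add contDiff_const))

lemma WD3_wave {g : ℝ → ℝ} (hg : ContDiff ℝ ∞ g) (k s : ℝ) (W : Fin 3) :
    WD3 W (wave g k s) = wave (amplitude W g) k (s + phase W) := by
  funext p
  have h1 := hasDerivAt_comp_flow3 (contDiff_wave hg k s) W 0 p
  rw [flow3_zero] at h1
  refine h1.unique ?_
  have hc : ∀ v a : ℝ, HasDerivAt (fun t : ℝ => Real.cos (a + t * v)) (-Real.sin a * v) 0 :=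
    fun v a => by
      have := (((hasDerivAt_id (0 : ℝ)).mul_const v).const_add a).cos
      simpa using this
  fin_cases W
  · change HasDerivAt (fun t => wave g k s (flowX t p))
      (wave (fun u => u * g u) k (s + Real.pi / 2) p) 0
    refine (((hc (p.2.1 - k) (p.2.2 - k * p.1 + s)).const_mul (g (p.2.1 - k))).congr_deriv
      ?_).congr_of_eventuallyEq (Filter.Eventually.of_forall fun t => ?_)
    · rw [wave, ← add_assoc, Real.cos_add_pi_div_two]
      ring
    · simp only [wave, flowX]
      ring_nf
  · change HasDerivAt (fun t => wave g k s (flowY t p)) (wave (deriv g) k (s + 0) p) 0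
    have hgd : HasDerivAt g (deriv g (p.2.1 - k)) (p.2.1 - k + 0) := by
      rw [add_zero]; exact ((hg.differentiable (by simp)) _).hasDerivAt
    refine (((hgd.comp_const_add (p.2.1 - k) 0).mul_const
      (Real.cos (p.2.2 - k * p.1 + s))).congr_deriv ?_).congr_of_eventuallyEq
      (Filter.Eventually.of_forall fun t => ?_)
    · rw [wave, add_zero]
    · simp only [wave, flowY]
      ring_nf
  · change HasDerivAt (fun t => wave g k s (flowZ t p)) (wave g k (s + Real.pi / 2) p) 0
    refine (((hc 1 (p.2.2 - k * p.1 + s)).const_mul (g (p.2.1 - k))).congr_deriv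
      ?_).congr_of_eventuallyEq (Filter.Eventually.of_forall fun t => ?_)
    · rw [wave, ← add_assoc, Real.cos_add_pi_div_two]
      ring
    · simp only [wave, flowZ]
      ring_nf

/-- The point of `2ℤ + σ` closest to `y`. -/
def center (σ y : ℝ) : ℝ := 2 * round ((y - σ) / 2) + σ

lemma abs_sub_center_le (σ y : ℝ) : |y - center σ y| ≤ 1 := by
  have := abs_sub_round ((y - σ) / 2)
  rw [abs_le] at this ⊢
  unfold center
  constructor <;> linarith

lemma two_le_abs_center_sub {σ y z : ℝ} (h : center σ y ≠ center σ z) :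
    2 ≤ |center σ y - center σ z| := by
  have h1 : round ((y - σ) / 2) ≠ round ((z - σ) / 2) := fun e => h (by simp [center, e])
  have h2 : (1 : ℤ) ≤ |round ((y - σ) / 2) - round ((z - σ) / 2)| :=
    Int.one_le_abs (sub_ne_zero.mpr h1)
  have h3 : (1 : ℝ) ≤ |(round ((y - σ) / 2) : ℝ) - round ((z - σ) / 2)| := by exact_mod_cast h2
  have e : center σ y - center σ z = 2 * ((round ((y - σ) / 2) : ℝ) - round ((z - σ) / 2)) := by
    unfold center; ring
  rw [e, abs_mul, abs_two]
  linarith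

lemma exists_abs_sub_center_le (y : ℝ) : |y - center 0 y| ≤ 1 / 2 ∨ |y - center 1 y| ≤ 1 / 2 := by
  have h0 := abs_sub_center_le 0 y
  by_cases h : |y - center 0 y| ≤ 1 / 2
  · exact Or.inl h
  right
  have key : ∀ z : ℤ, |(y - 1) / 2 - z| ≤ 1 / 4 → |y - center 1 y| ≤ 1 / 2 := fun z hz => by
    have h1 := (round_le ((y - 1) / 2) z).trans hz
    rw [abs_le] at h1 ⊢
    unfold center
    constructor <;> linarith
  unfold center at h h0
  rw [abs_le] at h0
  rcases le_total 0 (y - (2 * (round ((y - 0) / 2) : ℝ) + 0)) with h1 | h1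
  · rw [abs_of_nonneg h1] at h
    refine key (round ((y - 0) / 2)) ?_
    rw [abs_le]; constructor <;> linarith
  · rw [abs_of_nonpos h1] at h
    refine key (round ((y - 0) / 2) - 1) ?_
    push_cast
    rw [abs_le]; constructor <;> linarith

/-- Oscillations in `z`, localised around the planes `y ∈ 2ℤ + σ`. -/
def waves (g : ℝ → ℝ) (σ s : ℝ) (p : H) : ℝ := wave g (center σ p.2.1) s p

variable {g : ℝ → ℝ}

lemma waves_eventuallyEq (hg : ∀ u, 3 / 4 ≤ |u| → g u = 0) (σ s : ℝ) (p : H) :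
    waves g σ s =ᶠ[nhds p] wave g (center σ p.2.1) s := by
  have hcont : Continuous fun q : H => q.2.1 := continuous_fst.comp continuous_snd
  have : ∀ᶠ q : H in nhds p, |q.2.1 - p.2.1| < 1 / 8 := by
    have := hcont.continuousAt.eventually (Metric.ball_mem_nhds p.2.1 (by norm_num : (0:ℝ) < 1 / 8))
    simpa only [Metric.mem_ball, Real.dist_eq] using this
  filter_upwards [this] with q hq
  by_cases h : center σ q.2.1 = center σ p.2.1
  · rw [waves, h]
  have h1 := two_le_abs_center_sub h
  have h2 := abs_sub_center_le σ q.2.1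
  have h3 := abs_sub_center_le σ p.2.1
  have e1 : g (q.2.1 - center σ q.2.1) = 0 := hg _ (by
    have := abs_add_three (q.2.1 - p.2.1) (p.2.1 - center σ p.2.1) (center σ q.2.1 - q.2.1)
    have e : q.2.1 - p.2.1 + (p.2.1 - center σ p.2.1) + (center σ q.2.1 - q.2.1)
      = center σ q.2.1 - center σ p.2.1 := by ring
    rw [e, abs_sub_comm (center σ q.2.1) q.2.1] at this
    linarith)
  have e2 : g (q.2.1 - center σ p.2.1) = 0 := hg _ (by
    have := abs_add_le (q.2.1 - center σ p.2.1) (center σ q.2.1 - q.2.1)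
    have e : q.2.1 - center σ p.2.1 + (center σ q.2.1 - q.2.1)
      = center σ q.2.1 - center σ p.2.1 := by ring
    rw [e, abs_sub_comm (center σ q.2.1) q.2.1] at this
    linarith)
  simp [waves, wave, e1, e2]

lemma abs_wave_le (g : ℝ → ℝ) (k s : ℝ) (p : H) : ‖wave g k s p‖ ≤ |g (p.2.1 - k)| := by
  rw [wave, norm_mul, Real.norm_eq_abs, Real.norm_eq_abs]
  exact mul_le_of_le_one_right (abs_nonneg _) (Real.abs_cos_le_one _)

lemma c2Bound_waves (hg : ∀ u, 3 / 4 ≤ |u| → g u = 0) (hs : ContDiff ℝ ∞ g) {c : ℝ}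
    (h0 : ∀ u, |g u| ≤ c) (h1 : ∀ W u, |amplitude W g u| ≤ c)
    (h2 : ∀ U W u, |amplitude U (amplitude W g) u| ≤ c) (σ s : ℝ) :
    C2Bound (waves g σ s) c c c := by
  refine ⟨contDiff_iff_contDiffAt.mpr fun p => ?_, fun p => ?_, fun W p => ?_, fun U W p => ?_⟩
  · exact (contDiff_wave hs _ s).contDiffAt.congr_of_eventuallyEq (waves_eventuallyEq hg σ s p)
  · exact (abs_wave_le _ _ _ _).trans (h0 _)
  · rw [(WD3_congr (waves_eventuallyEq hg σ s p) W).eq_of_nhds, WD3_wave hs]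
    exact (abs_wave_le _ _ _ _).trans (h1 _ _)
  · rw [(WD3_congr (WD3_congr (waves_eventuallyEq hg σ s p) W) U).eq_of_nhds, WD3_wave hs,
      WD3_wave (contDiff_amplitude hs W)]
    exact (abs_wave_le _ _ _ _).trans (h2 _ _ _)

lemma cos_le_of_abs_mem {t : ℝ} (h1 : 1 ≤ |t|) (h4 : |t| ≤ 4) : Real.cos t ≤ 5 / 9 := by
  rw [← Real.cos_abs]
  rcases le_total |t| Real.pi with h | h
  · exact (Real.cos_le_cos_of_nonneg_of_le_pi zero_le_one h h1).trans Real.cos_one_le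
  · have := Real.pi_gt_three
    exact (Real.cos_nonpos_of_pi_div_two_le_of_le (by linarith) (by linarith)).trans (by norm_num)

lemma exists_separating_wave (hg : ∀ u, |u| ≤ 1 / 2 → g u = 1) {t : ℝ} (h1 : 1 ≤ |t|)
    (h4 : |t| ≤ 4) (p : H) : ∃ b : Bool × Bool,
      2 / 5 ≤ |waves g (if b.1 then 1 else 0) (if b.2 then -(Real.pi / 2) else 0) (flowZ t p)
        - waves g (if b.1 then 1 else 0) (if b.2 then -(Real.pi / 2) else 0) p| := by
  obtain ⟨b, hb⟩ : ∃ b : Bool, |p.2.1 - center (if b then 1 else 0) p.2.1| ≤ 1 / 2 := by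
    rcases exists_abs_sub_center_le p.2.1 with h | h
    · exact ⟨false, by simpa using h⟩
    · exact ⟨true, by simpa using h⟩
  obtain ⟨k, hk⟩ : ∃ k, k = center (if b then 1 else 0) p.2.1 := ⟨_, rfl⟩
  obtain ⟨a, ha⟩ : ∃ a, a = p.2.2 - k * p.1 := ⟨_, rfl⟩
  have hg1 : g (p.2.1 - k) = 1 := hg _ (hk ▸ hb)
  have e : ∀ s, waves g (if b then 1 else 0) s (flowZ t p) - waves g (if b then 1 else 0) s p
      = Real.cos (a + t + s) - Real.cos (a + s) := fun s => by
    simp only [waves, wave, flowZ, ← hk, hg1, one_mul, ha]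
    ring_nf
  have hc := cos_le_of_abs_mem h1 h4
  have hsum : (Real.cos (a + t) - Real.cos a) ^ 2 + (Real.sin (a + t) - Real.sin a) ^ 2
      = 2 - 2 * Real.cos t := by
    have h5 : Real.cos t = Real.cos (a + t) * Real.cos a + Real.sin (a + t) * Real.sin a := by
      rw [← Real.cos_sub]; ring_nf
    rw [h5]
    linear_combination Real.sin_sq_add_cos_sq (a + t) + Real.sin_sq_add_cos_sq a
  by_contra! hlt
  have l1 := hlt (b, false)
  have l2 := hlt (b, true)
  simp only [e, Bool.false_eq_true, if_false, if_true, add_zero, ← sub_eq_add_neg,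
    Real.cos_sub_pi_div_two] at l1 l2
  have m1 := sq_lt_sq' (abs_lt.mp l1).1 (abs_lt.mp l1).2
  have m2 := sq_lt_sq' (abs_lt.mp l2).1 (abs_lt.mp l2).2
  linarith

lemma exists_oscillations : ∃ (c : ℝ) (h : Bool × Bool → H → ℝ), 1 ≤ c ∧
    (∀ b, C2Bound (h b) c c c) ∧ ∀ (t : ℝ) (p : H), 1 ≤ |t| → |t| ≤ 4 →
      ∃ b, 2 / 5 ≤ |h b (flowZ t p) - h b p| := by
  let φ : ContDiffBump (0 : ℝ) := ⟨1 / 2, 3 / 4, by norm_num, by norm_num⟩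
  have hs : ContDiff ℝ ∞ φ := φ.contDiff
  have hcs : HasCompactSupport φ := φ.hasCompactSupport
  have h1 : ∀ u : ℝ, |u| ≤ 1 / 2 → φ u = 1 := fun u hu =>
    φ.one_of_mem_closedBall (by simpa [Metric.mem_closedBall, φ] using hu)
  have h0 : ∀ u : ℝ, 3 / 4 ≤ |u| → φ u = 0 := fun u hu =>
    φ.zero_of_le_dist (by simpa [φ] using hu)
  have hb : ∀ {g : ℝ → ℝ}, ContDiff ℝ ∞ g → HasCompactSupport g → ∃ C, ∀ u, |g u| ≤ C :=
    fun hg hc => by simpa using hc.exists_bound_of_continuous hg.continuous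
  obtain ⟨C0, hC0⟩ := hb hs hcs
  choose C1 hC1 using fun W => hb (contDiff_amplitude hs W) (hasCompactSupport_amplitude hcs W)
  choose C2 hC2 using fun U W => hb (contDiff_amplitude (contDiff_amplitude hs W) U)
    (hasCompactSupport_amplitude (hasCompactSupport_amplitude hcs W) U)
  have p0 : 0 ≤ |C0| := abs_nonneg _
  have p1 : 0 ≤ ∑ W, |C1 W| := Finset.sum_nonneg fun W _ => abs_nonneg _
  have p2 : 0 ≤ ∑ U, ∑ W, |C2 U W| :=
    Finset.sum_nonneg fun U _ => Finset.sum_nonneg fun W _ => abs_nonneg _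
  refine ⟨1 + |C0| + ∑ W, |C1 W| + ∑ U, ∑ W, |C2 U W|, fun b =>
    waves φ (if b.1 then 1 else 0) (if b.2 then -(Real.pi / 2) else 0), by linarith, fun b =>
    c2Bound_waves h0 hs (fun u => ?_) (fun W u => ?_) (fun U W u => ?_) _ _,
    fun t p ht1 ht4 => exists_separating_wave h1 ht1 ht4 p⟩
  · linarith [hC0 u, le_abs_self C0]
  · have := Finset.single_le_sum (f := fun W => |C1 W|) (fun W _ => abs_nonneg _)
      (Finset.mem_univ W)
    linarith [hC1 W u, le_abs_self (C1 W)]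
  · have q1 := Finset.single_le_sum (f := fun W => |C2 U W|) (fun W _ => abs_nonneg _)
      (Finset.mem_univ W)
    have q2 := Finset.single_le_sum (f := fun U => ∑ W, |C2 U W|)
      (fun U _ => Finset.sum_nonneg fun W _ => abs_nonneg _) (Finset.mem_univ U)
    linarith [hC2 U W u, le_abs_self (C2 U W)]

end Oscillation

section Sums

variable {F : Type*} [NormedAddCommGroup F]

lemma hasSum_pow_natAbs_sub {q : ℝ} (h0 : 0 ≤ q) (h1 : q < 1) (j₀ : ℤ) :
    HasSum (fun j : ℤ => q ^ (j - j₀).natAbs) ((1 - q)⁻¹ + q * (1 - q)⁻¹) := by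
  have hg := hasSum_geometric_of_lt_one h0 h1
  have h : HasSum (fun j : ℤ => q ^ j.natAbs) ((1 - q)⁻¹ + q * (1 - q)⁻¹) := by
    refine HasSum.of_nat_of_neg_add_one (by simpa using hg) ?_
    have e : (fun n : ℕ => q ^ (-((n : ℤ) + 1)).natAbs) = fun n : ℕ => q * q ^ n := by
      funext n
      rw [Int.natAbs_neg, ← pow_succ']
      rfl
    rw [e]
    exact hg.mul_left q
  exact (Equiv.subRight j₀).hasSum_iff (f := fun j : ℤ => q ^ j.natAbs) |>.mpr h

lemma summable_and_norm_tsum_le [CompleteSpace F] {q C : ℝ} (h0 : 0 ≤ q) (h1 : q ≤ 1 / 3) (hC : 0 ≤ C) {j₀ : ℤ}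
    {f : ℤ → F} (hf : ∀ j, ‖f j‖ ≤ C * q ^ (j - j₀).natAbs) :
    Summable f ∧ ‖∑' j, f j‖ ≤ 2 * C := by
  have hs := (hasSum_pow_natAbs_sub h0 (by linarith) j₀).mul_left C
  refine ⟨Summable.of_norm_bounded hs.summable hf, (tsum_of_norm_bounded hs hf).trans ?_⟩
  have : (1 - q)⁻¹ + q * (1 - q)⁻¹ ≤ 2 := by
    have : (1 - q)⁻¹ + q * (1 - q)⁻¹ = (1 + q) / (1 - q) := by
      rw [div_eq_mul_inv]; ring
    rw [this, div_le_iff₀ (by linarith)]; linarith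
  nlinarith

lemma norm_le_norm_tsum_add {q C : ℝ} (h0 : 0 ≤ q) (h1 : q ≤ 1 / 3) (hC : 0 ≤ C) {j₀ : ℤ}
    {f : ℤ → F} (hs : Summable f) (hf : ∀ j, j ≠ j₀ → ‖f j‖ ≤ C * q ^ (j - j₀).natAbs) :
    ‖f j₀‖ ≤ ‖∑' j, f j‖ + 4 * C * q := by
  classical
  have hq := (hasSum_pow_natAbs_sub h0 (by linarith) j₀)
  have hq' := ((hasSum_ite_eq j₀ (1 : ℝ)).neg.add hq).mul_left C
  have hrest : ‖∑' j, (if j = j₀ then 0 else f j)‖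
      ≤ C * (-1 + ((1 - q)⁻¹ + q * (1 - q)⁻¹)) := by
    refine tsum_of_norm_bounded hq' fun j => ?_
    by_cases h : j = j₀
    · subst h; simp
    · simpa [h] using hf j h
  have hval : -1 + ((1 - q)⁻¹ + q * (1 - q)⁻¹) ≤ 4 * q := by
    have : -1 + ((1 - q)⁻¹ + q * (1 - q)⁻¹) = 2 * q / (1 - q) := by
      have : 1 - q ≠ 0 := by linarith
      field_simp; ring
    rw [this, div_le_iff₀ (by linarith)]; nlinarith
  have hsplit := hs.tsum_eq_add_tsum_ite j₀
  have h2 : f j₀ = ∑' j, f j - ∑' j, (if j = j₀ then 0 else f j) := by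
    rw [hsplit, add_sub_cancel_right]
  have h3 := norm_sub_le (∑' j, f j) (∑' j, (if j = j₀ then 0 else f j))
  rw [← h2] at h3
  nlinarith

end Sums

section Ladder

/-- A ladder of scales `Q ^ j`, with `M = Q ^ ε` large. -/
structure Ladder (Q M ε : ℝ) : Prop where
  pos : 0 < ε
  le_half : ε ≤ 1 / 2
  base_pos : 0 < Q
  eq_rpow : M = Q ^ ε
  large : 1024 ≤ M

variable {Q M ε : ℝ}

lemma Ladder.sq_le (hl : Ladder Q M ε) : M ^ 2 ≤ Q := by
  have hQ1 : 1 ≤ Q := by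
    by_contra! h
    have := Real.rpow_le_one hl.base_pos.le h.le hl.pos.le
    rw [← hl.eq_rpow] at this
    linarith [hl.large]
  rw [hl.eq_rpow, ← Real.rpow_natCast, ← Real.rpow_mul hl.base_pos.le]
  calc Q ^ (ε * (2 : ℕ)) ≤ Q ^ (1 : ℝ) :=
        Real.rpow_le_rpow_of_exponent_le hQ1 (by push_cast; linarith [hl.le_half])
    _ = Q := Real.rpow_one Q

lemma Ladder.one_lt (hl : Ladder Q M ε) : 1 < Q := by nlinarith [hl.sq_le, hl.large]

lemma Ladder.zpow_rpow (hl : Ladder Q M ε) (j : ℤ) : (Q ^ j) ^ ε = M ^ j := by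
  rw [hl.eq_rpow, ← Real.rpow_intCast, ← Real.rpow_mul hl.base_pos.le, mul_comm,
    Real.rpow_mul hl.base_pos.le, Real.rpow_intCast]

lemma Ladder.mul_zpow_le (hl : Ladder Q M ε) {j : ℤ} {t : ℝ} (ht : 0 < t) (h : t ≤ Q ^ j) :
    t * M ^ (-j) ≤ t ^ (1 - ε) := by
  have hM : 0 < M := by linarith [hl.large]
  have h1 := Real.rpow_le_rpow ht.le h hl.pos.le
  rw [hl.zpow_rpow] at h1
  rw [Real.rpow_sub ht, Real.rpow_one, zpow_neg, ← div_eq_mul_inv]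
  have := Real.rpow_pos_of_pos ht ε
  gcongr

lemma Ladder.rpow_le (hl : Ladder Q M ε) {j : ℤ} {t : ℝ} (h : Q ^ (j - 1) ≤ t) :
    t ^ (1 - ε) ≤ M * (t * M ^ (-j)) := by
  have hM : 0 < M := by linarith [hl.large]
  have h0 : 0 < Q ^ (j - 1) := zpow_pos hl.base_pos _
  have ht : 0 < t := h0.trans_le h
  have h1 := Real.rpow_le_rpow h0.le h hl.pos.le
  rw [hl.zpow_rpow] at h1
  rw [Real.rpow_sub ht, Real.rpow_one, div_le_iff₀ (Real.rpow_pos_of_pos ht ε)]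
  have : M * (t * M ^ (-j)) * M ^ (j - 1) = t := by
    rw [zpow_sub_one₀ hM.ne', zpow_neg]
    field_simp
  calc t = M * (t * M ^ (-j)) * M ^ (j - 1) := this.symm
    _ ≤ _ := by gcongr

lemma Ladder.zpow_le_rpow (hl : Ladder Q M ε) {j : ℤ} {t : ℝ} (h : Q ^ j ≤ t) :
    (Q / M) ^ j ≤ t ^ (1 - ε) := by
  have h0 : 0 < Q ^ j := zpow_pos hl.base_pos _
  have e : (Q / M) ^ j = (Q ^ j) ^ (1 - ε) := by
    rw [Real.rpow_sub h0, Real.rpow_one, hl.zpow_rpow, div_zpow]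
  rw [e]
  exact Real.rpow_le_rpow h0.le h (by linarith [hl.le_half])

lemma inv_pow_natAbs_of_le {q : ℝ} {j j₀ : ℤ} (h : j₀ ≤ j) :
    q⁻¹ ^ (j - j₀).natAbs = q ^ (j₀ - j) := by
  rw [← zpow_natCast, Int.natAbs_of_nonneg (by omega), inv_zpow', neg_sub]

lemma inv_pow_natAbs_of_ge {q : ℝ} {j j₀ : ℤ} (h : j ≤ j₀) :
    q⁻¹ ^ (j - j₀).natAbs = q ^ (j - j₀) := by
  rw [← zpow_natCast, Int.ofNat_natAbs_of_nonpos (by omega), inv_zpow', neg_neg]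

lemma Ladder.weight_mul_min_le (hl : Ladder Q M ε) {j₀ : ℤ} {t : ℝ} (h1 : Q ^ (j₀ - 1) ≤ t)
    (h2 : t ≤ Q ^ j₀) (j : ℤ) :
    (Q / M) ^ j * min 1 (t * (Q ^ j)⁻¹) ≤ M * t ^ (1 - ε) * M⁻¹ ^ (j - j₀).natAbs := by
  have hM1 := hl.large
  have hM : 0 < M := by linarith
  have hQ := hl.base_pos
  have ht : 0 < t := (zpow_pos hQ _).trans_le h1
  have hp : 0 < t ^ (1 - ε) := Real.rpow_pos_of_pos ht _
  rcases le_or_gt j₀ j with h | h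
  · rw [inv_pow_natAbs_of_le h]
    calc (Q / M) ^ j * min 1 (t * (Q ^ j)⁻¹) ≤ (Q / M) ^ j * (t * (Q ^ j)⁻¹) := by
          gcongr; exact min_le_right _ _
      _ = (t * M ^ (-j₀)) * M ^ (j₀ - j) := by
          rw [div_zpow, zpow_sub₀ hM.ne', zpow_neg]; field_simp
      _ ≤ t ^ (1 - ε) * M ^ (j₀ - j) := by gcongr; exact hl.mul_zpow_le ht h2
      _ ≤ M * t ^ (1 - ε) * M ^ (j₀ - j) := by
          gcongr
          nlinarith
  · rw [inv_pow_natAbs_of_ge h.le]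
    have hR : M ≤ Q / M := by rw [le_div_iff₀ hM, ← sq]; exact hl.sq_le
    have hR0 : 0 < Q / M := by positivity
    calc (Q / M) ^ j * min 1 (t * (Q ^ j)⁻¹) ≤ (Q / M) ^ j * 1 := by
          gcongr; exact min_le_left _ _
      _ = (Q / M) ^ (j₀ - 1) * ((Q / M) ^ (j₀ - 1 - j).toNat)⁻¹ := by
          rw [mul_one, ← zpow_natCast, Int.toNat_of_nonneg (by omega), ← zpow_neg,
            ← zpow_add₀ hR0.ne']
          ring_nf
      _ ≤ t ^ (1 - ε) * (M ^ (j₀ - 1 - j).toNat)⁻¹ := by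
          gcongr
          exact hl.zpow_le_rpow h1
      _ = M * t ^ (1 - ε) * M ^ (j - j₀) := by
          rw [← zpow_natCast, Int.toNat_of_nonneg (by omega), ← zpow_neg,
            show -(j₀ - 1 - j) = j - j₀ + 1 by ring, zpow_add_one₀ hM.ne']
          ring

variable {F : Type*} [NormedAddCommGroup F] [CompleteSpace F]

lemma Ladder.summable_and_norm_tsum_le (hl : Ladder Q M ε) {c t : ℝ} (hc : 0 ≤ c) (ht : 0 ≤ t)
    {f : ℤ → F} (hf : ∀ j, ‖f j‖ ≤ c * ((Q / M) ^ j * min 1 (t * (Q ^ j)⁻¹))) :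
    Summable f ∧ ‖∑' j, f j‖ ≤ 2 * M * (c * t ^ (1 - ε)) := by
  have hM1 := hl.large
  rcases ht.eq_or_lt with rfl | ht
  · have : f = fun _ => 0 := funext fun j => by simpa using hf j
    rw [this]
    refine ⟨summable_zero, ?_⟩
    rw [tsum_zero, norm_zero]
    have := Real.rpow_nonneg (le_refl (0 : ℝ)) (1 - ε)
    have : 0 ≤ M := by linarith
    positivity
  · obtain ⟨j₀, h1, h2⟩ := exists_mem_Ico_zpow ht hl.one_lt
    have hq : M⁻¹ ≤ 1 / 3 := by
      rw [inv_le_comm₀ (by linarith) (by norm_num)]; linarith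
    have hp : 0 < t ^ (1 - ε) := Real.rpow_pos_of_pos ht _
    have := Heisenberg.summable_and_norm_tsum_le (C := c * (M * t ^ (1 - ε))) (f := f)
      (inv_nonneg.mpr (by linarith)) hq
      (by have : 0 ≤ M := by linarith
          positivity) (j₀ := j₀ + 1) (fun j => (hf j).trans (by
        rw [mul_assoc c]
        exact mul_le_mul_of_nonneg_left
          (hl.weight_mul_min_le (by rwa [add_sub_cancel_right]) h2.le j) hc))
    refine ⟨this.1, this.2.trans (le_of_eq (by ring))⟩

end Ladder

section Assemble

variable {E : Type*} [NormedAddCommGroup E] [NormedSpace ℝ E]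

/-- The homogeneous length of a displacement `t` in direction `X`, `Y`, `Z`. -/
def gauge (W : Fin 3) (t : ℝ) : ℝ := ![|t|, |t|, √|t|] W

lemma gauge_nonneg (W : Fin 3) (t : ℝ) : 0 ≤ gauge W t := by
  fin_cases W
  · exact abs_nonneg t
  · exact abs_nonneg t
  · exact Real.sqrt_nonneg _

lemma gauge_pow_wt_mul {a : ℝ} (ha : 0 ≤ a) (W : Fin 3) (t : ℝ) :
    gauge W (a ^ wt W * t) = a * gauge W t := by
  fin_cases W
  · simp [gauge, wt, abs_mul, abs_of_nonneg ha]
  · simp [gauge, wt, abs_mul, abs_of_nonneg ha]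
  · simp [gauge, wt, abs_mul, Real.sqrt_sq ha]

lemma dilate_flow3 (a : ℝ) (W : Fin 3) (t : ℝ) (p : H) :
    dilate a (flow3 W t p) = flow3 W (a ^ wt W * t) (dilate a p) := by
  fin_cases W
  · ext <;> simp [flow3, flowX, flowY, flowZ, dilate, wt] <;> ring
  · ext <;> simp [flow3, flowX, flowY, flowZ, dilate, wt]
    ring
  · ext <;> simp [flow3, flowX, flowY, flowZ, dilate, wt]
    ring

/-- The homogeneous lengths of the coordinates of `p q⁻¹`. -/
def sep (p q : H) : Fin 3 → ℝ :=
  ![|(mul p (inv q)).1|, |(mul p (inv q)).2.1|, √|(mul p (inv q)).2.2|]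

lemma sep_nonneg (p q : H) (W : Fin 3) : 0 ≤ sep p q W := by
  fin_cases W
  · exact abs_nonneg _
  · exact abs_nonneg _
  · exact Real.sqrt_nonneg _

lemma sep_dilate {a : ℝ} (ha : 0 ≤ a) (p q : H) (W : Fin 3) :
    sep (dilate a p) (dilate a q) W = a * sep p q W := by
  have h : mul (dilate a p) (inv (dilate a q)) = dilate a (mul p (inv q)) := by
    simp only [mul, inv, dilate, Prod.mk.injEq]
    refine ⟨by ring, by ring, by ring⟩
  simp only [sep, h]
  generalize mul p (inv q) = v
  simp only [dilate]
  fin_cases W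
  · simp [abs_mul, abs_of_nonneg ha]
  · simp [abs_mul, abs_of_nonneg ha]
  · simp [abs_mul, Real.sqrt_sq ha]

lemma eq_flowZ_flowY_flowX (p q : H) :
    p = flowZ (mul p (inv q)).2.2 (flowY (mul p (inv q)).2.1 (flowX (mul p (inv q)).1 q)) := by
  simp only [mul, inv, flowX, flowY, flowZ]
  ext <;> simp
  ring

/-- `ψ` has variation at most `c W` along `W`, and is Lipschitz with the same constant with
respect to the homogeneous length. -/
def Tame (ψ : H → E) (c : Fin 3 → ℝ) : Prop :=
  ∀ W t p, ‖ψ (flow3 W t p) - ψ p‖ ≤ c W * min 1 (gauge W t)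

/-- The increment between `q` and `p` of the rescaled copy of `ψ` at scale `Q ^ j`. -/
def increment (Q M : ℝ) (ψ : H → E) (p q : H) (j : ℤ) : E :=
  (Q / M) ^ j • (ψ (dilate (Q ^ j)⁻¹ p) - ψ (dilate (Q ^ j)⁻¹ q))

/-- The sum over all scales `Q ^ j` of the rescaled copies of `ψ`. -/
def assemble (Q M : ℝ) (ψ : H → E) (p : H) : E := ∑' j : ℤ, increment Q M ψ p 0 j

lemma increment_add (Q M : ℝ) (ψ : H → E) (p q r : H) :
    increment Q M ψ p r = increment Q M ψ p q + increment Q M ψ q r := by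
  funext j
  simp only [increment, Pi.add_apply, ← smul_add, sub_add_sub_cancel]

variable {Q M ε : ℝ} {ψ : H → E} {c : Fin 3 → ℝ}

lemma norm_increment (hl : Ladder Q M ε) (p q : H) (j : ℤ) :
    ‖increment Q M ψ p q j‖
      = (Q / M) ^ j * ‖ψ (dilate (Q ^ j)⁻¹ p) - ψ (dilate (Q ^ j)⁻¹ q)‖ := by
  have : 0 < Q / M := div_pos hl.base_pos (by linarith [hl.large])
  rw [increment, norm_smul, Real.norm_of_nonneg (zpow_nonneg this.le _)]

variable [CompleteSpace E]

lemma Tame.increment_flow3 (h : Tame ψ c) (hc : ∀ W, 0 ≤ c W) (hl : Ladder Q M ε) (W : Fin 3)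
    (t : ℝ) (p : H) :
    Summable (increment Q M ψ (flow3 W t p) p) ∧
      ‖∑' j, increment Q M ψ (flow3 W t p) p j‖ ≤ 2 * M * (c W * gauge W t ^ (1 - ε)) := by
  refine hl.summable_and_norm_tsum_le (hc W) (gauge_nonneg W t) fun j => ?_
  have hQ : 0 < Q ^ j := zpow_pos hl.base_pos j
  have hQM : 0 < Q / M := div_pos hl.base_pos (by linarith [hl.large])
  rw [norm_increment hl, dilate_flow3]
  have := h W ((Q ^ j)⁻¹ ^ wt W * t) (dilate (Q ^ j)⁻¹ p)
  rw [gauge_pow_wt_mul (inv_pos.mpr hQ).le] at this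
  calc _ ≤ (Q / M) ^ j * (c W * min 1 ((Q ^ j)⁻¹ * gauge W t)) := by gcongr
    _ = _ := by rw [mul_comm _ (gauge W t)]; ring

lemma Tame.increment (h : Tame ψ c) (hc : ∀ W, 0 ≤ c W) (hl : Ladder Q M ε) (p q : H) :
    Summable (increment Q M ψ p q) ∧
      ‖∑' j, increment Q M ψ p q j‖ ≤ 2 * M * ∑ W, c W * sep p q W ^ (1 - ε) := by
  set v := mul p (inv q) with hv
  have h0 := h.increment_flow3 hc hl 0 v.1 q
  have h1 := h.increment_flow3 hc hl 1 v.2.1 (flow3 0 v.1 q)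
  have h2 := h.increment_flow3 hc hl 2 v.2.2 (flow3 1 v.2.1 (flow3 0 v.1 q))
  have hp : flow3 2 v.2.2 (flow3 1 v.2.1 (flow3 0 v.1 q)) = p := (eq_flowZ_flowY_flowX p q).symm
  rw [hp] at h2
  have e : Heisenberg.increment Q M ψ p q = fun j =>
      Heisenberg.increment Q M ψ p (flow3 1 v.2.1 (flow3 0 v.1 q)) j
      + (Heisenberg.increment Q M ψ (flow3 1 v.2.1 (flow3 0 v.1 q)) (flow3 0 v.1 q) j
      + Heisenberg.increment Q M ψ (flow3 0 v.1 q) q j) := by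
    rw [increment_add Q M ψ p (flow3 1 v.2.1 (flow3 0 v.1 q)) q,
      increment_add Q M ψ _ (flow3 0 v.1 q) q]
    rfl
  rw [e]
  refine ⟨h2.1.add (h1.1.add h0.1), ?_⟩
  rw [h2.1.tsum_add (h1.1.add h0.1), h1.1.tsum_add h0.1]
  refine (norm_add_le _ _).trans ((add_le_add h2.2 ((norm_add_le _ _).trans
    (add_le_add h1.2 h0.2))).trans (le_of_eq ?_))
  rw [Fin.sum_univ_three]
  simp only [gauge, sep, ← hv]
  simp
  ring

lemma Tame.assemble_sub (h : Tame ψ c) (hc : ∀ W, 0 ≤ c W) (hl : Ladder Q M ε) (p q : H) :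
    assemble Q M ψ p - assemble Q M ψ q = ∑' j, Heisenberg.increment Q M ψ p q j := by
  rw [assemble, assemble, ← (h.increment hc hl p 0).1.tsum_sub (h.increment hc hl q 0).1]
  congr 1
  funext j
  simp only [Heisenberg.increment, ← smul_sub, sub_sub_sub_cancel_right]

lemma Tame.norm_assemble_sub_le (h : Tame ψ c) (hc : ∀ W, 0 ≤ c W) (hl : Ladder Q M ε)
    (p q : H) :
    ‖assemble Q M ψ p - assemble Q M ψ q‖ ≤ 2 * M * ∑ W, c W * sep p q W ^ (1 - ε) := by
  rw [h.assemble_sub hc hl]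
  exact (h.increment hc hl p q).2

end Assemble

section Homogenize

variable {E : Type*} [NormedAddCommGroup E] [NormedSpace ℝ E]

/-- Conjugation of a map by the dilation of factor `θ`. -/
def homogenize (ε θ : ℝ) (T : H → E) (p : H) : E := θ ^ (1 - ε) • T (dilate θ⁻¹ p)

lemma norm_homogenize_sub {ε θ : ℝ} (hθ : 0 < θ) (T : H → E) (p q : H) :
    ‖homogenize ε θ T p - homogenize ε θ T q‖
      = θ ^ (1 - ε) * ‖T (dilate θ⁻¹ p) - T (dilate θ⁻¹ q)‖ := by
  rw [homogenize, homogenize, ← smul_sub, norm_smul,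
    Real.norm_of_nonneg (Real.rpow_nonneg hθ.le _)]

lemma rpow_mul_sep_dilate {ε θ : ℝ} (hθ : 0 < θ) (p q : H) (W : Fin 3) :
    θ ^ (1 - ε) * sep (dilate θ⁻¹ p) (dilate θ⁻¹ q) W ^ (1 - ε) = sep p q W ^ (1 - ε) := by
  rw [sep_dilate (inv_pos.mpr hθ).le, ← Real.mul_rpow hθ.le
    (mul_nonneg (inv_pos.mpr hθ).le (sep_nonneg p q W)), mul_inv_cancel_left₀ hθ.ne']

lemma norm_homogenize_sub_le {ε θ C : ℝ} (hθ : 0 < θ) {T : H → E} {c : Fin 3 → ℝ}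
    (h : ∀ p q, ‖T p - T q‖ ≤ C * ∑ W, c W * sep p q W ^ (1 - ε)) (p q : H) :
    ‖homogenize ε θ T p - homogenize ε θ T q‖ ≤ C * ∑ W, c W * sep p q W ^ (1 - ε) := by
  rw [norm_homogenize_sub hθ]
  calc _ ≤ θ ^ (1 - ε) * (C * ∑ W, c W * sep (dilate θ⁻¹ p) (dilate θ⁻¹ q) W ^ (1 - ε)) := by
        gcongr; exact h _ _
    _ = C * ∑ W, c W * (θ ^ (1 - ε) * sep (dilate θ⁻¹ p) (dilate θ⁻¹ q) W ^ (1 - ε)) := by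
        rw [Finset.mul_sum, Finset.mul_sum, Finset.mul_sum]
        exact Finset.sum_congr rfl fun W _ => by ring
    _ = _ := by simp only [rpow_mul_sep_dilate hθ]

end Homogenize

section Horizontal

lemma norm_exp_I_mul_sub (a b : ℝ) :
    ‖Complex.exp (Complex.I * a) - Complex.exp (Complex.I * b)‖ = 2 * |Real.sin ((a - b) / 2)| := by
  have e : Complex.exp (Complex.I * a) - Complex.exp (Complex.I * b)
      = Complex.exp (Complex.I * b) * (Complex.exp (Complex.I * (a - b : ℝ)) - 1) := by
    rw [mul_sub, ← Complex.exp_add]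
    push_cast
    ring_nf
  rw [e, norm_mul, mul_comm Complex.I, Complex.norm_exp_ofReal_mul_I, one_mul,
    Complex.norm_exp_I_mul_ofReal_sub_one, norm_mul]
  simp

/-- The coordinate functions of `H`. -/
def coord (W : Fin 3) (p : H) : ℝ := ![p.1, p.2.1, p.2.2] W

lemma coord_flow3_sub {W : Fin 3} (hW : W ≠ 2) (V : Fin 3) (t : ℝ) (p : H) :
    coord W (flow3 V t p) - coord W p = if V = W then t else 0 := by
  fin_cases W
  · fin_cases V <;> simp [coord, flow3, flowX, flowY, flowZ]
  · fin_cases V <;> simp [coord, flow3, flowX, flowY, flowZ]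
  · exact absurd rfl hW

lemma abs_coord_sub {W : Fin 3} (hW : W ≠ 2) (p q : H) :
    |coord W p - coord W q| = sep p q W := by
  fin_cases W
  · simp [coord, sep, mul, inv, sub_eq_add_neg, add_comm]
  · simp [coord, sep, mul, inv, sub_eq_add_neg, add_comm]
  · exact absurd rfl hW

/-- The circular oscillation of amplitude `r` in the coordinate `W`. -/
def circ (r : ℝ) (W : Fin 3) (p : H) : ℂ := r • Complex.exp (Complex.I * coord W p)

lemma norm_circ_sub {r : ℝ} (hr : 0 ≤ r) (W : Fin 3) (p q : H) :
    ‖circ r W p - circ r W q‖ = r * (2 * |Real.sin ((coord W p - coord W q) / 2)|) := by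
  rw [circ, circ, ← smul_sub, norm_smul, norm_exp_I_mul_sub, Real.norm_of_nonneg hr]

lemma norm_circ_sub_le {r : ℝ} (hr : 0 ≤ r) (W : Fin 3) (p q : H) :
    ‖circ r W p - circ r W q‖ ≤ r * |coord W p - coord W q| := by
  rw [norm_circ_sub hr]
  gcongr
  have := Real.abs_sin_le_abs (x := (coord W p - coord W q) / 2)
  rw [abs_div, abs_two] at this
  linarith

lemma norm_circ_sub_le_two {r : ℝ} (hr : 0 ≤ r) (W : Fin 3) (p q : H) :
    ‖circ r W p - circ r W q‖ ≤ 2 * r := by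
  rw [norm_circ_sub hr]
  have := Real.abs_sin_le_one ((coord W p - coord W q) / 2)
  nlinarith

lemma le_norm_circ_sub {r : ℝ} (hr : 0 ≤ r) (W : Fin 3) {p q : H}
    (h : |coord W p - coord W q| ≤ 1) :
    3 / 5 * (r * |coord W p - coord W q|) ≤ ‖circ r W p - circ r W q‖ := by
  rw [norm_circ_sub hr]
  have h1 : |(coord W p - coord W q) / 2| ≤ Real.pi / 2 := by
    rw [abs_div, abs_two]
    linarith [Real.pi_gt_three]
  have h2 := Real.mul_abs_le_abs_sin h1
  rw [abs_div, abs_two] at h2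
  have h3 : 3 / 5 ≤ 2 / Real.pi := by
    rw [le_div_iff₀ Real.pi_pos]
    linarith [Real.pi_lt_d2]
  have h4 : 3 / 5 * (|coord W p - coord W q| / 2)
      ≤ 2 / Real.pi * (|coord W p - coord W q| / 2) := by gcongr
  have h5 : 3 / 5 * |coord W p - coord W q| ≤ 2 * |Real.sin ((coord W p - coord W q) / 2)| := by
    linarith
  calc _ = r * (3 / 5 * |coord W p - coord W q|) := by ring
    _ ≤ _ := by gcongr

/-- The constants of `circ r W`. -/
def circConst (r : ℝ) (W : Fin 3) : Fin 3 → ℝ := fun V => if V = W then 2 * r else 0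

lemma circConst_nonneg {r : ℝ} (hr : 0 ≤ r) (W V : Fin 3) : 0 ≤ circConst r W V := by
  unfold circConst; split_ifs <;> positivity

lemma tame_circ {r : ℝ} (hr : 0 ≤ r) {W : Fin 3} (hW : W ≠ 2) :
    Tame (circ r W) (circConst r W) := by
  intro V t p
  have h1 := norm_circ_sub_le hr W (flow3 V t p) p
  have h2 := norm_circ_sub_le_two hr W (flow3 V t p) p
  rw [coord_flow3_sub hW] at h1
  unfold circConst
  split_ifs with h
  · have hg : gauge V t = |t| := by
      subst h
      fin_cases V
      · rfl
      · rfl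
      · exact absurd rfl hW
    rw [if_pos h] at h1
    rw [hg]
    rcases min_cases 1 |t| with ⟨e, _⟩ | ⟨e, _⟩ <;> rw [e]
    · linarith
    · nlinarith [abs_nonneg t]
  · rw [if_neg h] at h1
    simpa using h1

variable {Q M ε S r : ℝ} {W : Fin 3}

lemma le_norm_assemble_circ_sub (hl : Ladder Q M ε) (hS0 : 0 < S) (hS : S ^ 4 = Q) (hr : 0 ≤ r)
    (hW : W ≠ 2) {p q : H} {j₀ : ℤ} (h1 : sep p q W ≤ Q ^ j₀) (h2 : Q ^ j₀ ≤ sep p q W * S) :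
    3 / 10 * (r * sep p q W ^ (1 - ε))
      ≤ M * ‖assemble Q M (circ r W) p - assemble Q M (circ r W) q‖ := by
  have hM1 := hl.large
  have hM : 0 < M := by linarith
  have hQ := hl.base_pos
  have hQ1 := hl.one_lt
  have hMQ := hl.sq_le
  have hT := tame_circ hr hW
  have hc := circConst_nonneg hr W
  have hs0 := sep_nonneg p q W
  rw [hT.assemble_sub hc hl]
  set s := sep p q W with hs
  set w := M ^ (-j₀) with hw
  have hw0 : 0 < w := zpow_pos hM _
  have hco : ∀ j : ℤ, |coord W (dilate (Q ^ j)⁻¹ p) - coord W (dilate (Q ^ j)⁻¹ q)|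
      = (Q ^ j)⁻¹ * s := by
    intro j
    have : 0 < Q ^ j := zpow_pos hQ j
    rw [abs_coord_sub hW, sep_dilate (inv_pos.mpr this).le]
  have hrt : 32 ≤ √M := by
    rw [show (32 : ℝ) = √1024 by
      rw [show (1024 : ℝ) = 32 ^ 2 by norm_num]; exact (Real.sqrt_sq (by norm_num)).symm]
    exact Real.sqrt_le_sqrt hM1
  have hrtM : √M * √M = M := Real.mul_self_sqrt hM.le
  have hrt0 : 0 < √M := by linarith
  have hMS : M ≤ S ^ 2 := by
    have : M ^ 2 ≤ (S ^ 2) ^ 2 := by nlinarith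
    exact le_of_sq_le_sq this (by positivity)
  have hrtS : √M ≤ S := by
    rw [show S = √(S ^ 2) from (Real.sqrt_sq hS0.le).symm]
    exact Real.sqrt_le_sqrt hMS
  have hS1 : 1 ≤ S := by linarith
  have hmain : 3 / 5 * (r * (s * w)) ≤ ‖increment Q M (circ r W) p q j₀‖ := by
    have hQj : 0 < Q ^ j₀ := zpow_pos hQ j₀
    rw [norm_increment hl]
    have := le_norm_circ_sub hr W (p := dilate (Q ^ j₀)⁻¹ p) (q := dilate (Q ^ j₀)⁻¹ q)
      (by rw [hco, inv_mul_le_iff₀ hQj]; linarith)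
    rw [hco] at this
    calc _ = (Q / M) ^ j₀ * (3 / 5 * (r * ((Q ^ j₀)⁻¹ * s))) := by
          rw [hw, div_zpow, zpow_neg]; field_simp
      _ ≤ _ := by
          have : 0 < Q / M := by positivity
          gcongr
  have herr := norm_le_norm_tsum_add (q := M⁻¹) (C := 2 * r * (s * w) * √M) (j₀ := j₀)
    (f := increment Q M (circ r W) p q) (by positivity)
    (by rw [inv_le_comm₀ hM (by norm_num)]; linarith) (by positivity)
    (hT.increment hc hl p q).1 (by
      intro j hj
      have hQj : 0 < Q ^ j := zpow_pos hQ j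
      have hQM : 0 < Q / M := by positivity
      rw [norm_increment hl]
      rcases lt_or_gt_of_ne hj with h | h
      · rw [inv_pow_natAbs_of_ge h.le]
        obtain ⟨n, rfl⟩ : ∃ n : ℕ, j = j₀ - (n + 1 : ℕ) := ⟨(j₀ - j - 1).toNat, by omega⟩
        have hfac : (M ^ 2 / Q) ^ (n + 1) ≤ M ^ 2 / Q :=
          pow_le_of_le_one (by positivity) (by rw [div_le_one hQ]; exact hMQ) (by omega)
        have hfac2 : S * (M ^ 2 / Q) ≤ √M := by
          rw [← mul_div_assoc, div_le_iff₀ hQ, ← hS]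
          have e1 : M ^ 2 = √M * √M ^ 3 := by rw [← hrtM]; simp [hrtM]; nlinarith
          have : √M ^ 3 ≤ S ^ 3 := by gcongr
          rw [e1]
          calc S * (√M * √M ^ 3) = √M * (S * √M ^ 3) := by ring
            _ ≤ √M * (S * S ^ 3) := by gcongr
            _ = _ := by ring
        calc _ ≤ (Q / M) ^ (j₀ - (n + 1 : ℕ)) * (2 * r) := by
              gcongr; exact norm_circ_sub_le_two hr _ _ _
          _ = 2 * r * (Q ^ j₀ * w) * (M ^ 2 / Q) ^ (n + 1) * M ^ (-((n + 1 : ℕ) : ℤ)) := by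
              rw [zpow_sub₀ hQM.ne', div_zpow, hw, zpow_neg, zpow_neg, zpow_natCast, zpow_natCast]
              simp only [div_pow]
              field_simp
              ring
          _ ≤ 2 * r * (s * S * w) * (M ^ 2 / Q) * M ^ (-((n + 1 : ℕ) : ℤ)) := by gcongr
          _ = 2 * r * (s * w) * (S * (M ^ 2 / Q)) * M ^ (-((n + 1 : ℕ) : ℤ)) := by ring
          _ ≤ 2 * r * (s * w) * √M * M ^ (-((n + 1 : ℕ) : ℤ)) := by gcongr
          _ = _ := by congr 2; ring
      · rw [inv_pow_natAbs_of_le h.le]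
        calc _ ≤ (Q / M) ^ j * (r * ((Q ^ j)⁻¹ * s)) := by
              gcongr; rw [← hco]; exact norm_circ_sub_le hr _ _ _
          _ = 1 * r * (s * w) * 1 * M ^ (j₀ - j) := by
              rw [div_zpow, hw, zpow_neg, zpow_sub₀ hM.ne']; field_simp
          _ ≤ _ := by gcongr <;> linarith)
  have he2 : 4 * (2 * r * (s * w) * √M) * M⁻¹ ≤ 1 / 4 * (r * (s * w)) := by
    have : √M * M⁻¹ ≤ 1 / 32 := by
      rw [← div_eq_mul_inv, div_le_div_iff₀ hM (by norm_num)]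
      nlinarith
    calc _ = 8 * (r * (s * w)) * (√M * M⁻¹) := by ring
      _ ≤ 8 * (r * (s * w)) * (1 / 32) := by gcongr
      _ = _ := by ring
  have hlow : Q ^ (j₀ - 1) ≤ s := by
    rw [zpow_sub_one₀ hQ.ne', ← div_eq_mul_inv, div_le_iff₀ hQ]
    refine h2.trans ?_
    gcongr
    rw [← hS]
    exact le_self_pow₀ hS1 (by norm_num)
  have hfin := hl.rpow_le hlow
  rw [← hw] at hfin
  have hrsw : 0 ≤ r * (s * w) := by positivity
  calc 3 / 10 * (r * s ^ (1 - ε)) ≤ 3 / 10 * (r * (M * (s * w))) := by gcongr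
    _ = M * (3 / 10 * (r * (s * w))) := by ring
    _ ≤ _ := by
        gcongr
        linarith

lemma exists_le_norm_homogenize_circ_sub (hl : Ladder Q M ε) (hS0 : 0 < S) (hS : S ^ 4 = Q)
    (hr : 0 ≤ r) (hW : W ≠ 2) (p q : H) :
    ∃ i : Fin 4, 3 / 10 * (r * sep p q W ^ (1 - ε)) ≤
      M * ‖homogenize ε (S ^ (i : ℕ)) (assemble Q M (circ r W)) p
        - homogenize ε (S ^ (i : ℕ)) (assemble Q M (circ r W)) q‖ := by
  have hM : 0 < M := by linarith [hl.large]
  rcases (sep_nonneg p q W).eq_or_lt with h | h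
  · refine ⟨0, ?_⟩
    rw [← h, Real.zero_rpow (by linarith [hl.le_half]), mul_zero, mul_zero]
    positivity
  · have hS1 : 1 < S := by
      by_contra! h1
      have := pow_le_one₀ (n := 4) hS0.le h1
      linarith [hl.one_lt]
    obtain ⟨m, h1, h2⟩ := exists_mem_Ioc_zpow h hS1
    obtain ⟨j₀, i, hm⟩ : ∃ (j₀ : ℤ) (i : Fin 4), m + 1 = 4 * j₀ + (i : ℕ) :=
      ⟨(m + 1) / 4, ⟨((m + 1) % 4).toNat, by omega⟩, by simp; omega⟩
    refine ⟨i, ?_⟩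
    have hQj : Q ^ j₀ = S ^ (4 * j₀) := by rw [← hS, zpow_mul]; rfl
    have hθ : 0 < S ^ (i : ℕ) := by positivity
    have hsep := sep_dilate (inv_pos.mpr hθ).le p q W
    have := le_norm_assemble_circ_sub hl hS0 hS hr hW (p := dilate (S ^ (i : ℕ))⁻¹ p)
      (q := dilate (S ^ (i : ℕ))⁻¹ q) (j₀ := j₀)
      (by
        rw [hsep, inv_mul_le_iff₀ hθ, hQj, ← zpow_natCast, ← zpow_add₀ hS0.ne', add_comm, ← hm]
        exact h2)
      (by
        rw [hsep, mul_assoc, le_inv_mul_iff₀ hθ, hQj, ← zpow_natCast, ← zpow_add₀ hS0.ne',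
          add_comm, ← hm, zpow_add_one₀ hS0.ne']
        gcongr)
    rw [norm_homogenize_sub hθ, ← rpow_mul_sep_dilate (ε := ε) hθ p q W]
    have hθ' : 0 < (S ^ (i : ℕ)) ^ (1 - ε) := Real.rpow_pos_of_pos hθ _
    calc _ = (S ^ (i : ℕ)) ^ (1 - ε) * (3 / 10 *
          (r * sep (dilate (S ^ (i : ℕ))⁻¹ p) (dilate (S ^ (i : ℕ))⁻¹ q) W ^ (1 - ε))) := by ring
      _ ≤ _ := mul_le_mul_of_nonneg_left this hθ'.le
      _ = _ := by ring

end Horizontal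

section Vertical

/-- The constants of `profile A L h N`. -/
def profileConst (c A L : ℝ) : Fin 3 → ℝ := ![3 * L, 3 * L, 54 * c * A]

/-- The admissible parameters of `profile A L h N`. -/
structure Admissible (c A L : ℝ) (h : H → ℝ) (N : ℕ) : Prop where
  one_le : 1 ≤ c
  bound : C2Bound h c c c
  le_base : 2 ^ 40 * c ^ 2 ≤ A
  le_slope : 140800 * c ^ 2 ≤ L
  height_le : 5600 * c ^ 2 * N ≤ L ^ 2 / 4

variable {c A L Q M ε : ℝ} {h : H → ℝ} {N : ℕ}

lemma Admissible.le_mul (ha : Admissible c A L h N) : 2 ^ 40 * c ≤ A := by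
  nlinarith [ha.one_le, ha.le_base]

lemma Admissible.two_le (ha : Admissible c A L h N) : 2 ≤ A := by
  nlinarith [ha.one_le, ha.le_mul]

lemma Admissible.slope (ha : Admissible c A L h N) : 2200 * c ≤ L := by
  nlinarith [ha.one_le, ha.le_slope]

lemma Admissible.profileConst_nonneg (ha : Admissible c A L h N) (W : Fin 3) :
    0 ≤ profileConst c A L W := by
  have h1 := ha.one_le
  have h2 := ha.two_le
  have h3 : 0 ≤ L := by linarith [ha.slope]
  fin_cases W <;> simp [profileConst] <;> positivity

lemma Admissible.norm_profile_sub_le (ha : Admissible c A L h N) (p q : H) :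
    ‖profile A L h N p - profile A L h N q‖ ≤ 32 * c / A := by
  have h1 := norm_profile_le ha.one_le ha.bound ha.two_le ha.slope ha.height_le p
  have h2 := norm_profile_le ha.one_le ha.bound ha.two_le ha.slope ha.height_le q
  refine (norm_sub_le _ _).trans ((add_le_add h1 h2).trans (le_of_eq (by ring)))

lemma Admissible.tame (ha : Admissible c A L h N) :
    Tame (profile A L h N) (profileConst c A L) := by
  intro W t p
  have hc := ha.one_le
  have hA := ha.two_le
  have hL := ha.slope
  have h0 : 32 * c / A ≤ 32 * c := by
    rw [div_le_iff₀ (by linarith)]; nlinarith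
  have h1 := (ha.norm_profile_sub_le (flow3 W t p) p).trans h0
  have h2 : ‖profile A L h N (flow3 W t p) - profile A L h N p‖
      ≤ profileConst c A L W * gauge W t := by
    by_cases hW : W = 2
    · subst hW
      exact norm_profile_flowZ_sub_le_sqrt hc ha.bound hA hL ha.height_le t p
    · have := norm_profile_flow_sub_le hc ha.bound hA hL ha.height_le hW t p
      fin_cases W
      · exact this
      · exact this
      · exact absurd rfl hW
  have h3 : 32 * c ≤ profileConst c A L W := by
    fin_cases W <;> simp [profileConst] <;> nlinarith
  rcases min_cases 1 (gauge W t) with ⟨e, _⟩ | ⟨e, _⟩ <;> rw [e]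
  · linarith
  · exact h2

lemma Admissible.rpow_le_norm_assemble_sub (ha : Admissible c A L h N) (hl : Ladder Q M ε)
    (hQ : Q = A ^ N) (hMA : M ^ 2 ≤ A) {m j₀ : ℤ} {n : ℕ} (hn1 : 1 ≤ n) (hn : n ≤ N)
    (hm : m = N * j₀ - n) {t : ℝ} (ht1 : A ^ m ≤ √|t|) (ht2 : √|t| ≤ 2 * A ^ m) (p : H)
    (hsep : 2 / 5 ≤ |h (dilate (A ^ m)⁻¹ (flowZ t p)) - h (dilate (A ^ m)⁻¹ p)|) :
    √|t| ^ (1 - ε) ≤ 80 * M * ‖assemble Q M (profile A L h N) (flowZ t p)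
      - assemble Q M (profile A L h N) p‖ := by
  have hM1 := hl.large
  have hM : 0 < M := by linarith
  have hQ0 := hl.base_pos
  have hMQ := hl.sq_le
  have hc := ha.one_le
  have hA := ha.two_le
  have hA0 : 0 < A := by linarith
  have hQM : 0 < Q / M := by positivity
  rw [ha.tame.assemble_sub ha.profileConst_nonneg hl]
  set a := A ^ m with hadef
  set w := M ^ (-j₀) with hw
  have ha0 : 0 < a := zpow_pos hA0 _
  have hw0 : 0 < w := zpow_pos hM _
  have hs0 := Real.sqrt_nonneg |t|
  have hss : √|t| * √|t| = |t| := Real.mul_self_sqrt (abs_nonneg t)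
  have hQj : Q ^ j₀ = a * A ^ n := by
    rw [hadef, hm, hQ, ← zpow_natCast, ← zpow_natCast, ← zpow_mul, ← zpow_add₀ hA0.ne']
    congr 1; ring
  have hAnQ : A ^ n ≤ Q := by rw [hQ]; exact pow_le_pow_right₀ (by linarith) hn
  have hAn : A ≤ A ^ n := le_self_pow₀ (by linarith) (by omega)
  have hAn0 : 0 < A ^ n := by positivity
  have ht4 : |t| ≤ 4 * a ^ 2 := by nlinarith
  have hdil : ∀ q, dilate (A ^ n) (dilate (Q ^ j₀)⁻¹ q) = dilate a⁻¹ q := fun q => by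
    rw [dilate_dilate, hQj]; congr 1; field_simp
  have hmain : 1 / 20 * (w * a)
      ≤ ‖increment Q M (profile A L h N) (flowZ t p) p j₀‖ := by
    have := le_norm_profile_flowZ_sub (A := A) (t := (Q ^ j₀)⁻¹ ^ 2 * t) hc ha.bound
      (by linarith [ha.le_mul]) ha.le_slope ha.height_le hn1 hn
      (by
        rw [abs_mul, abs_of_nonneg (by positivity), hQj]
        calc (A ^ n) ^ 2 * ((a * A ^ n)⁻¹ ^ 2 * |t|)
            ≤ (A ^ n) ^ 2 * ((a * A ^ n)⁻¹ ^ 2 * (4 * a ^ 2)) := by gcongr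
          _ = 4 := by field_simp)
      (dilate (Q ^ j₀)⁻¹ p) (by rwa [← flowZ_dilate, hdil, hdil])
    rw [norm_increment hl, flowZ_dilate]
    calc _ = (Q / M) ^ j₀ * (1 / 20 * (A ^ n)⁻¹) := by
          rw [div_zpow, hQj, hw, zpow_neg]; field_simp
      _ ≤ _ := by gcongr
  have herr := norm_le_norm_tsum_add (q := M⁻¹) (C := 32 * c * M ^ 2 / A * (w * a)) (j₀ := j₀)
    (f := increment Q M (profile A L h N) (flowZ t p) p) (by positivity)
    (by rw [inv_le_comm₀ hM (by norm_num)]; linarith) (by positivity)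
    (ha.tame.increment ha.profileConst_nonneg hl _ p).1 (by
      intro j hj
      rw [norm_increment hl]
      rcases lt_or_gt_of_ne hj with h' | h'
      · rw [inv_pow_natAbs_of_ge h'.le]
        obtain ⟨k, rfl⟩ : ∃ k : ℕ, j = j₀ - (k + 1 : ℕ) := ⟨(j₀ - j - 1).toNat, by omega⟩
        have hfac : (M ^ 2 / Q) ^ (k + 1) ≤ M ^ 2 / Q :=
          pow_le_of_le_one (by positivity) (by rw [div_le_one hQ0]; exact hMQ) (by omega)
        calc _ ≤ (Q / M) ^ (j₀ - (k + 1 : ℕ)) * (32 * c / A) := by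
              gcongr; exact ha.norm_profile_sub_le _ _
          _ = 32 * c / A * w * Q ^ j₀ * (M ^ 2 / Q) ^ (k + 1) * M ^ (-((k + 1 : ℕ) : ℤ)) := by
              rw [zpow_sub₀ hQM.ne', div_zpow, hw, zpow_neg, zpow_neg, zpow_natCast, zpow_natCast]
              simp only [div_pow]
              field_simp
              ring
          _ ≤ 32 * c / A * w * (a * Q) * (M ^ 2 / Q) * M ^ (-((k + 1 : ℕ) : ℤ)) := by
              rw [hQj]; gcongr
          _ = _ := by
              rw [show j₀ - ((k + 1 : ℕ) : ℤ) - j₀ = -((k + 1 : ℕ) : ℤ) by ring]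
              field_simp
      · rw [inv_pow_natAbs_of_le h'.le]
        have hQj' : 0 < Q ^ j := zpow_pos hQ0 j
        have hstep : Q * (Q ^ j)⁻¹ ≤ (a * A ^ n)⁻¹ := by
          rw [← hQj, ← div_eq_mul_inv, ← one_div, div_le_div_iff₀ hQj' (zpow_pos hQ0 _), one_mul,
            ← zpow_one_add₀ hQ0.ne']
          exact zpow_le_zpow_right₀ hl.one_lt.le (by omega)
        have := norm_profile_flowZ_sub_le hc ha.bound hA ha.slope ha.height_le
          ((Q ^ j)⁻¹ ^ 2 * t) (dilate (Q ^ j)⁻¹ p)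
        rw [← flowZ_dilate, abs_mul, abs_of_nonneg (by positivity), ← hQ] at this
        calc _ ≤ (Q / M) ^ j * (22 * c * Q * ((Q ^ j)⁻¹ ^ 2 * |t|)) := by gcongr
          _ = 22 * c * |t| * (Q * (Q ^ j)⁻¹) * (w * M ^ (j₀ - j)) := by
              rw [div_zpow, hw, zpow_neg, zpow_sub₀ hM.ne']; field_simp
          _ ≤ 22 * c * (4 * a ^ 2) * (a * A)⁻¹ * (w * M ^ (j₀ - j)) := by
              have : (a * A ^ n)⁻¹ ≤ (a * A)⁻¹ := by gcongr
              have := hstep.trans this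
              gcongr
          _ = 88 * c / A * (w * a) * M ^ (j₀ - j) := by field_simp; ring
          _ ≤ _ := by
              have : 4 ≤ M ^ 2 := by nlinarith
              gcongr ?_ / A * _ * _
              nlinarith)
  have he2 : 4 * (32 * c * M ^ 2 / A * (w * a)) * M⁻¹ ≤ 1 / 40 * (w * a) := by
    have h1 : (5120 * c * M) ^ 2 ≤ A ^ 2 := by
      have : 5120 ^ 2 * c ^ 2 ≤ A := by nlinarith [ha.le_base, sq_nonneg c]
      calc (5120 * c * M) ^ 2 = 5120 ^ 2 * c ^ 2 * M ^ 2 := by ring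
        _ ≤ A * A := by gcongr
        _ = _ := by ring
    have h2 : 5120 * c * M ≤ A := le_of_sq_le_sq h1 hA0.le
    have h3 : c * M / A ≤ 1 / 5120 := by
      rw [div_le_div_iff₀ hA0 (by norm_num)]; linarith
    calc _ = 128 * (w * a) * (c * M / A) := by field_simp; ring
      _ ≤ 128 * (w * a) * (1 / 5120) := by gcongr
      _ = _ := by ring
  have hlow : Q ^ (j₀ - 1) ≤ √|t| := by
    refine le_trans ?_ ht1
    rw [hadef, hm, hQ, ← zpow_natCast, ← zpow_mul]
    exact zpow_le_zpow_right₀ (by linarith) (by linarith [(Int.ofNat_le.mpr hn)])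
  have hfin := hl.rpow_le hlow
  rw [← hw] at hfin
  calc _ ≤ M * (√|t| * w) := hfin
    _ ≤ M * (2 * a * w) := by gcongr
    _ = 80 * M * (1 / 40 * (w * a)) := by ring
    _ ≤ _ := by
        gcongr
        linarith

lemma exists_rpow_le_norm_homogenize_sub {ι : Type*} {h : ι → H → ℝ}
    (hosc : ∀ t p, 1 ≤ |t| → |t| ≤ 4 → ∃ b, 2 / 5 ≤ |h b (flowZ t p) - h b p|)
    (ha : ∀ b, Admissible c A L (h b) N) (hN : 1 ≤ N) {J : ℕ} (hJ : A = 2 ^ J)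
    (hl : Ladder Q M ε) (hQ : Q = A ^ N) (hMA : M ^ 2 ≤ A) {t : ℝ} (ht : t ≠ 0) (p : H) :
    ∃ (b : ι) (i : Fin J), √|t| ^ (1 - ε) ≤
      80 * M * ‖homogenize ε (2 ^ (i : ℕ)) (assemble Q M (profile A L (h b) N)) (flowZ t p)
        - homogenize ε (2 ^ (i : ℕ)) (assemble Q M (profile A L (h b) N)) p‖ := by
  have hs : 0 < √|t| := Real.sqrt_pos.mpr (abs_pos.mpr ht)
  have hA0 : 0 < A := by rw [hJ]; positivity
  have hA1 : 1 < A := by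
    have := hl.large
    nlinarith
  have hJ0 : J ≠ 0 := by rintro rfl; norm_num at hJ; linarith
  obtain ⟨μ, h1, h2⟩ := exists_mem_Ico_zpow hs one_lt_two
  obtain ⟨m, i, hm⟩ : ∃ (m : ℤ) (i : Fin J), μ = J * m + (i : ℕ) := by
    have hJ1 : (0 : ℤ) < J := by omega
    have e1 := Int.emod_nonneg μ hJ1.ne'
    have e2 := Int.emod_lt_of_pos μ hJ1
    have e3 := Int.mul_ediv_add_emod μ J
    exact ⟨μ / J, ⟨(μ % J).toNat, by omega⟩, by simp only [Int.toNat_of_nonneg e1]; exact e3.symm⟩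
  obtain ⟨j₀, n, hn1, hn, hmj⟩ : ∃ (j₀ : ℤ) (n : ℕ), 1 ≤ n ∧ n ≤ N ∧ m = N * j₀ - n := by
    have hN1 : (0 : ℤ) < N := by omega
    have e1 := Int.emod_nonneg m hN1.ne'
    have e2 := Int.emod_lt_of_pos m hN1
    have e3 := Int.mul_ediv_add_emod m N
    refine ⟨m / N + 1, (N - m % N).toNat, by omega, by omega, ?_⟩
    rw [Int.toNat_of_nonneg (by omega)]
    linear_combination -e3
  have hθ : (0 : ℝ) < 2 ^ (i : ℕ) := by positivity
  set θ : ℝ := 2 ^ (i : ℕ) with hθdef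
  have hμ : (2 : ℝ) ^ μ = θ * A ^ m := by
    rw [hm, zpow_add₀ two_ne_zero, zpow_mul, zpow_natCast, zpow_natCast, hJ, mul_comm]
  have hsq : √|θ⁻¹ ^ 2 * t| = θ⁻¹ * √|t| := gauge_pow_wt_mul (inv_pos.mpr hθ).le 2 t
  have ha0 : 0 < A ^ m := zpow_pos hA0 m
  have ht1 : A ^ m ≤ √|θ⁻¹ ^ 2 * t| := by
    rw [hsq, le_inv_mul_iff₀ hθ, ← hμ]; exact h1
  have ht2 : √|θ⁻¹ ^ 2 * t| ≤ 2 * A ^ m := by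
    rw [hsq, inv_mul_le_iff₀ hθ]
    rw [zpow_add_one₀ two_ne_zero, hμ] at h2
    linarith
  have hs2 : √|(A ^ m)⁻¹ ^ 2 * (θ⁻¹ ^ 2 * t)| = (A ^ m)⁻¹ * √|θ⁻¹ ^ 2 * t| :=
    gauge_pow_wt_mul (inv_pos.mpr ha0).le 2 _
  obtain ⟨b, hb⟩ := hosc ((A ^ m)⁻¹ ^ 2 * (θ⁻¹ ^ 2 * t)) (dilate (A ^ m)⁻¹ (dilate θ⁻¹ p))
    (by
      rw [← Real.one_le_sqrt, hs2, le_inv_mul_iff₀ ha0]; linarith)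
    (by
      rw [← Real.sqrt_le_sqrt_iff (by norm_num), hs2, inv_mul_le_iff₀ ha0,
        show √(4 : ℝ) = 2 by
          rw [show (4 : ℝ) = 2 ^ 2 by norm_num]; exact Real.sqrt_sq (by norm_num)]
      linarith)
  rw [← flowZ_dilate] at hb
  refine ⟨b, i, ?_⟩
  have := (ha b).rpow_le_norm_assemble_sub hl hQ hMA hn1 hn hmj ht1 ht2 (dilate θ⁻¹ p) hb
  rw [norm_homogenize_sub hθ, flowZ_dilate]
  have hθ' : 0 < θ ^ (1 - ε) := Real.rpow_pos_of_pos hθ _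
  calc √|t| ^ (1 - ε) = θ ^ (1 - ε) * √|θ⁻¹ ^ 2 * t| ^ (1 - ε) := by
        rw [hsq, ← Real.mul_rpow hθ.le (by positivity), mul_inv_cancel_left₀ hθ.ne']
    _ ≤ _ := mul_le_mul_of_nonneg_left this hθ'.le
    _ = _ := by ring

end Vertical

section Embedding

/-- The target space of `embedding`. -/
abbrev Target (J : ℕ) : Type :=
  ((Bool × Bool) × Fin J → Fin 3 → ℝ) × ({W : Fin 3 // W ≠ 2} × Fin 4 → ℂ)

/-- All the homogenized profiles and circular oscillations, as a single map. -/
def embedding (ε Q M S A k : ℝ) (h : Bool × Bool → H → ℝ) (N J : ℕ) (p : H) : Target J :=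
  (fun b => homogenize ε (2 ^ (b.2 : ℕ)) (assemble Q M (profile A (k * √N) (h b.1) N)) p,
    fun b => homogenize ε (S ^ (b.2 : ℕ)) (assemble Q M (circ (√N) b.1)) p)

/-- The quantity comparable to the distances in the image of `embedding`. -/
def anisotropic (ε : ℝ) (N : ℕ) (p q : H) : ℝ :=
  √N * (sep p q 0 ^ (1 - ε) + sep p q 1 ^ (1 - ε)) + sep p q 2 ^ (1 - ε)

variable {ε Q M S A k c : ℝ} {h : Bool × Bool → H → ℝ} {N J : ℕ}

lemma norm_embedding_sub_le (ha : ∀ b, Admissible c A (k * √N) (h b) N) (hl : Ladder Q M ε)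
    (hMA : M ≤ A) (hk : 0 ≤ k) (hS : 0 < S) (p q : H) :
    ‖embedding ε Q M S A k h N J p - embedding ε Q M S A k h N J q‖
      ≤ 2 * A * (3 * k + 54 * c * A + 2) * anisotropic ε N p q := by
  have hM : 0 < M := by linarith [hl.large]
  have hc := (ha default).one_le
  have hr := Real.sqrt_nonneg (N : ℝ)
  have hu0 := Real.rpow_nonneg (sep_nonneg p q 0) (1 - ε)
  have hu1 := Real.rpow_nonneg (sep_nonneg p q 1) (1 - ε)
  have hu2 := Real.rpow_nonneg (sep_nonneg p q 2) (1 - ε)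
  have hA : 0 < A := by linarith
  have haux : ∀ C : Fin 3 → ℝ, ∑ W, C W * sep p q W ^ (1 - ε)
        ≤ (3 * k + 54 * c * A + 2) * anisotropic ε N p q →
      2 * M * ∑ W, C W * sep p q W ^ (1 - ε)
        ≤ 2 * A * (3 * k + 54 * c * A + 2) * anisotropic ε N p q := by
    intro C hC
    have : 0 ≤ anisotropic ε N p q := by unfold anisotropic; positivity
    calc _ ≤ 2 * M * ((3 * k + 54 * c * A + 2) * anisotropic ε N p q) := by gcongr
      _ ≤ 2 * A * ((3 * k + 54 * c * A + 2) * anisotropic ε N p q) := by gcongr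
      _ = _ := by ring
  have hrhs : 0 ≤ 2 * A * (3 * k + 54 * c * A + 2) * anisotropic ε N p q := by
    unfold anisotropic; positivity
  refine max_le ((pi_norm_le_iff_of_nonneg hrhs).mpr fun b => ?_)
    ((pi_norm_le_iff_of_nonneg hrhs).mpr fun b => ?_)
  · refine (norm_homogenize_sub_le (by positivity)
      ((ha b.1).tame.norm_assemble_sub_le (ha b.1).profileConst_nonneg hl) p q).trans (haux _ ?_)
    rw [Fin.sum_univ_three]
    simp only [profileConst, Matrix.cons_val, anisotropic]
    have hcA : 0 ≤ 54 * c * A := by positivity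
    nlinarith [mul_nonneg hr hu0, mul_nonneg hr hu1, mul_nonneg hk hu2,
      mul_nonneg hcA (mul_nonneg hr hu0), mul_nonneg hcA (mul_nonneg hr hu1)]
  · refine (norm_homogenize_sub_le (by positivity)
      ((tame_circ hr b.1.2).norm_assemble_sub_le (circConst_nonneg hr b.1) hl) p q).trans
        (haux _ ?_)
    have hcA : 0 ≤ 3 * k + 54 * c * A := by positivity
    have han : 0 ≤ anisotropic ε N p q := by unfold anisotropic; positivity
    have : ∑ W, circConst (√N) b.1 W * sep p q W ^ (1 - ε) ≤ 2 * anisotropic ε N p q := by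
      simp only [circConst, ite_mul, zero_mul, Finset.sum_ite_eq', Finset.mem_univ, if_true,
        anisotropic]
      obtain ⟨⟨W, hW⟩, i⟩ := b
      fin_cases W
      · simp only [Fin.zero_eta]
        nlinarith [mul_nonneg hr hu1]
      · simp only [Fin.mk_one]
        nlinarith [mul_nonneg hr hu0]
      · exact absurd rfl hW
    nlinarith [mul_nonneg hcA han]

lemma anisotropic_le (hosc : ∀ t p, 1 ≤ |t| → |t| ≤ 4 → ∃ b, 2 / 5 ≤ |h b (flowZ t p) - h b p|)
    (ha : ∀ b, Admissible c A (k * √N) (h b) N) (hN : 1 ≤ N) (hJ : A = 2 ^ J)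
    (hl : Ladder Q M ε) (hQ : Q = A ^ N) (hMA : M ^ 2 ≤ A) (hk : 0 ≤ k)
    (hS0 : 0 < S) (hS : S ^ 4 = Q) (p q : H) :
    anisotropic ε N p q ≤ (7 * A + 80 * A * (1 + 42 * k * A ^ 2)) *
      ‖embedding ε Q M S A k h N J p - embedding ε Q M S A k h N J q‖ := by
  have hM : 1024 ≤ M := hl.large
  have hMA' : M ≤ A := by nlinarith
  have hA : 0 < A := by linarith
  have hr := Real.sqrt_nonneg (N : ℝ)
  have hu0 := Real.rpow_nonneg (sep_nonneg p q 0) (1 - ε)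
  have hu1 := Real.rpow_nonneg (sep_nonneg p q 1) (1 - ε)
  set R := ‖embedding ε Q M S A k h N J p - embedding ε Q M S A k h N J q‖ with hR
  have hR0 : 0 ≤ R := norm_nonneg _
  have hhor : ∀ W : Fin 3, W ≠ 2 → √N * sep p q W ^ (1 - ε) ≤ 7 / 2 * A * R := by
    intro W hW
    obtain ⟨i, hi⟩ := exists_le_norm_homogenize_circ_sub hl hS0 hS hr hW p q
    have h1 : ‖homogenize ε (S ^ (i : ℕ)) (assemble Q M (circ (√N) W)) p
        - homogenize ε (S ^ (i : ℕ)) (assemble Q M (circ (√N) W)) q‖ ≤ R :=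
      (norm_le_pi_norm (embedding ε Q M S A k h N J p - embedding ε Q M S A k h N J q).2
        (⟨W, hW⟩, i)).trans (norm_snd_le _)
    have h2 : 3 / 10 * (√N * sep p q W ^ (1 - ε)) ≤ A * R := hi.trans (by gcongr)
    nlinarith [mul_nonneg hA.le hR0]
  have hH : √N * (sep p q 0 ^ (1 - ε) + sep p q 1 ^ (1 - ε)) ≤ 7 * A * R := by
    linarith [hhor 0 (by decide), hhor 1 (by decide)]
  have hV : sep p q 2 ^ (1 - ε) ≤ 80 * A * (1 + 42 * k * A ^ 2) * R := by
    set v := mul p (inv q) with hv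
    have hsep2 : sep p q 2 = √|v.2.2| := rfl
    by_cases hz : v.2.2 = 0
    · rw [hsep2, hz, abs_zero, Real.sqrt_zero, Real.zero_rpow (by linarith [hl.le_half])]
      positivity
    · set q' := flowY v.2.1 (flowX v.1 q) with hq'
      have hp : flowZ v.2.2 q' = p := (eq_flowZ_flowY_flowX p q).symm
      obtain ⟨b, i, hi⟩ := exists_rpow_le_norm_homogenize_sub hosc ha hN hJ hl hQ hMA hz q'
      rw [hp, ← hsep2] at hi
      set T := homogenize ε (2 ^ (i : ℕ)) (assemble Q M (profile A (k * √N) (h b) N)) with hT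
      have h1 : ‖T p - T q‖ ≤ R :=
        (norm_le_pi_norm (embedding ε Q M S A k h N J p - embedding ε Q M S A k h N J q).1
          (b, i)).trans (norm_fst_le _)
      have hs : sep q' q = ![sep p q 0, sep p q 1, 0] := by
        have e : mul q' (inv q) = (v.1, v.2.1, 0) := by
          simp only [hq', mul, inv, flowX, flowY]
          ext <;> simp
          ring
        simp only [sep, e, ← hv]
        simp
      have h2 : ‖T q' - T q‖ ≤ 6 * k * A * (7 * A * R) := by
        refine (norm_homogenize_sub_le (by positivity)
          ((ha b).tame.norm_assemble_sub_le (ha b).profileConst_nonneg hl) q' q).trans ?_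
        rw [Fin.sum_univ_three, hs]
        simp only [profileConst, Matrix.cons_val]
        rw [Real.zero_rpow (by linarith [hl.le_half])]
        calc _ = 6 * k * M * (√N * (sep p q 0 ^ (1 - ε) + sep p q 1 ^ (1 - ε))) := by ring
          _ ≤ _ := by gcongr
      have h3 : ‖T p - T q'‖ ≤ R + 6 * k * A * (7 * A * R) := by
        rw [← sub_sub_sub_cancel_right _ _ (T q)]
        exact (norm_sub_le _ _).trans (add_le_add h1 h2)
      calc _ ≤ 80 * M * ‖T p - T q'‖ := hi
        _ ≤ 80 * A * (R + 6 * k * A * (7 * A * R)) := by gcongr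
        _ = _ := by ring
  rw [anisotropic, add_mul]
  exact add_le_add hH hV

lemma Feps_eq (ε : ℝ) (p q : H) :
    Feps ε (mul p (inv q)) = ε ^ (-(1 / 2 : ℝ)) * (sep p q 0 ^ (1 - ε) + sep p q 1 ^ (1 - ε))
      + sep p q 2 ^ (1 - ε) := by
  simp only [Feps, sep, Matrix.cons_val]
  rw [Real.sqrt_eq_rpow, ← Real.rpow_mul (abs_nonneg _),
    show 1 / 2 * (1 - ε) = (1 - ε) / 2 by ring]
  ring

lemma anisotropic_le_Feps (hε : 0 < ε) (hN : N * ε ≤ 1) (p q : H) :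
    anisotropic ε N p q ≤ Feps ε (mul p (inv q)) := by
  have hu0 := Real.rpow_nonneg (sep_nonneg p q 0) (1 - ε)
  have hu1 := Real.rpow_nonneg (sep_nonneg p q 1) (1 - ε)
  rw [Feps_eq, anisotropic, Real.rpow_neg hε.le, ← Real.sqrt_eq_rpow, ← Real.sqrt_inv]
  gcongr
  rwa [← one_div, le_div_iff₀ hε]

lemma Feps_le_anisotropic (hε : 0 < ε) (hN : 1 ≤ 4 * (N * ε)) (p q : H) :
    Feps ε (mul p (inv q)) ≤ 2 * anisotropic ε N p q := by
  have hu0 := Real.rpow_nonneg (sep_nonneg p q 0) (1 - ε)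
  have hu1 := Real.rpow_nonneg (sep_nonneg p q 1) (1 - ε)
  have hu2 := Real.rpow_nonneg (sep_nonneg p q 2) (1 - ε)
  have h : √ε⁻¹ ≤ 2 * √N := by
    rw [Real.sqrt_le_left (by positivity), mul_pow, Real.sq_sqrt (Nat.cast_nonneg N), ← one_div,
      div_le_iff₀ hε]
    linarith
  rw [Feps_eq, anisotropic, Real.rpow_neg hε.le, ← Real.sqrt_eq_rpow, ← Real.sqrt_inv]
  nlinarith [mul_le_mul_of_nonneg_right h (add_nonneg hu0 hu1)]

lemma exists_ladder (hA : 2 ^ 40 ≤ A) (hε : 0 < ε) (hε' : ε ≤ 1 / 2)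
    (hN : 1 ≤ 4 * (N * ε)) (hN' : N * ε ≤ 1 / 2) :
    ∃ M S : ℝ, Ladder (A ^ N) M ε ∧ M ^ 2 ≤ A ∧ 0 < S ∧ S ^ 4 = A ^ N := by
  have hA0 : 0 < A := by linarith
  have hA1 : 1 ≤ A := by linarith
  have hM : (A ^ N) ^ ε = A ^ (N * ε) := by
    rw [← Real.rpow_natCast, ← Real.rpow_mul hA0.le]
  refine ⟨(A ^ N) ^ ε, (A ^ N) ^ (1 / 4 : ℝ), ⟨hε, hε', by positivity, rfl, ?_⟩, ?_,
    by positivity, ?_⟩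
  · rw [hM]
    calc (1024 : ℝ) = (2 ^ 40) ^ (1 / 4 : ℝ) := by
          rw [← Real.rpow_natCast, ← Real.rpow_mul (by norm_num)]
          norm_num
      _ ≤ A ^ (1 / 4 : ℝ) := by gcongr
      _ ≤ _ := Real.rpow_le_rpow_of_exponent_le hA1 (by linarith)
  · rw [hM, ← Real.rpow_natCast, ← Real.rpow_mul hA0.le]
    calc A ^ (N * ε * (2 : ℕ)) ≤ A ^ (1 : ℝ) :=
          Real.rpow_le_rpow_of_exponent_le hA1 (by push_cast; linarith)
      _ = A := Real.rpow_one A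
  · rw [← Real.rpow_natCast, ← Real.rpow_mul (by positivity)]
    norm_num

theorem exists_map_target :
    ∃ (J : ℕ) (C : ℝ), 0 < C ∧ ∀ ε : ℝ, 0 < ε → ε ≤ 1 / 2 → ∃ Ψ : H → Target J, ∀ p q : H,
      Feps ε (mul p (inv q)) ≤ C * ‖Ψ p - Ψ q‖ ∧ ‖Ψ p - Ψ q‖ ≤ C * Feps ε (mul p (inv q)) := by
  obtain ⟨c, h, hc, hbound, hosc⟩ := exists_oscillations
  obtain ⟨J, hJ⟩ := pow_unbounded_of_one_lt (2 ^ 40 * c ^ 2) (one_lt_two (α := ℝ))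
  set A : ℝ := 2 ^ J with hA
  have hAc : 2 ^ 40 ≤ A := by nlinarith
  have hA0 : 0 < A := by linarith
  set k := 140800 * c ^ 2 with hk
  have hk0 : 0 < k := by positivity
  refine ⟨J, 2 * (7 * A + 80 * A * (1 + 42 * k * A ^ 2))
    + 2 * A * (3 * k + 54 * c * A + 2), by positivity, fun ε hε hε' => ?_⟩
  obtain ⟨N, hN1, hN2⟩ : ∃ N : ℕ, 1 ≤ 4 * (N * ε) ∧ N * ε ≤ 1 / 2 := by
    have h1 : 1 ≤ 1 / (2 * ε) := by rw [le_div_iff₀ (by positivity)]; linarith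
    have h2 := Nat.floor_le (a := 1 / (2 * ε)) (by positivity)
    have h3 := Nat.lt_floor_add_one (1 / (2 * ε))
    have h4 : (1 : ℝ) ≤ ⌊1 / (2 * ε)⌋₊ := by exact_mod_cast Nat.le_floor (by simpa using h1)
    rw [le_div_iff₀ (by positivity)] at h2
    rw [div_lt_iff₀ (by positivity)] at h3
    exact ⟨_, by nlinarith, by linarith⟩
  have hN : 1 ≤ N := by
    rcases Nat.eq_zero_or_pos N with rfl | h0
    · norm_num at hN1
    · exact h0
  obtain ⟨M, S, hl, hMA, hS0, hS⟩ := exists_ladder hAc hε hε' hN1 hN2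
  have hMA' : M ≤ A := by nlinarith [hl.large]
  have hNr : (1 : ℝ) ≤ N := by exact_mod_cast hN
  have ha : ∀ b, Admissible c A (k * √N) (h b) N := by
    intro b
    refine ⟨hc, hbound b, hJ.le, le_mul_of_one_le_right hk0.le (Real.one_le_sqrt.mpr hNr), ?_⟩
    rw [mul_pow, Real.sq_sqrt (by linarith)]
    have h1 : 5600 * c ^ 2 ≤ k ^ 2 / 4 := by
      have : 1 ≤ c ^ 2 := one_le_pow₀ hc
      nlinarith
    nlinarith
  refine ⟨embedding ε (A ^ N) M S A k h N J, fun p q => ?_⟩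
  have hup := norm_embedding_sub_le (J := J) ha hl hMA' hk0.le hS0 p q
  have hlow := anisotropic_le hosc ha hN hA hl rfl hMA hk0.le hS0 hS p q
  have h1 := anisotropic_le_Feps hε (by linarith) p q
  have h2 := Feps_le_anisotropic hε hN1 p q
  set R := ‖embedding ε (A ^ N) M S A k h N J p - embedding ε (A ^ N) M S A k h N J q‖
  have hR : 0 ≤ R := norm_nonneg _
  have hB1 : 0 ≤ 7 * A + 80 * A * (1 + 42 * k * A ^ 2) := by positivity
  have hB2 : 0 ≤ 2 * A * (3 * k + 54 * c * A + 2) := by positivity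
  have hF : 0 ≤ Feps ε (mul p (inv q)) := by unfold Feps; positivity
  constructor
  · calc _ ≤ 2 * ((7 * A + 80 * A * (1 + 42 * k * A ^ 2)) * R) := by linarith
      _ ≤ _ := by rw [add_mul]; nlinarith [mul_nonneg hB2 hR]
  · calc R ≤ 2 * A * (3 * k + 54 * c * A + 2) * Feps ε (mul p (inv q)) := hup.trans (by gcongr)
      _ ≤ _ := by rw [add_mul]; nlinarith [mul_nonneg hB1 hF]

end Embedding

end Heisenberg

/-- **A refined embedding** (Remark 4.1 of the paper): there is a bounded dimension `D`
and a constant `C` so that for each `0 < ε ≤ 1/2` one can find `Φ : H → ℝ^D` with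
`|Φ(p) - Φ(q)| ≍ F_ε(p·q⁻¹)` uniformly. -/
theorem statement18 :
    ∃ (D : ℕ) (C : ℝ), 1 ≤ C ∧
      ∀ ε : ℝ, 0 < ε → ε ≤ 1 / 2 →
        ∃ Φ : H → EuclideanSpace ℝ (Fin D),
          ∀ p q : H,
            C⁻¹ * Feps ε (mul p (inv q)) ≤ ‖Φ p - Φ q‖ ∧
            ‖Φ p - Φ q‖ ≤ C * Feps ε (mul p (inv q)) := by
  obtain ⟨J, C, hC, hmap⟩ := exists_map_target
  let e : Target J ≃L[ℝ] EuclideanSpace ℝ (Fin (Module.finrank ℝ (Target J))) := toEuclidean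
  set a := ‖e.toContinuousLinearMap‖
  set b := ‖e.symm.toContinuousLinearMap‖
  have ha : 0 ≤ a := norm_nonneg _
  have hb : 0 ≤ b := norm_nonneg _
  refine ⟨Module.finrank ℝ (Target J), 1 + C * a + C * b,
    by linarith [mul_nonneg hC.le ha, mul_nonneg hC.le hb], fun ε hε hε' => ?_⟩
  obtain ⟨Ψ, hΨ⟩ := hmap ε hε hε'
  refine ⟨fun p => e (Ψ p), fun p q => ?_⟩
  obtain ⟨h1, h2⟩ := hΨ p q
  have hF : 0 ≤ Feps ε (mul p (inv q)) := by unfold Feps; positivity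
  have e1 : ‖e (Ψ p) - e (Ψ q)‖ ≤ a * ‖Ψ p - Ψ q‖ := by
    rw [← map_sub]
    exact e.toContinuousLinearMap.le_opNorm _
  have e2 : ‖Ψ p - Ψ q‖ ≤ b * ‖e (Ψ p) - e (Ψ q)‖ := by
    have := e.symm.toContinuousLinearMap.le_opNorm (e (Ψ p) - e (Ψ q))
    simpa [← map_sub] using this
  have hn := norm_nonneg (e (Ψ p) - e (Ψ q))
  constructor
  · rw [inv_mul_le_iff₀ (by positivity)]
    calc _ ≤ C * (b * ‖e (Ψ p) - e (Ψ q)‖) := h1.trans (by gcongr)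
      _ ≤ _ := by nlinarith [mul_nonneg (mul_nonneg hC.le ha) hn]
  · calc _ ≤ a * (C * Feps ε (mul p (inv q))) := e1.trans (by gcongr)
      _ ≤ _ := by nlinarith [mul_nonneg (mul_nonneg hC.le hb) hF]
end
end
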